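/- Let A = kQ/I be a simply connected toupie algebra with m = dim_k e_0 A e_∞ ≥ 3 and t = m + 1 branches. If at least two branches of Q have length at least three, then A is not a laura algebra; if at most one branch of Q has length at least three, then A is tilted. -/

import Mathlib

/-!
Formalization preamble for "Toupie algebras".

We realize the bound quiver algebra `A = kQ/I` of a toupie quiver `Q` concretely:
the path algebra `kQ` is realized, via its (faithful) left regular representation,
as the subalgebra of `Module.End k (paths → k)` generated by the operators of left
multiplication by the trivial paths `e_v` and by the arrows of `Q`.  Paths are
composed from left to right (`p * q` = "first `p`, then `q`"), as in
Assem–Simson–Skowroński, so that paths from the source `0` to the sink `∞` span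
`e₀ (kQ) e∞`, and (right) `A`-modules are identified with representations of `(Q, I)`.
Right `A`-modules are formalized as (left) modules over `Aᵐᵒᵖ`.
-/

set_option synthInstance.maxHeartbeats 400000
set_option maxHeartbeats 800000

noncomputable section
open scoped Classical
open MulOpposite

universe u

namespace Toupie

/-- Vertices of a toupie quiver with `t` branches, branch `i` having length `ℓ i ≥ 1`:
the unique source `src`, the unique sink `snk`, and for each branch `i` its interior
vertices `mid i a` (the `(a+1)`-st vertex on branch `i`, for `a : Fin (ℓ i - 1)`). -/
inductive Vtx (t : ℕ) (ℓ : Fin t → ℕ) : Type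
  | src : Vtx t ℓ
  | snk : Vtx t ℓ
  | mid (i : Fin t) (a : Fin (ℓ i - 1)) : Vtx t ℓ

/-- The `a`-th vertex on branch `i`, for `0 ≤ a ≤ ℓ i`
(`a = 0` is the source, `a = ℓ i` is the sink). -/
def vtx (t : ℕ) (ℓ : Fin t → ℕ) (i : Fin t) (a : ℕ) : Vtx t ℓ :=
  if a = 0 then .src else if h : a - 1 < ℓ i - 1 then .mid i ⟨a - 1, h⟩ else .snk

/-- The paths of a toupie quiver: trivial paths at the vertices, and for each branch
`i` and `a < b ≤ ℓ i` the path `sub i a b` along branch `i` from its `a`-th vertex to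
its `b`-th vertex.  (`sub i 0 (ℓ i)` is the `i`-th branch `w i`.) -/
inductive PIdx (t : ℕ) (ℓ : Fin t → ℕ) : Type
  | vert (v : Vtx t ℓ) : PIdx t ℓ
  | sub (i : Fin t) (a b : ℕ) (hab : a < b) (hb : b ≤ ℓ i) : PIdx t ℓ

variable (k : Type u) [Field k] (t : ℕ) (ℓ : Fin t → ℕ)

/-- The vector space with basis the set of paths of the toupie quiver. -/
abbrev PSp : Type u := PIdx t ℓ → k

variable {t ℓ}

/-- The starting vertex of a path. -/
def startIdx : PIdx t ℓ → Vtx t ℓ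
  | .vert v => v
  | .sub i a _ _ _ => vtx t ℓ i a

/-- Left multiplication by the trivial path (primitive idempotent) `e_v`. -/
def Ev (v : Vtx t ℓ) : Module.End k (PSp k t ℓ) where
  toFun f := fun p => if startIdx p = v then f p else 0
  map_add' f g := by funext p; by_cases h : startIdx p = v <;> simp [h]
  map_smul' c f := by funext p; by_cases h : startIdx p = v <;> simp [h]

/-- Strip the `j`-th arrow of branch `i` (the arrow `vtx i j ⟶ vtx i (j+1)`) from the
front of a path, if possible. -/
def strip (i : Fin t) (j : ℕ) : PIdx t ℓ → Option (PIdx t ℓ)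
  | .vert _ => none
  | .sub i' a b _ hb =>
      if h : i' = i ∧ a = j then
        if hb2 : j + 1 < b then some (.sub i (j + 1) b hb2 (h.1 ▸ hb))
        else some (.vert (vtx t ℓ i b))
      else none

/-- Left multiplication by the `j`-th arrow of branch `i`
(the arrow from `vtx i j` to `vtx i (j+1)`, for `j < ℓ i`; the zero operator for junk `j`). -/
def Ar (i : Fin t) (j : ℕ) : Module.End k (PSp k t ℓ) where
  toFun f := fun p => (strip i j p).elim 0 f
  map_add' f g := by funext p; rcases h : strip i j p with _ | q <;> simp [h]
  map_smul' c f := by funext p; rcases h : strip i j p with _ | q <;> simp [h]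

variable (t ℓ)

/-- The generators of the path algebra: the trivial paths and the arrows. -/
def gens : Set (Module.End k (PSp k t ℓ)) :=
  Set.range (Ev k) ∪ {x | ∃ i j, x = Ar k i j}

/-- The path algebra `kQ` of the toupie quiver, realized as the subalgebra of
`Module.End k (PSp k t ℓ)` generated by left multiplication by trivial paths and arrows. -/
def PathAlg : Subalgebra k (Module.End k (PSp k t ℓ)) :=
  Algebra.adjoin k (gens k t ℓ)

variable {k t ℓ}

/-- The trivial path `e_v` as an element of the path algebra. -/
def eV (v : Vtx t ℓ) : PathAlg k t ℓ :=
  ⟨Ev k v, Algebra.subset_adjoin (Or.inl ⟨v, rfl⟩)⟩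

/-- The `j`-th arrow of branch `i` as an element of the path algebra. -/
def arE (i : Fin t) (j : ℕ) : PathAlg k t ℓ :=
  ⟨Ar k i j, Algebra.subset_adjoin (Or.inr ⟨i, j, rfl⟩)⟩

/-- The path along branch `i` from its `a`-th vertex to its `b`-th vertex, as an element
of the path algebra: the product (composed from left to right) of the arrows
`a → a+1 → ⋯ → b`.  (For `b ≤ a` this is the empty product `1`.) -/
def subE (i : Fin t) (a b : ℕ) : PathAlg k t ℓ :=
  (((List.range (b - a)).map fun s => arE i (a + s)).prod)

/-- The `i`-th branch `w i` (the path from the source to the sink along branch `i`)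
as an element of the path algebra. -/
def wE (i : Fin t) : PathAlg k t ℓ := subE i 0 (ℓ i)

variable {k : Type u} [Field k]

/-- A toupie algebra `A = kQ/I`: a toupie quiver `Q` (a non-linear quiver with a unique
source, a unique sink, and all other vertices having exactly one incoming and one
outgoing arrow, i.e. `t ≥ 2` branches of lengths `ℓ i ≥ 1`), together with an admissible
ideal `I` of the path algebra `kQ`.  Since `Q` is finite and acyclic, the arrow ideal is
nilpotent, so admissibility amounts to `I ⊆ R_Q²`, i.e. every element of `I` is a linear
combination of paths of length `≥ 2`. -/
structure ToupieAlg (k : Type u) [Field k] : Type u where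
  t : ℕ
  ht : 2 ≤ t
  ℓ : Fin t → ℕ
  hℓ : ∀ i, 1 ≤ ℓ i
  I : TwoSidedIdeal (PathAlg k t ℓ)
  adm : ∀ x ∈ I, x ∈ Submodule.span k
    {y : PathAlg k t ℓ | ∃ i a b, a + 2 ≤ b ∧ b ≤ ℓ i ∧ y = subE i a b}

variable (T : ToupieAlg k)

/-- The underlying algebra `A = kQ/I` of a toupie algebra. -/
def Alg : Type u := T.I.ringCon.Quotient

instance : Ring (Alg T) := inferInstanceAs (Ring T.I.ringCon.Quotient)

/-- The quotient map `kQ → A = kQ/I`. -/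
def mkA : PathAlg k T.t T.ℓ →+* Alg T := T.I.ringCon.mk'

lemma mkA_surjective : Function.Surjective (mkA T) := Quotient.mk''_surjective

instance : Algebra k (Alg T) :=
  RingHom.toAlgebra' ((mkA T).comp (algebraMap k (PathAlg k T.t T.ℓ)))
    (by
      intro c x
      obtain ⟨y, rfl⟩ := mkA_surjective T x
      simp only [RingHom.coe_comp, Function.comp_apply, ← map_mul]
      rw [Algebra.commutes])

/-- The idempotent `e₀` (at the source) in `A`. -/
def e0 : Alg T := mkA T (eV Vtx.src)

/-- The idempotent `e∞` (at the sink) in `A`. -/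
def einf : Alg T := mkA T (eV Vtx.snk)

/-- The `k`-linear map `A → A`, `x ↦ e₀ * x * e∞`, whose range is `e₀ A e∞`. -/
def lrMap : Alg T →ₗ[k] Alg T where
  toFun x := e0 T * x * einf T
  map_add' x y := by simp [mul_add, add_mul]
  map_smul' c x := by
    simp only [RingHom.id_apply]
    rw [mul_smul_comm, smul_mul_assoc]

/-- `m = dim_k e₀ A e∞`, the dimension of the span of the (residues of the) paths from
the source to the sink. -/
def mDim : ℕ := Module.finrank k ↥(LinearMap.range (lrMap T))

/-- The branch `w i` lies in the ideal `I`. -/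
def branchInI (i : Fin T.t) : Prop := wE i ∈ T.I

/-- A minimal relation: `∑_{i ∈ J} λ i • w i ∈ I` with `|J| ≥ 2`, all `λ i ≠ 0`, and no
nonempty proper subsum in `I`. -/
def MinRel (J : Finset (Fin T.t)) (lam : Fin T.t → k) : Prop :=
  2 ≤ J.card ∧ (∀ i ∈ J, lam i ≠ 0) ∧ (∑ i ∈ J, lam i • wE i) ∈ T.I ∧
    ∀ J' ⊂ J, J'.Nonempty → (∑ i ∈ J', lam i • wE i) ∉ T.I

/-- A toupie algebra is simply connected if any two distinct branches are involved in a
common minimal relation. -/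
def SimplyConnected : Prop :=
  ∀ i j : Fin T.t, i ≠ j → ∃ J lam, MinRel T J lam ∧ i ∈ J ∧ j ∈ J

/-- A (minimal) zero-relation on branch `i`: the subpath of branch `i` from its `a`-th
to its `b`-th vertex lies in `I`, but no proper subpath of it does. -/
def ZeroRel (i : Fin T.t) (a b : ℕ) : Prop :=
  a < b ∧ b ≤ T.ℓ i ∧ subE i a b ∈ T.I ∧
    ∀ a' b', a ≤ a' → b' ≤ b → a' < b' → (a', b') ≠ (a, b) → subE i a' b' ∉ T.I

/-- There is exactly one relation on branch `i`. -/
def ExactlyOneRel (i : Fin T.t) : Prop := ∃! p : ℕ × ℕ, ZeroRel T i p.1 p.2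

/-- Branch `i` carries more than one relation. -/
def MoreThanOneRel (i : Fin T.t) : Prop :=
  ∃ p q : ℕ × ℕ, p ≠ q ∧ ZeroRel T i p.1 p.2 ∧ ZeroRel T i q.1 q.2

/-- At most one branch of `Q` has length at least three. -/
def AtMostOneLongBranch : Prop := ∀ i j : Fin T.t, 3 ≤ T.ℓ i → 3 ≤ T.ℓ j → i = j

/-- The two-sided ideal `I` is generated by the set `S`. -/
def IsGenBy {R : Type u} [Ring R] (I : TwoSidedIdeal R) (S : Set R) : Prop :=
  S ⊆ (I : Set R) ∧ ∀ J : TwoSidedIdeal R, S ⊆ (J : Set R) → (I : Set R) ⊆ (J : Set R)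

/-- A toupie algebra is canonical if (after choosing two distinguished branches `i₁, i₂`)
its ideal is generated by `{w i₁ + λ j • w i₂ - w j}` over the remaining branches `j`,
with the `λ j` pairwise distinct and nonzero. -/
def IsCanonical : Prop :=
  ∃ (i₁ i₂ : Fin T.t) (lam : Fin T.t → k), i₁ ≠ i₂ ∧
    (∀ j, j ≠ i₁ → j ≠ i₂ → lam j ≠ 0) ∧
    (∀ j j', j ≠ i₁ → j ≠ i₂ → j' ≠ i₁ → j' ≠ i₂ → j ≠ j' → lam j ≠ lam j') ∧
    IsGenBy T.I {x | ∃ j, j ≠ i₁ ∧ j ≠ i₂ ∧ x = wE i₁ + lam j • wE i₂ - wE j}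

end Toupie
namespace Toupie

/-! ### Module-theoretic notions over an arbitrary ring

Following the paper, all modules are finite-dimensional *right* modules; a right
`A`-module is formalized as a (left) module over `Aᵐᵒᵖ`.  The definitions below are
stated for modules over an arbitrary ring `R` and are applied with `R := Aᵐᵒᵖ`. -/

variable (R : Type u) [Ring R]

/-- A module is indecomposable if it is nonzero and its only idempotent endomorphisms
are `0` and the identity. -/
def Indec (M : ModuleCat.{u} R) : Prop :=
  Nontrivial M ∧ ∀ f : M →ₗ[R] M, f.comp f = f → f = 0 ∨ f = LinearMap.id

/-- Finiteness ("finite dimensionality") of a module. -/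
def FdMod (M : ModuleCat.{u} R) : Prop := Module.Finite R M

/-- `M` has projective dimension at most one: it is the quotient of a projective module
by a projective submodule. -/
def PdLeOne (M : ModuleCat.{u} R) : Prop :=
  ∃ (P : ModuleCat.{u} R) (f : P →ₗ[R] M), Function.Surjective f ∧
    Module.Projective R P ∧ Module.Projective R ↥(LinearMap.ker f)

/-- `M` has injective dimension at most one: it embeds in an injective module with
injective cokernel. -/
def IdLeOne (M : ModuleCat.{u} R) : Prop :=
  ∃ (E : ModuleCat.{u} R) (f : M →ₗ[R] E), Function.Injective f ∧
    Module.Injective R E ∧ Module.Injective R (E ⧸ LinearMap.range f)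

/-- One step of a path in `ind R`: a nonzero non-isomorphism between (finite-dimensional)
indecomposable modules. -/
def Step (M N : ModuleCat.{u} R) : Prop :=
  Indec R M ∧ FdMod R M ∧ Indec R N ∧ FdMod R N ∧
    ∃ f : M →ₗ[R] N, f ≠ 0 ∧ ¬ Function.Bijective f

/-- A path in `ind R` from `M` to `N` (possibly trivial): a chain
`M = M₀ → M₁ → ⋯ → Mₙ = N` of nonzero non-isomorphisms between indecomposables. -/
def IndPath (M N : ModuleCat.{u} R) : Prop := Relation.ReflTransGen (Step R) M N

/-- The left part `L_R`: the indecomposable (finite-dimensional) modules `M` such that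
every indecomposable `X` with a path `X ⇝ M` in `ind R` has projective dimension `≤ 1`. -/
def InLeftPart (M : ModuleCat.{u} R) : Prop :=
  Indec R M ∧ FdMod R M ∧
    ∀ X : ModuleCat.{u} R, Indec R X → FdMod R X → IndPath R X M → PdLeOne R X

/-- The right part `R_R`: the indecomposable (finite-dimensional) modules `M` such that
every indecomposable `X` with a path `M ⇝ X` in `ind R` has injective dimension `≤ 1`. -/
def InRightPart (M : ModuleCat.{u} R) : Prop :=
  Indec R M ∧ FdMod R M ∧
    ∀ X : ModuleCat.{u} R, Indec R X → FdMod R X → IndPath R M X → IdLeOne R X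

/-- Hereditary: global dimension at most one, i.e. every module has projective dimension
at most one. -/
def Hereditary : Prop := ∀ M : ModuleCat.{u} R, PdLeOne R M

/-- Quasitilted: every indecomposable projective module lies in the left part. -/
def Quasitilted : Prop :=
  ∀ P : ModuleCat.{u} R, Indec R P → FdMod R P → Module.Projective R P → InLeftPart R P

/-- A module is directed if it lies on no cycle of nonzero non-isomorphisms between
indecomposables in `ind R`. -/
def Directed (M : ModuleCat.{u} R) : Prop := ¬ Relation.TransGen (Step R) M M

/-- Weakly shod: every indecomposable (finite-dimensional) module not lying in
`L_R ∪ R_R` is directed. -/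
def WeaklyShod : Prop :=
  ∀ M : ModuleCat.{u} R, Indec R M → FdMod R M →
    ¬ InLeftPart R M → ¬ InRightPart R M → Directed R M

/-- Laura: all but finitely many isomorphism classes of indecomposable
(finite-dimensional) modules lie in `L_R ∪ R_R`. -/
def Laura : Prop :=
  ∃ S : Set (ModuleCat.{u} R), S.Finite ∧
    ∀ M : ModuleCat.{u} R, Indec R M → FdMod R M →
      ¬ InLeftPart R M → ¬ InRightPart R M → ∃ N ∈ S, Nonempty (M ≃ₗ[R] N)

/-- There are exactly `n` isomorphism classes of modules satisfying `P`. -/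
def NumClasses (P : ModuleCat.{u} R → Prop) (n : ℕ) : Prop :=
  ∃ f : Fin n → ModuleCat.{u} R, (∀ i, P (f i)) ∧
    (∀ i j, Nonempty ((f i : Type u) ≃ₗ[R] (f j : Type u)) → i = j) ∧
    ∀ M : ModuleCat.{u} R, P M → ∃ i, Nonempty ((M : Type u) ≃ₗ[R] (f i : Type u))

/-- `M` is (isomorphic to) a direct summand of `T`. -/
def IsSummandOf (T : Type u) [AddCommGroup T] [Module R T] (M : ModuleCat.{u} R) : Prop :=
  ∃ N N' : Submodule R T, IsCompl N N' ∧ Nonempty ((M : Type u) ≃ₗ[R] N)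

/-- `Ext¹_R(T, T) = 0`: every self-extension `0 → T → E → T → 0` splits. -/
def SelfExtVanish (T : Type u) [AddCommGroup T] [Module R T] : Prop :=
  ∀ (E : Type u) [AddCommGroup E] [Module R E] (ι : T →ₗ[R] E) (π : E →ₗ[R] T),
    Function.Injective ι → Function.Surjective π → LinearMap.range ι = LinearMap.ker π →
      ∃ s : T →ₗ[R] E, π.comp s = LinearMap.id

/-- A tilting module over a hereditary algebra: a finite module with `Ext¹(T,T) = 0`
having as many pairwise non-isomorphic indecomposable direct summands as there are
simple modules. -/
def IsTiltingMod (T : Type u) [AddCommGroup T] [Module R T] : Prop :=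
  Module.Finite R T ∧ SelfExtVanish R T ∧
    ∃ n : ℕ, NumClasses R (fun M => Indec R M ∧ IsSummandOf R T M) n ∧
      NumClasses R (fun M => IsSimpleModule R M) n

variable (k : Type u) [Field k]

/-- A `k`-algebra `A` is tilted if it is the endomorphism algebra of a tilting (right)
module over a hereditary finite-dimensional `k`-algebra `H`.  (Right `H`-modules are
modules over `Hᵐᵒᵖ`; the isomorphism `A ≅ End_H T` is a `k`-linear ring isomorphism.) -/
def IsTilted (A : Type u) [Ring A] [Algebra k A] : Prop :=
  ∃ (H : Type u) (_ : Ring H) (_ : Algebra k H),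
    FiniteDimensional k H ∧ Hereditary Hᵐᵒᵖ ∧
      ∃ (T : Type u) (_ : AddCommGroup T) (_ : Module Hᵐᵒᵖ T),
        IsTiltingMod Hᵐᵒᵖ T ∧
          ∃ (_ : Module k T) (_ : SMulCommClass Hᵐᵒᵖ k T) (_ : IsScalarTower k Hᵐᵒᵖ T)
            (φ : A ≃+* Module.End Hᵐᵒᵖ T), ∀ (c : k) (x : A), φ (c • x) = c • φ x

end Toupie
namespace Toupie

variable {k : Type u} [Field k] (T : ToupieAlg k)

/-! ### Right `A`-modules as representations of `(Q, I)`

For a right `A`-module `M` (a module over `Aᵐᵒᵖ`) and a vertex `v`, the space of the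
corresponding representation at `v` is `M_v = M • e_v`. -/

/-- The action of the idempotent `e_v ∈ A` on a right `A`-module (= `Aᵐᵒᵖ`-module). -/
def actV (v : Vtx T.t T.ℓ) : (Alg T)ᵐᵒᵖ := op (mkA T (eV v))

/-- The space `M_v = M • e_v` of the representation `M` at the vertex `v` is zero. -/
def VanishAt (M : ModuleCat.{u} (Alg T)ᵐᵒᵖ) (v : Vtx T.t T.ℓ) : Prop :=
  ∀ m : M, actV T v • m = 0

/-- Every simple summand of `top M = M / rad M` is one of the simple modules `S_v`,
`v ∈ vs`: for every maximal submodule `N` the simple quotient `M/N` is supported at some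
vertex of `vs` (for an admissible quotient of a path algebra, the simple module `S_v` is
the unique simple on which `e_v` acts nontrivially). -/
def TopIn (M : ModuleCat.{u} (Alg T)ᵐᵒᵖ) (vs : Set (Vtx T.t T.ℓ)) : Prop :=
  ∀ N : Submodule (Alg T)ᵐᵒᵖ M, IsCoatom N → ∃ v ∈ vs, ∃ m : M, actV T v • m ∉ N

/-- Every simple summand of the socle of `M` is one of the simple modules `S_v`,
`v ∈ vs`: every simple submodule `N ≤ M` is supported at some vertex of `vs`. -/
def SocIn (M : ModuleCat.{u} (Alg T)ᵐᵒᵖ) (vs : Set (Vtx T.t T.ℓ)) : Prop :=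
  ∀ N : Submodule (Alg T)ᵐᵒᵖ M, IsAtom N → ∃ v ∈ vs, ∃ m ∈ N, actV T v • m ≠ 0

/-- The module `D x y` (for two positions `0 ≤ x, y ≤ ℓ i₀` on the unique branch `i₀`
lying in `I`, and an auxiliary branch `i₂ ≠ i₀`): the right `A`-module with generators
`g = e₀` (at the source) and `h = e_y` (at the `y`-th vertex of branch `i₀`), subject to
the relations `g ⬝ (subpath of w i₀ from 0 to x+1) = 0` and
`g ⬝ w i₂ = h ⬝ (subpath of w i₀ from y to ℓ i₀)`.  It is presented as the quotient of
the right regular module `A ⊕ A` by the right submodule generated by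
`(1 - e₀, 0)`, `(0, 1 - e_y)`, `(subE i₀ 0 (min (x+1) (ℓ i₀)), 0)` and
`(w i₂, - subE i₀ y (ℓ i₀))`. -/
abbrev Dmod (i₀ i₂ : Fin T.t) (x y : ℕ) : Type u :=
  (Alg T × Alg T) ⧸ Submodule.span (Alg T)ᵐᵒᵖ
    ({((mkA T (1 - eV Vtx.src) : Alg T), (0 : Alg T)),
      ((0 : Alg T), (mkA T (1 - eV (vtx T.t T.ℓ i₀ y)) : Alg T)),
      ((mkA T (subE i₀ 0 (min (x + 1) (T.ℓ i₀))) : Alg T), (0 : Alg T)),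
      ((mkA T (wE i₂) : Alg T), (- mkA T (subE i₀ y (T.ℓ i₀)) : Alg T))} :
        Set (Alg T × Alg T))

end Toupie

namespace Toupie

section Coefficients

variable {t : ℕ} {ℓ : Fin t → ℕ}

instance : Finite (Vtx t ℓ) := by
  refine Finite.of_injective
    (fun v : Vtx t ℓ => (match v with
      | .src => Sum.inl false
      | .snk => Sum.inl true
      | .mid i a => Sum.inr ⟨i, a⟩ : Bool ⊕ (Σ i : Fin t, Fin (ℓ i - 1)))) ?_
  intro v w h
  cases v <;> cases w <;> simp_all

instance : Finite (PIdx t ℓ) := by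
  refine Finite.of_injective
    (fun p : PIdx t ℓ => (match p with
      | .vert v => Sum.inl v
      | .sub i a b hab hb => Sum.inr ⟨i, ⟨a, by omega⟩, ⟨b, by omega⟩⟩ :
        Vtx t ℓ ⊕ (Σ i : Fin t, Fin (ℓ i + 1) × Fin (ℓ i + 1)))) ?_
  intro v w h
  cases v <;> cases w
  · simp_all
  · simp at h
  · simp at h
  · simp only [Sum.inr.injEq, Sigma.mk.injEq] at h
    obtain ⟨rfl, h⟩ := h
    simp_all

instance : Fintype (Vtx t ℓ) := Fintype.ofFinite _

instance : Fintype (PIdx t ℓ) := Fintype.ofFinite _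

@[simp] lemma vtx_zero (i : Fin t) : vtx t ℓ i 0 = .src := by simp [vtx]

lemma vtx_last (i : Fin t) (h : 1 ≤ ℓ i) : vtx t ℓ i (ℓ i) = .snk := by
  simp [vtx, show ℓ i ≠ 0 by omega]

lemma vtx_mid (i : Fin t) (a : ℕ) (h0 : 0 < a) (h : a < ℓ i) :
    vtx t ℓ i a = .mid i ⟨a - 1, by omega⟩ := by
  simp [vtx, show a ≠ 0 by omega, show a - 1 < ℓ i - 1 by omega]

lemma vtx_eq_src_iff (i : Fin t) (a : ℕ) : vtx t ℓ i a = .src ↔ a = 0 := by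
  unfold vtx; split_ifs <;> simp_all

lemma vtx_eq_snk_iff (i : Fin t) (a : ℕ) (h : 1 ≤ ℓ i) (ha : a ≤ ℓ i) :
    vtx t ℓ i a = .snk ↔ a = ℓ i := by
  unfold vtx; split_ifs <;> simp_all <;> omega

lemma vtx_eq_mid_iff (i j : Fin t) (a : ℕ) (b : Fin (ℓ j - 1)) :
    vtx t ℓ i a = .mid j b ↔ i = j ∧ a = b + 1 := by
  have := b.2
  unfold vtx
  split_ifs with h h'
  · simp; omega
  · simp only [Vtx.mid.injEq]
    constructor
    · rintro ⟨rfl, h⟩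
      simp at h
      exact ⟨rfl, by rw [← h]; simp; omega⟩
    · rintro ⟨rfl, rfl⟩
      simp
  · simp only [false_iff]
    rintro ⟨rfl, rfl⟩
    simp at h'

lemma vtx_inj_left (i : Fin t) {a b : ℕ} (ha : a ≤ ℓ i) (hb : b ≤ ℓ i)
    (h : vtx t ℓ i a = vtx t ℓ i b) : a = b := by
  unfold vtx at h
  split_ifs at h <;> simp_all <;> omega

lemma exists_vtx_eq (hℓ : ∀ i, 1 ≤ ℓ i) (i₀ : Fin t) (v : Vtx t ℓ) :
    ∃ i a, a ≤ ℓ i ∧ vtx t ℓ i a = v := by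
  cases v with
  | src => exact ⟨i₀, 0, by omega, by simp⟩
  | snk => exact ⟨i₀, ℓ i₀, le_rfl, vtx_last _ (hℓ _)⟩
  | mid i a => exact ⟨i, a + 1, by omega, (vtx_eq_mid_iff _ _ _ _).2 ⟨rfl, rfl⟩⟩

end Coefficients

/-- A representation of the toupie quiver in an algebra `B`: a complete system of orthogonal
idempotents indexed by the vertices, and an element for every arrow. -/
structure QuiverRep (k : Type*) [Field k] (t : ℕ) (ℓ : Fin t → ℕ) (B : Type*) [Ring B]
    [Algebra k B] where
  ev : Vtx t ℓ → B
  ar : Fin t → ℕ → B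
  ev_mul_ev : ∀ v w, ev v * ev w = if v = w then ev v else 0
  sum_ev : ∑ v, ev v = 1
  ev_mul_ar : ∀ i j, j < ℓ i → ev (vtx t ℓ i j) * ar i j = ar i j
  ar_mul_ev : ∀ i j, j < ℓ i → ar i j * ev (vtx t ℓ i (j + 1)) = ar i j
  ar_zero : ∀ i j, ℓ i ≤ j → ar i j = 0

namespace QuiverRep

variable {k : Type*} [Field k] {t : ℕ} {ℓ : Fin t → ℕ} {B : Type*} [Ring B] [Algebra k B]
  (D : QuiverRep k t ℓ B)

/-- The value of the representation on the path from `a` to `b` on branch `i`. -/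
def pr (i : Fin t) (a b : ℕ) : B := ((List.range (b - a)).map fun s => D.ar i (a + s)).prod

@[simp] lemma pr_self (i : Fin t) (a : ℕ) : D.pr i a a = 1 := by simp [pr]

lemma pr_succ (i : Fin t) {a b : ℕ} (h : a < b) :
    D.pr i a b = D.ar i a * D.pr i (a + 1) b := by
  unfold pr
  rw [show b - a = (b - (a + 1)) + 1 by omega, List.range_succ_eq_map]
  simp only [List.map_cons, List.prod_cons, List.map_map, add_zero]
  congr 2
  apply List.map_congr_left
  intro s _
  simp only [Function.comp]
  congr 1; omega

/-- The value of the representation on a path. -/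
def val : PIdx t ℓ → B
  | .vert v => D.ev v
  | .sub i a b _ _ => D.pr i a b

lemma ev_mul_val (v : Vtx t ℓ) (p : PIdx t ℓ) :
    D.ev v * D.val p = if startIdx p = v then D.val p else 0 := by
  cases p with
  | vert w =>
    simp only [val, startIdx, D.ev_mul_ev]
    by_cases h : v = w
    · simp [h]
    · simp [h, Ne.symm h]
  | sub i a b hab hb =>
    simp only [val, startIdx]
    rw [D.pr_succ i hab, ← mul_assoc, ← D.ev_mul_ar i a (by omega), ← mul_assoc, D.ev_mul_ev]
    by_cases h : v = vtx t ℓ i a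
    · simp [h]
    · simp [h, Ne.symm h]

/-- The path obtained by putting the `j`-th arrow of branch `i` in front of a path, if
possible. -/
def consPath (i : Fin t) (j : ℕ) : PIdx t ℓ → Option (PIdx t ℓ)
  | .vert v => if h : v = vtx t ℓ i (j + 1) ∧ j < ℓ i then
      some (.sub i j (j + 1) (by omega) h.2) else none
  | .sub i' a b hab hb =>
      if h : i' = i ∧ a = j + 1 then some (.sub i j b (by omega) (h.1 ▸ hb)) else none

lemma strip_eq_some_iff (i : Fin t) (j : ℕ) (p q : PIdx t ℓ) :
    strip i j p = some q ↔ consPath i j q = some p := by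
  cases p with
  | vert v =>
    cases q with
    | vert w => simp [strip, consPath]
    | sub i' a b hab hb => simp [strip, consPath]
  | sub i₁ a₁ b₁ hab₁ hb₁ =>
    cases q with
    | vert w =>
      simp only [strip, consPath]
      constructor
      · intro h
        split_ifs at h with h1 h2
        · simp at h
        · obtain ⟨rfl, rfl⟩ := h1
          obtain rfl : b₁ = a₁ + 1 := by omega
          simp only [Option.some.injEq, PIdx.vert.injEq] at h
          rw [dif_pos ⟨h.symm, by omega⟩]
      · intro h
        split_ifs at h with h1
        · simp only [Option.some.injEq, PIdx.sub.injEq] at h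
          obtain ⟨rfl, rfl, rfl⟩ := h
          simp [h1]
    | sub i' a b hab hb =>
      simp only [strip, consPath]
      constructor
      · intro h
        split_ifs at h with h1 h2
        · simp only [Option.some.injEq, PIdx.sub.injEq] at h
          obtain ⟨rfl, rfl, rfl⟩ := h
          obtain ⟨rfl, rfl⟩ := h1
          simp
        · simp at h
      · intro h
        split_ifs at h with h1
        · simp only [Option.some.injEq, PIdx.sub.injEq] at h
          obtain ⟨rfl, rfl, rfl⟩ := h
          obtain ⟨rfl, rfl⟩ := h1
          simp [hab]

lemma ar_mul_val (hℓ : ∀ i, 1 ≤ ℓ i) (i : Fin t) (j : ℕ) (q : PIdx t ℓ) :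
    D.ar i j * D.val q = (consPath i j q).elim 0 D.val := by
  by_cases hj : j < ℓ i
  swap
  · rw [D.ar_zero i j (by omega), zero_mul]
    cases q with
    | vert v => simp [consPath, hj]
    | sub i' a b hab hb =>
      simp only [consPath]
      split_ifs with h
      · obtain ⟨rfl, rfl⟩ := h; omega
      · rfl
  rw [← D.ar_mul_ev i j hj, mul_assoc, D.ev_mul_val, mul_ite, mul_zero]
  cases q with
  | vert v =>
    by_cases h : v = vtx t ℓ i (j + 1)
    · rw [if_pos (show startIdx (PIdx.vert v) = _ from h)]
      subst h
      simp [consPath, hj, val, D.ar_mul_ev i j hj, pr]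
    · rw [if_neg (show ¬ startIdx (PIdx.vert v) = _ from h)]
      simp [consPath, h]
  | sub i' a b hab hb =>
    by_cases h : i' = i ∧ a = j + 1
    · obtain ⟨rfl, rfl⟩ := h
      rw [if_pos (show startIdx (PIdx.sub i' (j + 1) b hab hb) = vtx t ℓ i' (j + 1) from rfl)]
      simp only [consPath, and_self, dif_pos, Option.elim, val]
      rw [D.pr_succ i' (show j < b by omega)]
    · rw [if_neg]
      · simp [consPath, h]
      · intro h'
        apply h
        change vtx t ℓ i' a = _ at h'
        rcases Nat.lt_or_ge (j + 1) (ℓ i) with hj' | hj'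
        · rw [vtx_mid i (j + 1) (by omega) hj', vtx_eq_mid_iff] at h'
          exact ⟨h'.1, by simpa using h'.2⟩
        · rw [show j + 1 = ℓ i by omega, vtx_last i (hℓ i),
            vtx_eq_snk_iff _ _ (hℓ _) (by omega)] at h'
          omega

/-- The linear extension of `QuiverRep.val` to linear combinations of paths. -/
def lin : PSp k t ℓ →ₗ[k] B := Fintype.linearCombination k D.val

lemma lin_single (q : PIdx t ℓ) (c : k) : D.lin (Pi.single q c) = c • D.val q := by
  simp [lin, Fintype.linearCombination_apply, Pi.single_apply, ite_smul]

lemma Ev_single (v : Vtx t ℓ) (q : PIdx t ℓ) (c : k) :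
    Ev k v (Pi.single q c) = if startIdx q = v then Pi.single q c else 0 := by
  funext p
  simp only [Ev, LinearMap.coe_mk, AddHom.coe_mk, ]
  by_cases h : p = q
  · subst h
    by_cases h : startIdx p = v <;> simp [h]
  · by_cases h' : startIdx q = v <;> by_cases h'' : startIdx p = v <;> simp [h, h', h'']

lemma Ar_single (i : Fin t) (j : ℕ) (q : PIdx t ℓ) (c : k) :
    Ar k i j (Pi.single q c) = (consPath i j q).elim 0 fun p => Pi.single p c := by
  funext p
  simp only [Ar, LinearMap.coe_mk, AddHom.coe_mk]
  rcases h : strip i j p with _ | q'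
  · rcases h' : consPath i j q with _ | p'
    · simp
    · have : p ≠ p' := by
        rintro rfl
        rw [(strip_eq_some_iff i j p q).2 h'] at h
        simp at h
      simp [this]
  · simp only [Option.elim]
    by_cases hq : q' = q
    · subst hq
      rw [(strip_eq_some_iff i j p q').1 h]
      simp
    · rw [Pi.single_eq_of_ne hq]
      rcases h' : consPath i j q with _ | p'
      · simp
      · have : p ≠ p' := by
          rintro rfl
          rw [(strip_eq_some_iff i j p q).2 h'] at h
          simp at h; exact hq h.symm
        simp [this]

lemma lin_Ev (v : Vtx t ℓ) (f : PSp k t ℓ) : D.lin (Ev k v f) = D.ev v * D.lin f := by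
  suffices D.lin ∘ₗ Ev k v = LinearMap.mulLeft k (D.ev v) ∘ₗ D.lin from
    LinearMap.congr_fun this f
  apply LinearMap.pi_ext
  intro q c
  simp only [LinearMap.comp_apply, Ev_single, lin_single, LinearMap.mulLeft_apply,
    mul_smul_comm, D.ev_mul_val]
  split_ifs <;> simp [lin_single]

lemma lin_Ar (hℓ : ∀ i, 1 ≤ ℓ i) (i : Fin t) (j : ℕ) (f : PSp k t ℓ) :
    D.lin (Ar k i j f) = D.ar i j * D.lin f := by
  suffices D.lin ∘ₗ Ar k i j = LinearMap.mulLeft k (D.ar i j) ∘ₗ D.lin from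
    LinearMap.congr_fun this f
  apply LinearMap.pi_ext
  intro q c
  simp only [LinearMap.comp_apply, Ar_single, lin_single, LinearMap.mulLeft_apply,
    mul_smul_comm, D.ar_mul_val hℓ]
  rcases consPath i j q with _ | p <;> simp [lin_single]

end QuiverRep

section Universal

variable {k : Type*} [Field k] {t : ℕ} {ℓ : Fin t → ℕ} {B : Type*} [Ring B] [Algebra k B]

/-- The sum of all trivial paths. -/
def unitVec (k : Type*) [Field k] (t : ℕ) (ℓ : Fin t → ℕ) : PIdx t ℓ → k
  | .vert _ => 1
  | .sub _ _ _ _ _ => 0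

lemma unitVec_eq_sum : unitVec k t ℓ = ∑ v : Vtx t ℓ, Pi.single (PIdx.vert v) 1 := by
  funext p
  rw [Finset.sum_apply]
  cases p <;> simp [unitVec, Pi.single_apply]

end Universal
end Toupie

namespace Toupie

section Universal

variable {k : Type u} [Field k] {t : ℕ} {ℓ : Fin t → ℕ} {B : Type*} [Ring B] [Algebra k B]

/-- The coordinates of an element of the path algebra with respect to the basis of paths. -/
def coeffs : PathAlg k t ℓ →ₗ[k] PSp k t ℓ where
  toFun x := x.1 (unitVec k t ℓ)
  map_add' _ _ := rfl
  map_smul' _ _ := rfl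

namespace QuiverRep

variable (D : QuiverRep k t ℓ B)

lemma lin_unitVec : D.lin (unitVec k t ℓ) = 1 := by
  simp [unitVec_eq_sum, lin_single, val, D.sum_ev]

lemma lin_apply (hℓ : ∀ i, 1 ≤ ℓ i) (x : PathAlg k t ℓ) (f : PSp k t ℓ) :
    D.lin (x.1 f) = D.lin (coeffs x) * D.lin f := by
  obtain ⟨x, hx⟩ := x
  change D.lin (x f) = D.lin (x (unitVec k t ℓ)) * D.lin f
  induction hx using Algebra.adjoin_induction generalizing f with
  | mem x hx =>
    rcases hx with ⟨v, rfl⟩ | ⟨i, j, rfl⟩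
    · simp [lin_Ev, lin_unitVec]
    · simp [lin_Ar _ hℓ, lin_unitVec]
  | algebraMap r => simp [Module.algebraMap_end_apply, lin_unitVec]
  | add x y _ _ hx hy => simp only [LinearMap.add_apply, map_add, hx f, hy f, add_mul]
  | mul x y _ _ hx hy =>
    rw [Module.End.mul_apply, Module.End.mul_apply, hx, hy, hx (y (unitVec k t ℓ)), mul_assoc]

/-- The universal property of the path algebra. -/
def hom (hℓ : ∀ i, 1 ≤ ℓ i) : PathAlg k t ℓ →ₐ[k] B :=
  AlgHom.ofLinearMap (D.lin ∘ₗ coeffs) D.lin_unitVec fun x y => D.lin_apply hℓ x (coeffs y)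

@[simp] lemma hom_eV (hℓ : ∀ i, 1 ≤ ℓ i) (v : Vtx t ℓ) : D.hom hℓ (eV v) = D.ev v := by
  change D.lin (Ev k v (unitVec k t ℓ)) = _
  rw [lin_Ev, lin_unitVec, mul_one]

@[simp] lemma hom_arE (hℓ : ∀ i, 1 ≤ ℓ i) (i : Fin t) (j : ℕ) :
    D.hom hℓ (arE i j) = D.ar i j := by
  change D.lin (Ar k i j (unitVec k t ℓ)) = _
  rw [lin_Ar _ hℓ, lin_unitVec, mul_one]

lemma hom_subE (hℓ : ∀ i, 1 ≤ ℓ i) (i : Fin t) (a b : ℕ) :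
    D.hom hℓ (subE i a b) = D.pr i a b := by
  simp [subE, pr, map_list_prod, Function.comp_def]

end QuiverRep

/-- The path algebra as a representation of its own quiver. -/
def selfRep (k : Type u) [Field k] (t : ℕ) (ℓ : Fin t → ℕ) :
    QuiverRep k t ℓ (PathAlg k t ℓ) where
  ev := eV
  ar := arE
  ev_mul_ev v w := by
    apply Subtype.ext
    apply LinearMap.ext
    intro f
    funext p
    change (if startIdx p = v then (if startIdx p = w then f p else 0) else 0) = _
    by_cases h : v = w
    · subst h
      rw [if_pos rfl]
      change _ = (if startIdx p = v then f p else 0)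
      split_ifs <;> rfl
    · rw [if_neg h]
      change _ = (0 : k)
      by_cases h1 : startIdx p = v
      · rw [if_pos h1, if_neg (fun h2 => h (h1.symm.trans h2))]
      · rw [if_neg h1]
  sum_ev := by
    apply Subtype.ext
    apply LinearMap.ext
    intro f
    funext p
    rw [AddSubmonoidClass.coe_finsetSum, LinearMap.sum_apply, Finset.sum_apply]
    change (∑ v, if startIdx p = v then f p else 0) = f p
    simp
  ev_mul_ar i j hj := by
    apply Subtype.ext
    apply LinearMap.ext
    intro f
    funext p
    change (if startIdx p = vtx t ℓ i j then (strip i j p).elim 0 f else 0) =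
      (strip i j p).elim 0 f
    by_cases h : startIdx p = vtx t ℓ i j
    · rw [if_pos h]
    · rw [if_neg h]
      cases p with
      | vert v => rfl
      | sub i' a b hab hb =>
        simp only [strip]
        rw [dif_neg]
        · rfl
        · rintro ⟨rfl, rfl⟩
          exact h rfl
  ar_mul_ev i j hj := by
    apply Subtype.ext
    apply LinearMap.ext
    intro f
    funext p
    change (strip i j p).elim 0 (fun q => if startIdx q = vtx t ℓ i (j + 1) then f q else 0) =
      (strip i j p).elim 0 f
    cases p with
    | vert v => rfl
    | sub i' a b hab hb =>
      simp only [strip]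
      by_cases h : i' = i ∧ a = j
      · obtain ⟨rfl, rfl⟩ := h
        rw [dif_pos ⟨rfl, rfl⟩]
        by_cases h2 : a + 1 < b
        · rw [dif_pos h2]
          exact if_pos rfl
        · rw [dif_neg h2]
          obtain rfl : b = a + 1 := by omega
          exact if_pos rfl
      · rw [dif_neg h]
        rfl
  ar_zero i j hj := by
    apply Subtype.ext
    apply LinearMap.ext
    intro f
    funext p
    change (strip i j p).elim 0 f = 0
    cases p with
    | vert v => rfl
    | sub i' a b hab hb =>
      simp only [strip]
      rw [dif_neg]
      · rfl
      · rintro ⟨rfl, rfl⟩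
        omega

lemma selfRep_lin_coeffs (hℓ : ∀ i, 1 ≤ ℓ i) (x : PathAlg k t ℓ) :
    (selfRep k t ℓ).lin (coeffs x) = x := by
  suffices (selfRep k t ℓ).hom hℓ = AlgHom.id k _ from DFunLike.congr_fun this x
  apply AlgHom.adjoin_ext
  rintro _ (⟨v, rfl⟩ | ⟨i, j, rfl⟩)
  · exact (selfRep k t ℓ).hom_eV hℓ v
  · exact (selfRep k t ℓ).hom_arE hℓ i j

/-- The element of the path algebra given by a path. -/
def pathE (k : Type u) [Field k] {t : ℕ} {ℓ : Fin t → ℕ} (p : PIdx t ℓ) : PathAlg k t ℓ :=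
  (selfRep k t ℓ).val p

lemma pathE_vert (v : Vtx t ℓ) : pathE k (PIdx.vert v) = eV v := rfl

lemma pathE_sub (i : Fin t) (a b : ℕ) (hab : a < b) (hb : b ≤ ℓ i) :
    pathE k (PIdx.sub i a b hab hb) = subE i a b := rfl

lemma eq_sum_coeffs (hℓ : ∀ i, 1 ≤ ℓ i) (x : PathAlg k t ℓ) :
    x = ∑ p, coeffs x p • pathE k p :=
  (selfRep_lin_coeffs hℓ x).symm

/-- The representation of the toupie quiver by matrices indexed by the vertices which
remembers the `i`-th branch only. -/
def matRep (k : Type u) [Field k] (t : ℕ) (ℓ : Fin t → ℕ) (i : Fin t) :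
    QuiverRep k t ℓ (Matrix (Vtx t ℓ) (Vtx t ℓ) k) where
  ev v := Matrix.single v v 1
  ar i' j := if i' = i ∧ j < ℓ i then Matrix.single (vtx t ℓ i j) (vtx t ℓ i (j + 1)) 1 else 0
  ev_mul_ev v w := by
    by_cases h : v = w
    · subst h; simp
    · rw [if_neg h, Matrix.single_mul_single_of_ne _ _ _ _ h]
  sum_ev := by
    ext u v
    simp only [Matrix.sum_apply, Matrix.single_apply, Matrix.one_apply]
    by_cases h : u = v
    · subst h; simp
    · rw [if_neg h]
      exact Finset.sum_eq_zero fun w _ => if_neg (fun h' => h (h'.1.symm.trans h'.2))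
  ev_mul_ar i' j hj := by
    by_cases h : i' = i ∧ j < ℓ i
    · obtain ⟨rfl, h⟩ := h; simp [h]
    · simp [h]
  ar_mul_ev i' j hj := by
    by_cases h : i' = i ∧ j < ℓ i
    · obtain ⟨rfl, h⟩ := h; simp [h]
    · simp [h]
  ar_zero i' j hj := by
    rw [if_neg]
    rintro ⟨rfl, h⟩
    omega

lemma matRep_pr (i i' : Fin t) (a b : ℕ) (hab : a < b) (hb : b ≤ ℓ i') :
    (matRep k t ℓ i).pr i' a b =
      if i' = i then Matrix.single (vtx t ℓ i a) (vtx t ℓ i b) 1 else 0 := by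
  obtain ⟨n, rfl⟩ : ∃ n, b = a + n + 1 := ⟨b - a - 1, by omega⟩
  clear hab
  induction n generalizing a with
  | zero =>
    rw [(matRep k t ℓ i).pr_succ i' (by omega), add_zero, QuiverRep.pr_self, mul_one]
    by_cases h : i' = i
    · subst h; simp [matRep, show a < ℓ i' by omega]
    · simp [matRep, h]
  | succ n ih =>
    rw [(matRep k t ℓ i).pr_succ i' (by omega), show a + (n + 1) + 1 = a + 1 + n + 1 by omega,
      ih _ (by omega)]
    by_cases h : i' = i
    · subst h; simp [matRep, show a < ℓ i' by omega]
    · simp [matRep, h]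

/-- The matrix of an element of the path algebra along the `i`-th branch. -/
def theta (hℓ : ∀ i, 1 ≤ ℓ i) (i : Fin t) :
    PathAlg k t ℓ →ₐ[k] Matrix (Vtx t ℓ) (Vtx t ℓ) k :=
  (matRep k t ℓ i).hom hℓ

variable (hℓ : ∀ i, 1 ≤ ℓ i)

@[simp] lemma theta_eV (i : Fin t) (v : Vtx t ℓ) :
    theta hℓ i (eV v : PathAlg k t ℓ) = Matrix.single v v 1 :=
  QuiverRep.hom_eV _ _ _

lemma theta_subE (i i' : Fin t) {a b : ℕ} (hab : a < b) (hb : b ≤ ℓ i') :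
    theta hℓ i (subE i' a b : PathAlg k t ℓ) =
      if i' = i then Matrix.single (vtx t ℓ i a) (vtx t ℓ i b) 1 else 0 := by
  rw [theta, QuiverRep.hom_subE, matRep_pr _ _ _ _ hab hb]

lemma theta_subE_self (i : Fin t) {a b : ℕ} (hab : a < b) (hb : b ≤ ℓ i) :
    theta hℓ i (subE i a b : PathAlg k t ℓ) = Matrix.single (vtx t ℓ i a) (vtx t ℓ i b) 1 := by
  rw [theta_subE hℓ i i hab hb, if_pos rfl]

lemma theta_subE_of_ne {i i' : Fin t} (h : i' ≠ i) {a b : ℕ} (hab : a < b) (hb : b ≤ ℓ i') :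
    theta hℓ i (subE i' a b : PathAlg k t ℓ) = 0 := by
  rw [theta_subE hℓ i i' hab hb, if_neg h]

lemma theta_eq_sum (i : Fin t) (x : PathAlg k t ℓ) (u v : Vtx t ℓ) :
    theta hℓ i x u v = ∑ p, coeffs x p * theta hℓ i (pathE k p) u v := by
  conv_lhs => rw [eq_sum_coeffs hℓ x]
  rw [map_sum, Matrix.sum_apply]
  simp

lemma theta_diag (i : Fin t) (x : PathAlg k t ℓ) (v : Vtx t ℓ) :
    theta hℓ i x v v = coeffs x (.vert v) := by
  rw [theta_eq_sum, Finset.sum_eq_single (.vert v)]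
  · simp [pathE_vert]
  · rintro (w | ⟨i', a, b, hab, hb⟩) _ h
    · have h' : w ≠ v := fun h' => h (by rw [h'])
      simp [pathE_vert, h']
    · rw [pathE_sub, theta_subE hℓ i i' hab hb]
      split_ifs with h'
      · subst h'
        rw [Matrix.single_apply_of_ne, mul_zero]
        rintro ⟨h1, h2⟩
        have := vtx_inj_left i' (by omega) hb (h1.trans h2.symm)
        omega
      · simp
  · simp

lemma theta_vtx (i : Fin t) (x : PathAlg k t ℓ) {a b : ℕ} (hab : a < b) (hb : b ≤ ℓ i) :
    theta hℓ i x (vtx t ℓ i a) (vtx t ℓ i b) = coeffs x (.sub i a b hab hb) := by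
  rw [theta_eq_sum, Finset.sum_eq_single (.sub i a b hab hb)]
  · simp [pathE_sub, theta_subE_self hℓ i hab hb]
  · rintro (w | ⟨i', a', b', hab', hb'⟩) _ h
    · rw [pathE_vert, theta_eV, Matrix.single_apply_of_ne, mul_zero]
      rintro ⟨h1, h2⟩
      have := vtx_inj_left i (by omega) hb (h1.symm.trans h2)
      omega
    · rw [pathE_sub, theta_subE hℓ i i' hab' hb']
      split_ifs with h'
      · subst h'
        rw [Matrix.single_apply_of_ne, mul_zero]
        rintro ⟨h1, h2⟩
        obtain rfl := vtx_inj_left i' (by omega) (by omega) h1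
        obtain rfl := vtx_inj_left i' (by omega) (by omega) h2
        exact h rfl
      · simp
  · simp

lemma theta_diag_eq (i j : Fin t) (x : PathAlg k t ℓ) (v : Vtx t ℓ) :
    theta hℓ i x v v = theta hℓ j x v v := by
  rw [theta_diag, theta_diag]

lemma exists_of_theta_ne_zero (i : Fin t) (x : PathAlg k t ℓ) {u v : Vtx t ℓ}
    (h : theta hℓ i x u v ≠ 0) (huv : u ≠ v) :
    ∃ a b, a < b ∧ b ≤ ℓ i ∧ u = vtx t ℓ i a ∧ v = vtx t ℓ i b := by
  rw [theta_eq_sum] at h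
  obtain ⟨p, -, hp⟩ := Finset.exists_ne_zero_of_sum_ne_zero h
  have hp := right_ne_zero_of_mul hp
  cases p with
  | vert w =>
    rw [pathE_vert, theta_eV, Matrix.single_apply] at hp
    simp only [ne_eq, ite_eq_right_iff, one_ne_zero, imp_false, not_not] at hp
    exact absurd (hp.1.symm.trans hp.2) huv
  | sub i' a b hab hb =>
    rw [pathE_sub, theta_subE hℓ i i' hab hb] at hp
    split_ifs at hp with h'
    · subst h'
      rw [Matrix.single_apply] at hp
      simp only [ne_eq, ite_eq_right_iff, one_ne_zero, imp_false, not_not] at hp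
      exact ⟨a, b, hab, hb, hp.1.symm, hp.2.symm⟩
    · simp at hp

lemma theta_ext (i₀ : Fin t) {x y : PathAlg k t ℓ} (h : ∀ i, theta hℓ i x = theta hℓ i y) :
    x = y := by
  rw [eq_sum_coeffs hℓ x, eq_sum_coeffs hℓ y]
  refine Finset.sum_congr rfl fun p _ => ?_
  congr 1
  cases p with
  | vert v => rw [← theta_diag hℓ i₀, ← theta_diag hℓ i₀, h]
  | sub i a b hab hb => rw [← theta_vtx hℓ, ← theta_vtx hℓ, h]

lemma eV_mul_eV (v w : Vtx t ℓ) :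
    (eV v * eV w : PathAlg k t ℓ) = if v = w then eV v else 0 := (selfRep k t ℓ).ev_mul_ev v w

lemma eV_mul_self (v : Vtx t ℓ) : (eV v * eV v : PathAlg k t ℓ) = eV v := by
  rw [eV_mul_eV, if_pos rfl]

lemma sum_eV : ∑ v, (eV v : PathAlg k t ℓ) = 1 := (selfRep k t ℓ).sum_ev

include hℓ in
lemma subE_mul_subE (i : Fin t) {a b c : ℕ} (hab : a < b) (hbc : b < c) (hc : c ≤ ℓ i) :
    (subE i a b * subE i b c : PathAlg k t ℓ) = subE i a c := by
  apply theta_ext hℓ i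
  intro j
  rw [map_mul, theta_subE hℓ j i hab (by omega), theta_subE hℓ j i hbc hc,
    theta_subE hℓ j i (hab.trans hbc) hc]
  split_ifs <;> simp

include hℓ in
lemma eV_mul_subE (i : Fin t) {a b : ℕ} (hab : a < b) (hb : b ≤ ℓ i) :
    (eV (vtx t ℓ i a) * subE i a b : PathAlg k t ℓ) = subE i a b := by
  apply theta_ext hℓ i
  intro j
  rw [map_mul, theta_subE hℓ j i hab hb, theta_eV]
  split_ifs with h
  · subst h; simp
  · simp

include hℓ in
lemma subE_mul_eV (i : Fin t) {a b : ℕ} (hab : a < b) (hb : b ≤ ℓ i) :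
    (subE i a b * eV (vtx t ℓ i b) : PathAlg k t ℓ) = subE i a b := by
  apply theta_ext hℓ i
  intro j
  rw [map_mul, theta_subE hℓ j i hab hb, theta_eV]
  split_ifs with h
  · subst h; simp
  · simp

end Universal

end Toupie

namespace Toupie

section Universal

variable {k : Type u} [Field k] {t : ℕ} {ℓ : Fin t → ℕ}

@[simp] lemma subE_self (i : Fin t) (a : ℕ) : (subE i a a : PathAlg k t ℓ) = 1 := by
  simp [subE]

lemma subE_mul_subE' (hℓ : ∀ i, 1 ≤ ℓ i) (i : Fin t) {a b c : ℕ} (hab : a ≤ b) (hbc : b ≤ c)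
    (hc : c ≤ ℓ i) : (subE i a b * subE i b c : PathAlg k t ℓ) = subE i a c := by
  rcases hab.eq_or_lt with rfl | hab
  · simp
  rcases hbc.eq_or_lt with rfl | hbc
  · simp
  exact subE_mul_subE hℓ i hab hbc hc

lemma theta_sandwich (hℓ : ∀ i, 1 ≤ ℓ i) (i : Fin t) (u v : Vtx t ℓ) (x : PathAlg k t ℓ) :
    theta hℓ i (eV u * x * eV v) = Matrix.single u v (theta hℓ i x u v) := by
  rw [map_mul, map_mul, theta_eV, theta_eV, Matrix.single_mul_mul_single]
  simp

lemma theta_wE (hℓ : ∀ i, 1 ≤ ℓ i) (i j : Fin t) :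
    theta hℓ i (wE j : PathAlg k t ℓ) = if j = i then Matrix.single .src .snk 1 else 0 := by
  rw [wE, theta_subE hℓ i j (hℓ j) le_rfl]
  split_ifs with h
  · subst h
    rw [vtx_zero, vtx_last _ (hℓ _)]
  · rfl

/-- The linear combination of the branches with given coefficients. -/
def branchSum : (Fin t → k) →ₗ[k] PathAlg k t ℓ := Fintype.linearCombination k wE

lemma branchSum_apply (μ : Fin t → k) :
    (branchSum μ : PathAlg k t ℓ) = ∑ i, μ i • wE i := rfl

lemma theta_branchSum (hℓ : ∀ i, 1 ≤ ℓ i) (i : Fin t) (μ : Fin t → k) :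
    theta hℓ i (branchSum μ : PathAlg k t ℓ) = Matrix.single .src .snk (μ i) := by
  rw [branchSum_apply, map_sum, Finset.sum_eq_single i]
  · rw [map_smul, theta_wE, if_pos rfl, Matrix.smul_single, smul_eq_mul, mul_one]
  · intro j _ hj
    rw [map_smul, theta_wE, if_neg hj, smul_zero]
  · simp

lemma eV_src_mul_mul_eV_snk (hℓ : ∀ i, 1 ≤ ℓ i) (i₀ : Fin t) (x : PathAlg k t ℓ) :
    eV .src * x * eV .snk = branchSum fun i => theta hℓ i x .src .snk := by
  apply theta_ext hℓ i₀
  intro i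
  rw [theta_sandwich, theta_branchSum]

lemma eV_mul_mul_eV (hℓ : ∀ i, 1 ≤ ℓ i) (i : Fin t) {a b : ℕ} (hab : a < b) (hb : b ≤ ℓ i)
    (h : a ≠ 0 ∨ b ≠ ℓ i) (x : PathAlg k t ℓ) :
    eV (vtx t ℓ i a) * x * eV (vtx t ℓ i b) =
      theta hℓ i x (vtx t ℓ i a) (vtx t ℓ i b) • subE i a b := by
  apply theta_ext hℓ i
  intro j
  rw [theta_sandwich, map_smul, theta_subE hℓ j i hab hb]
  split_ifs with hij
  · subst hij
    simp [Matrix.smul_single]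
  · rw [smul_zero]
    by_contra hne
    have hne' : theta hℓ j x (vtx t ℓ i a) (vtx t ℓ i b) ≠ 0 := by
      intro h0; rw [h0] at hne; simp at hne
    obtain ⟨a', b', hab', hb', h1, h2⟩ := exists_of_theta_ne_zero hℓ j x hne'
      (fun h' => by have := vtx_inj_left i (by omega) hb h'; omega)
    apply hij
    rcases Nat.eq_zero_or_pos a with rfl | ha
    · rw [vtx_mid i b (by omega) (by omega), eq_comm, vtx_eq_mid_iff] at h2
      exact h2.1.symm
    · rw [vtx_mid i a ha (by omega), eq_comm, vtx_eq_mid_iff] at h1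
      exact h1.1.symm

end Universal

variable {k : Type u} [Field k] (T : ToupieAlg k)

/-- The quotient map `kQ → A` as a map of `k`-algebras. -/
def mkHom : PathAlg k T.t T.ℓ →ₐ[k] Alg T := { mkA T with commutes' := fun _ => rfl }

lemma mkHom_surjective : Function.Surjective (mkHom T) := mkA_surjective T

lemma mkHom_eq_zero_iff (x : PathAlg k T.t T.ℓ) : mkHom T x = 0 ↔ x ∈ T.I := by
  rw [TwoSidedIdeal.mem_iff]
  exact RingCon.eq T.I.ringCon

lemma smul_mem_I (c : k) {x : PathAlg k T.t T.ℓ} (hx : x ∈ T.I) : c • x ∈ T.I := by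
  rw [← mkHom_eq_zero_iff] at hx ⊢
  rw [map_smul, hx, smul_zero]

/-- The linear relations between the branches. -/
def relSpace : Submodule k (Fin T.t → k) :=
  LinearMap.ker ((mkHom T).toLinearMap ∘ₗ branchSum)

lemma mem_relSpace_iff (μ : Fin T.t → k) : μ ∈ relSpace T ↔ branchSum μ ∈ T.I := by
  rw [← mkHom_eq_zero_iff]
  rfl

lemma range_lrMap :
    LinearMap.range (lrMap T) = LinearMap.range ((mkHom T).toLinearMap ∘ₗ branchSum) := by
  have i₀ : Fin T.t := ⟨0, by have := T.ht; omega⟩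
  apply le_antisymm
  · rintro _ ⟨y, rfl⟩
    obtain ⟨x, rfl⟩ := mkHom_surjective T y
    refine ⟨fun i => theta T.hℓ i x .src .snk, ?_⟩
    rw [LinearMap.comp_apply, ← eV_src_mul_mul_eV_snk T.hℓ i₀]
    simp [lrMap, e0, einf, mkHom]
  · rintro _ ⟨μ, rfl⟩
    refine ⟨mkHom T (branchSum μ), ?_⟩
    change mkHom T (eV .src) * mkHom T (branchSum μ) * mkHom T (eV .snk) = mkHom T (branchSum μ)
    rw [← map_mul, ← map_mul, eV_src_mul_mul_eV_snk T.hℓ i₀]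
    simp [theta_branchSum]

lemma mDim_add_finrank_relSpace : mDim T + Module.finrank k (relSpace T) = T.t := by
  have h := LinearMap.finrank_range_add_finrank_ker ((mkHom T).toLinearMap ∘ₗ branchSum)
  rw [Module.finrank_fin_fun, ← range_lrMap] at h
  exact h

lemma exists_generator (h : T.t = mDim T + 1) :
    ∃ lam ∈ relSpace T, ∀ μ ∈ relSpace T, ∃ c : k, μ = c • lam := by
  have h1 : Module.finrank k (relSpace T) = 1 := by
    have := mDim_add_finrank_relSpace T
    omega
  obtain ⟨⟨lam, hlam⟩, -, h2⟩ := finrank_eq_one_iff'.1 h1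
  refine ⟨lam, hlam, fun μ hμ => ?_⟩
  obtain ⟨c, hc⟩ := h2 ⟨μ, hμ⟩
  exact ⟨c, congrArg Subtype.val hc.symm⟩

/-- The ideal of the toupie algebra is generated by a single linear relation between the
branches, in which every branch occurs. -/
structure OneRel (lam : Fin T.t → k) : Prop where
  ne_zero : ∀ i, lam i ≠ 0
  two_le : ∀ i, 2 ≤ T.ℓ i
  mem_iff : ∀ x, x ∈ T.I ↔ ∃ c, ∀ i, theta T.hℓ i x = Matrix.single .src .snk (c * lam i)

lemma theta_of_mem_I {x : PathAlg k T.t T.ℓ} (hx : x ∈ T.I) (i : Fin T.t) :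
    (∀ v, theta T.hℓ i x v v = 0) ∧ (T.ℓ i < 2 → theta T.hℓ i x = 0) := by
  have h := T.adm x hx
  clear hx
  induction h using Submodule.span_induction with
  | mem x hx =>
    obtain ⟨i', a, b, hab, hb, rfl⟩ := hx
    rw [theta_subE T.hℓ i i' (by omega) hb]
    split_ifs with h
    · subst h
      refine ⟨fun v => ?_, fun h => by omega⟩
      apply Matrix.single_apply_of_ne
      rintro ⟨h1, h2⟩
      have := vtx_inj_left i' (by omega) hb (h1.trans h2.symm)
      omega
    · simp
  | zero => simp
  | add x y _ _ hx hy =>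
    exact ⟨fun v => by simp [hx.1 v, hy.1 v], fun h => by rw [map_add, hx.2 h, hy.2 h, add_zero]⟩
  | smul c x _ hx =>
    exact ⟨fun v => by simp [hx.1 v], fun h => by rw [map_smul, hx.2 h, smul_zero]⟩

lemma generator_ne_zero (hsc : SimplyConnected T) (lam : Fin T.t → k)
    (hgen : ∀ μ ∈ relSpace T, ∃ c : k, μ = c • lam) (i : Fin T.t) : lam i ≠ 0 := by
  have := T.ht
  have : Nontrivial (Fin T.t) := Fin.nontrivial_iff_two_le.2 this
  obtain ⟨j, hj⟩ := exists_ne i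
  obtain ⟨J, μ, ⟨-, hne, hI, -⟩, hi, -⟩ := hsc i j hj.symm
  obtain ⟨c, hc⟩ := hgen (fun a => if a ∈ J then μ a else 0) (by
    rw [mem_relSpace_iff, branchSum_apply]
    simpa [ite_smul, Finset.sum_ite_mem] using hI)
  have h := congrFun hc i
  simp only [hi, if_true, Pi.smul_apply, smul_eq_mul] at h
  intro h0
  exact hne i hi (by rw [h, h0, mul_zero])

lemma exists_oneRel (hsc : SimplyConnected T) (ht : T.t = mDim T + 1) :
    ∃ lam, OneRel T lam := by
  obtain ⟨lam, hlam, hgen⟩ := exists_generator T ht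
  have i₀ : Fin T.t := ⟨0, by have := T.ht; omega⟩
  have hne := generator_ne_zero T hsc lam hgen
  rw [mem_relSpace_iff] at hlam
  refine ⟨lam, hne, fun i => ?_, fun x => ⟨fun hx => ?_, ?_⟩⟩
  · by_contra h
    have h0 := (theta_of_mem_I T hlam i).2 (by omega)
    rw [theta_branchSum] at h0
    exact hne i (by simpa using congrFun (congrFun h0 .src) .snk)
  · have hμ : (branchSum fun i => theta T.hℓ i x .src .snk) ∈ T.I := by
      rw [← eV_src_mul_mul_eV_snk T.hℓ i₀]
      exact T.I.mul_mem_right _ _ (T.I.mul_mem_left _ _ hx)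
    obtain ⟨c, hc⟩ := hgen _ ((mem_relSpace_iff T _).2 hμ)
    refine ⟨c, fun i => ?_⟩
    have hci : theta T.hℓ i x .src .snk = c * lam i := congrFun hc i
    rw [← hci]
    ext u v
    rw [Matrix.single_apply]
    split_ifs with h
    · rw [h.1, h.2]
    · by_contra h0
      by_cases huv : u = v
      · subst huv
        exact h0 ((theta_of_mem_I T hx i).1 u)
      · obtain ⟨a, b, hab, hb, rfl, rfl⟩ := exists_of_theta_ne_zero T.hℓ i x h0 huv
        have hab' : a ≠ 0 ∨ b ≠ T.ℓ i := by
          by_contra hcon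
          push Not at hcon
          exact h ⟨by rw [hcon.1, vtx_zero], by rw [hcon.2, vtx_last _ (T.hℓ i)]⟩
        have h1 := eV_mul_mul_eV T.hℓ i hab hb hab' x
        have h2 : theta T.hℓ i x (vtx _ _ i a) (vtx _ _ i b) • subE i a b ∈ T.I := by
          rw [← h1]
          exact T.I.mul_mem_right _ _ (T.I.mul_mem_left _ _ hx)
        have h3 : subE i a b ∈ T.I := by
          have := smul_mem_I T (theta T.hℓ i x (vtx _ _ i a) (vtx _ _ i b))⁻¹ h2
          rwa [smul_smul, inv_mul_cancel₀ h0, one_smul] at this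
        have h4 : subE i 0 a * subE i a b * subE i b (T.ℓ i) ∈ T.I :=
          T.I.mul_mem_right _ _ (T.I.mul_mem_left _ _ h3)
        rw [subE_mul_subE' T.hℓ i (by omega) hab.le hb,
          subE_mul_subE' T.hℓ i (by omega) hb le_rfl] at h4
        obtain ⟨d, hd⟩ := hgen (Pi.single i 1) (by
          rw [mem_relSpace_iff, branchSum_apply, Finset.sum_eq_single i]
          · simpa [wE] using h4
          · intro j _ hj
            simp [hj]
          · simp)
        have := T.ht
        have : Nontrivial (Fin T.t) := Fin.nontrivial_iff_two_le.2 this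
        obtain ⟨j, hj⟩ := exists_ne i
        have hdj := congrFun hd j
        simp only [ne_eq, hj, not_false_eq_true, Pi.single_eq_of_ne, Pi.smul_apply, smul_eq_mul,
          zero_eq_mul, hne j, or_false] at hdj
        have hdi := congrFun hd i
        simp [hdj] at hdi
  · rintro ⟨c, hc⟩
    have : x = c • branchSum lam := by
      apply theta_ext T.hℓ i₀
      intro i
      rw [hc, map_smul, theta_branchSum, Matrix.smul_single, smul_eq_mul]
    rw [this]
    exact smul_mem_I T c hlam

end Toupie

namespace Toupie

section Universal

variable {k : Type u} [Field k] {t : ℕ} {ℓ : Fin t → ℕ} (hℓ : ∀ i, 1 ≤ ℓ i)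

include hℓ in
lemma mul_eV_mid (x : PathAlg k t ℓ) (i : Fin t) {b : ℕ} (hb0 : 0 < b) (hb : b < ℓ i) (c : k)
    (h : ∀ u, theta hℓ i x u (vtx t ℓ i b) = if u = .src then c else 0) :
    x * eV (vtx t ℓ i b) = c • subE i 0 b := by
  apply theta_ext hℓ i
  intro j
  rw [map_mul, theta_eV, map_smul, theta_subE hℓ j i hb0 hb.le]
  have hj : ∀ u, theta hℓ j x u (vtx t ℓ i b) = if i = j ∧ u = .src then c else 0 := by
    intro u
    by_cases hij : i = j
    · subst hij
      simp [h]
    · rw [if_neg (fun h' => hij h'.1)]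
      by_cases hu : u = vtx t ℓ i b
      · rw [hu, theta_diag_eq hℓ j i, h, if_neg]
        rw [vtx_eq_src_iff]
        omega
      · by_contra h0
        obtain ⟨a', b', -, -, -, h2⟩ := exists_of_theta_ne_zero hℓ j x h0 hu
        rw [vtx_mid i b hb0 hb, eq_comm, vtx_eq_mid_iff] at h2
        exact hij h2.1.symm
  ext u v
  by_cases hv : v = vtx t ℓ i b
  · subst hv
    rw [Matrix.mul_single_apply_same, mul_one, hj]
    by_cases hij : i = j
    · subst hij
      by_cases hu : u = .src <;> simp [hu, eq_comm]
    · simp [hij]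
  · rw [Matrix.mul_single_apply_of_ne _ _ _ _ _ hv]
    by_cases hij : i = j
    · subst hij
      simp [Ne.symm hv]
    · simp [hij]

include hℓ in
lemma eV_mid_mul (x : PathAlg k t ℓ) (i : Fin t) {a : ℕ} (ha0 : 0 < a) (ha : a < ℓ i) (c : k)
    (h : ∀ v, theta hℓ i x (vtx t ℓ i a) v = if v = .snk then c else 0) :
    eV (vtx t ℓ i a) * x = c • subE i a (ℓ i) := by
  apply theta_ext hℓ i
  intro j
  rw [map_mul, theta_eV, map_smul, theta_subE hℓ j i ha le_rfl]
  have hj : ∀ v, theta hℓ j x (vtx t ℓ i a) v = if i = j ∧ v = .snk then c else 0 := by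
    intro v
    by_cases hij : i = j
    · subst hij
      simp [h]
    · rw [if_neg (fun h' => hij h'.1)]
      by_cases hu : vtx t ℓ i a = v
      · rw [← hu, theta_diag_eq hℓ j i, h, if_neg]
        rw [vtx_eq_snk_iff i a (hℓ i) ha.le]
        omega
      · by_contra h0
        obtain ⟨a', b', -, -, h1, -⟩ := exists_of_theta_ne_zero hℓ j x h0 hu
        rw [vtx_mid i a ha0 ha, eq_comm, vtx_eq_mid_iff] at h1
        exact hij h1.1.symm
  ext u v
  by_cases hu : u = vtx t ℓ i a
  · subst hu
    rw [Matrix.single_mul_apply_same, one_mul, hj]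
    by_cases hij : i = j
    · subst hij
      by_cases hv : v = .snk <;> simp [hv, vtx_last i (hℓ i), eq_comm]
    · simp [hij]
  · rw [Matrix.single_mul_apply_of_ne _ _ _ _ _ hu]
    by_cases hij : i = j
    · subst hij
      simp [Ne.symm hu]
    · simp [hij]

end Universal

namespace OneRel

variable {k : Type u} [Field k] {T : ToupieAlg k} {lam : Fin T.t → k} (h : OneRel T lam)
include h

lemma mkHom_branchSum : mkHom T (branchSum lam) = 0 := by
  rw [mkHom_eq_zero_iff, h.mem_iff]
  exact ⟨1, fun i => by rw [theta_branchSum, one_mul]⟩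

/-- A relation between the last arrows of the branches is a multiple of the defining
relation. -/
lemma exists_of_sum_mul_last (y : Fin T.t → Alg T)
    (hy : ∑ i, y i * mkHom T (lam i • subE i (T.ℓ i - 1) (T.ℓ i)) = 0) :
    ∃ c : k, ∀ i, y i * mkHom T (eV (vtx T.t T.ℓ i (T.ℓ i - 1))) =
      c • mkHom T (subE i 0 (T.ℓ i - 1)) := by
  choose x hx using fun i => mkHom_surjective T (y i)
  have hmem : ∑ i, x i * (lam i • subE i (T.ℓ i - 1) (T.ℓ i)) ∈ T.I := by
    rw [← mkHom_eq_zero_iff, map_sum]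
    simpa only [map_mul, hx] using hy
  obtain ⟨c, hc⟩ := (h.mem_iff _).1 hmem
  refine ⟨c, fun j => ?_⟩
  have hj := h.two_le j
  rw [← hx, ← map_mul, ← map_smul, mul_eV_mid T.hℓ (x j) j (by omega) (by omega) c]
  intro u
  have h1 := hc j
  rw [map_sum, Finset.sum_eq_single j] at h1
  · rw [map_mul, map_smul, theta_subE_self _ _ (by omega) le_rfl, vtx_last _ (T.hℓ j),
      mul_smul_comm] at h1
    have h2 := congrFun (congrFun h1 u) .snk
    rw [Matrix.smul_apply, Matrix.mul_single_apply_same, Matrix.single_apply] at h2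
    apply mul_left_cancel₀ (h.ne_zero j)
    simp only [mul_one, smul_eq_mul, and_true] at h2
    rw [h2]
    by_cases hu : u = .src
    · simp [hu, mul_comm]
    · simp [hu, Ne.symm hu]
  · intro i _ hij
    have := h.two_le i
    rw [map_mul, map_smul, theta_subE_of_ne T.hℓ hij (by omega) le_rfl, smul_zero, mul_zero]
  · simp

/-- A relation between the first arrows of the branches is a multiple of the defining
relation. -/
lemma exists_of_sum_first_mul (y : Fin T.t → Alg T)
    (hy : ∑ i, mkHom T (subE i 0 1) * y i = 0) :
    ∃ c : k, ∀ i, mkHom T (eV (vtx T.t T.ℓ i 1)) * y i =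
      c • mkHom T (lam i • subE i 1 (T.ℓ i)) := by
  choose x hx using fun i => mkHom_surjective T (y i)
  have hmem : ∑ i, subE i 0 1 * x i ∈ T.I := by
    rw [← mkHom_eq_zero_iff, map_sum]
    simpa only [map_mul, hx] using hy
  obtain ⟨c, hc⟩ := (h.mem_iff _).1 hmem
  refine ⟨c, fun j => ?_⟩
  have hj := h.two_le j
  rw [← hx, ← map_mul, ← map_smul, smul_smul,
    eV_mid_mul T.hℓ (x j) j (by omega) (by omega) (c * lam j)]
  intro v
  have h1 := hc j
  rw [map_sum, Finset.sum_eq_single j] at h1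
  · rw [map_mul, theta_subE_self _ _ (by omega) (T.hℓ j), vtx_zero] at h1
    have h2 := congrFun (congrFun h1 .src) v
    rw [Matrix.single_mul_apply_same, Matrix.single_apply, one_mul] at h2
    rw [h2]
    by_cases hu : v = .snk
    · simp [hu]
    · simp [hu, Ne.symm hu]
  · intro i _ hij
    rw [map_mul, theta_subE_of_ne T.hℓ hij (by omega) (T.hℓ i), zero_mul]
  · simp

lemma mul_e0_eq_zero (i : Fin T.t) (y : Alg T)
    (hy : y * mkHom T (subE i 0 (T.ℓ i - 1)) = 0) : y * mkHom T (eV .src) = 0 := by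
  obtain ⟨x, rfl⟩ := mkHom_surjective T y
  rw [← map_mul, mkHom_eq_zero_iff, h.mem_iff] at hy
  obtain ⟨c, hc⟩ := hy
  have hi := h.two_le i
  have h1 := hc i
  rw [map_mul, theta_subE_self _ _ (by omega) (by omega), vtx_zero] at h1
  have hne : Vtx.snk ≠ vtx T.t T.ℓ i (T.ℓ i - 1) := by
    rw [ne_eq, eq_comm, vtx_eq_snk_iff _ _ (T.hℓ i) (by omega)]
    omega
  have hc0 : c = 0 := by
    have h2 := congrFun (congrFun h1 .src) .snk
    rw [Matrix.mul_single_apply_of_ne _ _ _ _ _ hne, Matrix.single_apply_same] at h2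
    exact (mul_eq_zero.1 h2.symm).resolve_right (h.ne_zero i)
  have hcol : ∀ j u, theta T.hℓ j x u .src = 0 := by
    intro j u
    by_cases hu : u = .src
    · rw [hu, theta_diag_eq T.hℓ j i]
      have h2 := congrFun (congrFun h1 .src) (vtx T.t T.ℓ i (T.ℓ i - 1))
      rwa [Matrix.mul_single_apply_same, mul_one, hc0, zero_mul, Matrix.single_zero] at h2
    · by_contra h0
      obtain ⟨a, b, hab, -, -, h2⟩ := exists_of_theta_ne_zero T.hℓ j x h0 hu
      rw [eq_comm, vtx_eq_src_iff] at h2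
      omega
  rw [← map_mul]
  suffices x * eV .src = 0 by rw [this, map_zero]
  apply theta_ext T.hℓ i
  intro j
  rw [map_mul, theta_eV, map_zero]
  ext u v
  by_cases hv : v = .src
  · subst hv
    rw [Matrix.mul_single_apply_same, hcol]
    simp
  · rw [Matrix.mul_single_apply_of_ne _ _ _ _ _ hv]
    simp

lemma einf_mul_eq_zero (i : Fin T.t) (y : Alg T)
    (hy : mkHom T (subE i 1 (T.ℓ i)) * y = 0) : mkHom T (eV .snk) * y = 0 := by
  obtain ⟨x, rfl⟩ := mkHom_surjective T y
  rw [← map_mul, mkHom_eq_zero_iff, h.mem_iff] at hy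
  obtain ⟨c, hc⟩ := hy
  have hi := h.two_le i
  have h1 := hc i
  rw [map_mul, theta_subE_self _ _ (by omega) (by omega), vtx_last _ (T.hℓ i)] at h1
  have hne : Vtx.src ≠ vtx T.t T.ℓ i 1 := by
    rw [ne_eq, eq_comm, vtx_eq_src_iff]
    omega
  have hc0 : c = 0 := by
    have h2 := congrFun (congrFun h1 .src) .snk
    rw [Matrix.single_mul_apply_of_ne _ _ _ _ _ hne, Matrix.single_apply_same] at h2
    exact (mul_eq_zero.1 h2.symm).resolve_right (h.ne_zero i)
  have hrow : ∀ j u, theta T.hℓ j x .snk u = 0 := by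
    intro j u
    by_cases hu : .snk = u
    · rw [← hu, theta_diag_eq T.hℓ j i]
      have h2 := congrFun (congrFun h1 (vtx T.t T.ℓ i 1)) .snk
      rwa [Matrix.single_mul_apply_same, one_mul, hc0, zero_mul, Matrix.single_zero] at h2
    · by_contra h0
      obtain ⟨a, b, hab, hb, h2, -⟩ := exists_of_theta_ne_zero T.hℓ j x h0 hu
      rw [eq_comm, vtx_eq_snk_iff _ _ (T.hℓ j) (by omega)] at h2
      omega
  rw [← map_mul]
  suffices eV .snk * x = 0 by rw [this, map_zero]
  apply theta_ext T.hℓ i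
  intro j
  rw [map_mul, theta_eV, map_zero]
  ext u v
  by_cases hv : u = .snk
  · subst hv
    rw [Matrix.single_mul_apply_same, hrow]
    simp
  · rw [Matrix.single_mul_apply_of_ne _ _ _ _ _ hv]
    simp

end OneRel

lemma _root_.Module.Injective.exists_extension_of_ker_le {R : Type u} [Ring R] {E X Y : Type u}
    [AddCommGroup E] [Module R E] [AddCommGroup X] [Module R X] [AddCommGroup Y] [Module R Y]
    (hE : Module.Injective R E) (f : X →ₗ[R] Y) (g : X →ₗ[R] E)
    (hfg : LinearMap.ker f ≤ LinearMap.ker g) : ∃ h : Y →ₗ[R] E, ∀ x, h (f x) = g x := by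
  obtain ⟨h, hh⟩ := hE.out ((LinearMap.ker f).liftQ f le_rfl)
    (by rw [← LinearMap.ker_eq_bot, Submodule.ker_liftQ_eq_bot _ _ _ le_rfl])
    ((LinearMap.ker f).liftQ g hfg)
  exact ⟨h, fun x => by simpa using hh (Submodule.Quotient.mk x)⟩

namespace OneRel

variable {k : Type u} [Field k] {T : ToupieAlg k} {lam : Fin T.t → k} (h : OneRel T lam)
include h

section Projective

variable {P : Type*} [AddCommGroup P] [Module (Alg T)ᵐᵒᵖ P] [Module.Projective (Alg T)ᵐᵒᵖ P]

lemma smul_e0_eq_zero_of_projective (i : Fin T.t) (p : P)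
    (hp : op (mkHom T (subE i 0 (T.ℓ i - 1))) • p = 0) : op (mkHom T (eV .src)) • p = 0 := by
  obtain ⟨s, hs⟩ := Module.Projective.out (R := (Alg T)ᵐᵒᵖ) (P := P)
  apply hs.injective
  rw [map_smul, map_zero]
  ext x
  have h1 := DFunLike.congr_fun (congrArg s hp) x
  rw [map_smul, map_zero, Finsupp.smul_apply, Finsupp.zero_apply, smul_eq_mul] at h1
  rw [Finsupp.smul_apply, Finsupp.zero_apply, smul_eq_mul]
  apply unop_injective
  rw [unop_mul, unop_op, unop_zero]
  apply h.mul_e0_eq_zero i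
  simpa using congrArg unop h1

lemma exists_smul_of_projective (κ : Fin T.t → P)
    (hκ : ∀ i, op (mkHom T (eV (vtx T.t T.ℓ i (T.ℓ i - 1)))) • κ i = κ i)
    (hsum : ∑ i, op (mkHom T (lam i • subE i (T.ℓ i - 1) (T.ℓ i))) • κ i = 0) :
    ∃ q : P, ∀ i, op (mkHom T (subE i 0 (T.ℓ i - 1))) • q = κ i := by
  obtain ⟨s, hs⟩ := Module.Projective.out (R := (Alg T)ᵐᵒᵖ) (P := P)
  have key : ∀ x, ∃ c : k, ∀ i, unop (s (κ i) x) * mkHom T (eV (vtx T.t T.ℓ i (T.ℓ i - 1))) =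
      c • mkHom T (subE i 0 (T.ℓ i - 1)) := by
    intro x
    apply h.exists_of_sum_mul_last
    have h1 := congrArg unop (DFunLike.congr_fun (congrArg s hsum) x)
    rw [map_sum, map_zero, Finsupp.finsetSum_apply, Finsupp.zero_apply, unop_zero,
      Finset.unop_sum] at h1
    rw [← h1]
    refine Finset.sum_congr rfl fun i _ => ?_
    rw [LinearMap.map_smul s, Finsupp.smul_apply, smul_eq_mul, unop_mul, unop_op]
  choose c hc using key
  have hcoord : ∀ i x, s (κ i) x = op (c x • mkHom T (subE i 0 (T.ℓ i - 1))) := by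
    intro i x
    rw [← hc x i, op_mul, op_unop]
    conv_lhs => rw [← hκ i, map_smul, Finsupp.smul_apply, smul_eq_mul]
  let S : Finset P := Finset.univ.biUnion fun i => (s (κ i)).support
  let q' : P →₀ (Alg T)ᵐᵒᵖ := Finsupp.onFinset S
    (fun x => if x ∈ S then op (algebraMap k (Alg T) (c x)) else 0) (fun x hx => by
      by_contra h'
      exact hx (if_neg h'))
  refine ⟨Finsupp.linearCombination _ id q', fun i => ?_⟩
  rw [← map_smul]
  conv_rhs => rw [← hs (κ i)]
  congr 1
  ext x
  rw [Finsupp.smul_apply, smul_eq_mul]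
  by_cases hx : x ∈ S
  · rw [hcoord]
    simp only [q', Finsupp.onFinset_apply, if_pos hx]
    rw [← op_mul, Algebra.smul_def]
  · have h0 : s (κ i) x = 0 := by
      by_contra h'
      exact hx (Finset.mem_biUnion.2 ⟨i, Finset.mem_univ _, Finsupp.mem_support_iff.2 h'⟩)
    simp only [q', Finsupp.onFinset_apply, if_neg hx, mul_zero, h0]

end Projective

/-- A module with a nonzero element at the source killed by all penultimate paths has
projective dimension at least two. -/
lemma not_pdLeOne (M : ModuleCat.{u} (Alg T)ᵐᵒᵖ) (z : M) (hz : z ≠ 0)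
    (hz0 : op (mkHom T (eV .src)) • z = z)
    (hzπ : ∀ i, op (mkHom T (subE i 0 (T.ℓ i - 1))) • z = 0) : ¬ PdLeOne (Alg T)ᵐᵒᵖ M := by
  rintro ⟨P, f, hf, hP, hK⟩
  have i₀ : Fin T.t := ⟨0, by have := T.ht; omega⟩
  obtain ⟨p', hp'⟩ := hf z
  obtain ⟨p, hp, hfp⟩ : ∃ p : P, op (mkHom T (eV .src)) • p = p ∧ f p = z :=
    ⟨op (mkHom T (eV .src)) • p', by rw [smul_smul, ← op_mul, ← map_mul, eV_mul_self],
      by rw [map_smul, hp', hz0]⟩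
  let κ : Fin T.t → LinearMap.ker f := fun i =>
    ⟨op (mkHom T (subE i 0 (T.ℓ i - 1))) • p, by
      rw [LinearMap.mem_ker, map_smul, hfp, hzπ]⟩
  obtain ⟨q, hq⟩ := h.exists_smul_of_projective κ
    (fun i => by
      apply Subtype.ext
      have := h.two_le i
      change op _ • op _ • p = op _ • p
      rw [smul_smul, ← op_mul, ← map_mul, subE_mul_eV T.hℓ i (by omega) (by omega)])
    (by
      apply Subtype.ext
      rw [AddSubmonoidClass.coe_finsetSum]
      change ∑ i, op _ • op _ • p = 0
      have : ∀ i : Fin T.t, op (mkHom T (lam i • subE i (T.ℓ i - 1) (T.ℓ i))) •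
          op (mkHom T (subE i 0 (T.ℓ i - 1))) • p = op (mkHom T (lam i • wE i)) • p := by
        intro i
        rw [smul_smul, ← op_mul, ← map_mul, mul_smul_comm,
          subE_mul_subE' T.hℓ i (by omega) (by omega) le_rfl]
        rfl
      simp_rw [this]
      rw [← Finset.sum_smul, ← Finset.op_sum, ← map_sum, ← branchSum_apply, h.mkHom_branchSum]
      simp)
  have hu := h.smul_e0_eq_zero_of_projective i₀ (p - (q : P)) (by
    rw [smul_sub, sub_eq_zero]
    exact (congrArg Subtype.val (hq i₀)).symm)
  rw [smul_sub, hp, sub_eq_zero] at hu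
  apply hz
  rw [← hfp, hu, map_smul, LinearMap.mem_ker.1 q.2, smul_zero]

/-- A module with an element at the sink which is not a combination of elements coming from
the first interior vertices of the branches has injective dimension at least two. -/
lemma not_idLeOne (M : ModuleCat.{u} (Alg T)ᵐᵒᵖ) (y : M)
    (hy : op (mkHom T (eV .snk)) • y = y)
    (hy' : ∀ m : Fin T.t → M, ∑ i, op (mkHom T (lam i • subE i 1 (T.ℓ i))) • m i ≠ y) :
    ¬ IdLeOne (Alg T)ᵐᵒᵖ M := by
  rintro ⟨E, f, hf, hE, hC⟩
  have i₀ : Fin T.t := ⟨0, by have := T.ht; omega⟩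
  set γ : Fin T.t → (Alg T)ᵐᵒᵖ := fun i => op (mkHom T (lam i • subE i 1 (T.ℓ i))) with hγ
  have hγe : ∀ i, γ i * op (mkHom T (eV (vtx T.t T.ℓ i 1))) = γ i := by
    intro i
    have := h.two_le i
    rw [hγ]
    simp only
    rw [← op_mul, ← map_mul, mul_smul_comm, eV_mul_subE T.hℓ i (by omega) le_rfl]
  obtain ⟨η, hη, hη'⟩ : ∃ η : E, γ i₀ • η = f y ∧
      op (mkHom T (eV (vtx T.t T.ℓ i₀ 1))) • η = η := by
    obtain ⟨g, hg⟩ := hE.exists_extension_of_ker_le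
      (LinearMap.toSpanSingleton (Alg T)ᵐᵒᵖ (Alg T)ᵐᵒᵖ (γ i₀))
      (LinearMap.toSpanSingleton (Alg T)ᵐᵒᵖ E (f y)) (by
        intro r hr
        rw [LinearMap.mem_ker, LinearMap.toSpanSingleton_apply, smul_eq_mul] at hr
        rw [LinearMap.mem_ker, LinearMap.toSpanSingleton_apply, ← hy, map_smul, smul_smul]
        have h1 : mkHom T (subE i₀ 1 (T.ℓ i₀)) * unop r = 0 := by
          have h2 := congrArg unop hr
          rw [hγ] at h2
          simp only [unop_mul, unop_op, unop_zero, map_smul, smul_mul_assoc] at h2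
          exact (smul_eq_zero.1 h2).resolve_left (h.ne_zero i₀)
        have h3 := congrArg op (h.einf_mul_eq_zero i₀ _ h1)
        rw [op_mul, op_unop, op_zero] at h3
        rw [h3, zero_smul])
    refine ⟨op (mkHom T (eV (vtx T.t T.ℓ i₀ 1))) • g 1, ?_, ?_⟩
    · rw [smul_smul, hγe, ← map_smul, smul_eq_mul, mul_one]
      simpa using hg 1
    · rw [smul_smul, ← op_mul, ← map_mul, eV_mul_self]
  obtain ⟨g, hg⟩ := hC.exists_extension_of_ker_le
    (Fintype.linearCombination (Alg T)ᵐᵒᵖ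
      (fun i : Fin T.t => (op (mkHom T (subE i 0 1)) : (Alg T)ᵐᵒᵖ)))
    ((LinearMap.toSpanSingleton (Alg T)ᵐᵒᵖ (E ⧸ LinearMap.range f)
      (Submodule.Quotient.mk η)) ∘ₗ LinearMap.proj i₀) (by
      intro r hr
      rw [LinearMap.mem_ker, Fintype.linearCombination_apply] at hr
      rw [LinearMap.mem_ker, LinearMap.comp_apply, LinearMap.proj_apply,
        LinearMap.toSpanSingleton_apply, ← Submodule.Quotient.mk_smul,
        Submodule.Quotient.mk_eq_zero]
      obtain ⟨c, hc⟩ := h.exists_of_sum_first_mul (fun i => unop (r i)) (by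
        simpa using congrArg unop hr)
      have h1 : r i₀ * op (mkHom T (eV (vtx T.t T.ℓ i₀ 1))) =
          op (algebraMap k (Alg T) c) * γ i₀ := by
        have h2 := congrArg op (hc i₀)
        rw [op_mul, op_unop] at h2
        rw [h2, hγ]
        simp only
        rw [← op_mul, Algebra.smul_def, Algebra.commutes]
      rw [← hη', smul_smul, h1, mul_smul, hη, ← map_smul]
      exact ⟨_, rfl⟩)
  obtain ⟨c, hc⟩ := Submodule.Quotient.mk_surjective _ (g 1)
  have hm : ∀ i, ∃ m : M, f m =
      op (mkHom T (subE i 0 1)) • c - (Pi.single i 1 : Fin T.t → (Alg T)ᵐᵒᵖ) i₀ • η := by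
    intro i
    have h1 := hg (Pi.single i 1)
    rw [Fintype.linearCombination_apply_single, one_smul] at h1
    have h2 : g (op (mkHom T (subE i 0 1))) = op (mkHom T (subE i 0 1)) • g 1 := by
      rw [← map_smul, smul_eq_mul, mul_one]
    rw [h2, ← hc, LinearMap.comp_apply, LinearMap.proj_apply, LinearMap.toSpanSingleton_apply,
      ← Submodule.Quotient.mk_smul, ← Submodule.Quotient.mk_smul, Submodule.Quotient.eq] at h1
    exact h1
  choose m hm using hm
  apply hy' (fun i => - m i)
  apply hf
  rw [map_sum]
  simp only [map_smul, map_neg, hm, smul_neg, smul_sub, Finset.sum_neg_distrib,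
    Finset.sum_sub_distrib]
  have h1 : ∑ i, γ i • (op (mkHom T (subE i 0 1)) • c) = 0 := by
    have : ∀ i : Fin T.t, γ i • op (mkHom T (subE i 0 1)) • c =
        op (mkHom T (lam i • wE i)) • c := by
      intro i
      rw [hγ]
      simp only
      rw [smul_smul, ← op_mul, ← map_mul, mul_smul_comm,
        subE_mul_subE' T.hℓ i (by omega) (T.hℓ i) le_rfl]
      rfl
    simp_rw [this]
    rw [← Finset.sum_smul, ← Finset.op_sum, ← map_sum, ← branchSum_apply, h.mkHom_branchSum]
    simp
  have h2 : ∑ i, γ i • ((Pi.single i 1 : Fin T.t → (Alg T)ᵐᵒᵖ) i₀ • η) = f y := by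
    rw [Finset.sum_eq_single i₀]
    · rw [Pi.single_eq_same, one_smul, hη]
    · intro i _ hi
      rw [Pi.single_eq_of_ne hi.symm, zero_smul, smul_zero]
    · simp
  have h1' := h1
  have h2' := h2
  simp only [hγ, map_smul] at h1' h2'
  rw [h1', h2']
  simp

end OneRel

end Toupie

namespace Toupie

section Modules

variable {k : Type u} [Field k] {T : ToupieAlg k}

/-- The ring map out of `A = kQ/I` induced by an algebra map out of `kQ` killing `I`. -/
def liftRing {C : Type*} [Ring C] [Algebra k C] (f : PathAlg k T.t T.ℓ →ₐ[k] C)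
    (hf : ∀ x ∈ T.I, f x = 0) : Alg T →+* C :=
  T.I.ringCon.lift (f : PathAlg k T.t T.ℓ →+* C) fun x y hxy => by
    have h : f (x - y) = 0 := hf _ ((TwoSidedIdeal.rel_iff T.I x y).1 hxy)
    exact sub_eq_zero.1 ((f.toLinearMap.map_sub x y).symm.trans h)

lemma liftRing_mkHom {C : Type*} [Ring C] [Algebra k C] (f : PathAlg k T.t T.ℓ →ₐ[k] C)
    (hf : ∀ x ∈ T.I, f x = 0) (x : PathAlg k T.t T.ℓ) : liftRing f hf (mkHom T x) = f x :=
  rfl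

/-- The algebra map out of `A = kQ/I` induced by an algebra map out of `kQ` killing `I`. -/
def liftAlg {C : Type*} [Ring C] [Algebra k C] (f : PathAlg k T.t T.ℓ →ₐ[k] C)
    (hf : ∀ x ∈ T.I, f x = 0) : Alg T →ₐ[k] C :=
  { liftRing f hf with
    commutes' := fun c => by
      have h := liftRing_mkHom f hf (algebraMap k _ c)
      rw [AlgHom.commutes, AlgHom.commutes] at h
      exact h }

@[simp] lemma liftAlg_mkHom {C : Type*} [Ring C] [Algebra k C] (f : PathAlg k T.t T.ℓ →ₐ[k] C)
    (hf : ∀ x ∈ T.I, f x = 0) (x : PathAlg k T.t T.ℓ) : liftAlg f hf (mkHom T x) = f x :=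
  liftRing_mkHom f hf x

/-- The right module given by a representation of `A` on a vector space. -/
@[nolint unusedArguments]
def RepMod {V : Type u} [AddCommGroup V] [Module k V] (_ : Alg T →ₐ[k] (Module.End k V)ᵐᵒᵖ) :
    Type u := V

variable {V : Type u} [AddCommGroup V] [Module k V] (ρ : Alg T →ₐ[k] (Module.End k V)ᵐᵒᵖ)

instance : AddCommGroup (RepMod ρ) := inferInstanceAs (AddCommGroup V)

instance : Module k (RepMod ρ) := inferInstanceAs (Module k V)

instance : Module (Alg T)ᵐᵒᵖ (RepMod ρ) where
  smul r v := unop (ρ (unop r)) v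
  one_smul v := LinearMap.congr_fun (congrArg unop (map_one ρ)) v
  mul_smul r s v := LinearMap.congr_fun (congrArg unop (map_mul ρ (unop s) (unop r))) v
  smul_zero r := map_zero (unop (ρ (unop r)))
  smul_add r := map_add (unop (ρ (unop r)))
  add_smul r s v := LinearMap.congr_fun (congrArg unop (map_add ρ (unop r) (unop s))) v
  zero_smul v := LinearMap.congr_fun (congrArg unop (map_zero ρ)) v

lemma op_smul_repMod (a : Alg T) (v : RepMod ρ) : op a • v = (unop (ρ a) v : V) := rfl

lemma algebraMap_smul_repMod (c : k) (v : RepMod ρ) :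
    op (algebraMap k (Alg T) c) • v = c • v := by
  rw [op_smul_repMod, AlgHom.commutes]
  rfl

end Modules

/-- A representation of the toupie quiver all of whose maps are, up to scalars, identities except
possibly the ones at the arrows leaving the source, given at branch `i` by an endomorphism `F i`
of a space `Y`, followed by the scalar `ε i` at the next arrow. -/
structure StarRep {k : Type u} [Field k] (T : ToupieAlg k) (lam : Fin T.t → k) (Y : Type u)
    [AddCommGroup Y] [Module k Y] where
  one : OneRel T lam
  F : Fin T.t → Module.End k Y
  ε : Fin T.t → k
  rel : ∑ i, (lam i * ε i) • F i = 0

namespace StarRep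

variable {k : Type u} [Field k] {T : ToupieAlg k} {lam : Fin T.t → k} {Y : Type u}
  [AddCommGroup Y] [Module k Y] (D : StarRep T lam Y)

/-- The map at the `j`-th arrow of branch `i`. -/
def arrowMap (i : Fin T.t) : ℕ → Module.End k Y
  | 0 => D.F i
  | 1 => D.ε i • 1
  | _ + 2 => 1

/-- The operator on `Vtx → Y` moving the component at `v` to `w` via `g`. -/
def moveMap (v w : Vtx T.t T.ℓ) (g : Module.End k Y) : Module.End k (Vtx T.t T.ℓ → Y) :=
  LinearMap.single k (fun _ => Y) w ∘ₗ g ∘ₗ LinearMap.proj v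

lemma moveMap_apply (v w : Vtx T.t T.ℓ) (g : Module.End k Y) (f : Vtx T.t T.ℓ → Y) :
    moveMap v w g f = Pi.single w (g (f v)) := rfl

lemma moveMap_mul (v w w' x : Vtx T.t T.ℓ) (g g' : Module.End k Y) :
    moveMap w' x g' * moveMap v w g = if w = w' then moveMap v x (g' * g) else 0 := by
  refine LinearMap.ext fun f => ?_
  split_ifs with h
  · subst h
    simp [moveMap_apply]
  · simp [moveMap_apply, Pi.single_eq_of_ne (Ne.symm h)]

/-- The representation of the quiver on the space `Vtx → Y`. -/
def quiverRep : QuiverRep k T.t T.ℓ (Module.End k (Vtx T.t T.ℓ → Y))ᵐᵒᵖ where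
  ev v := op (moveMap v v 1)
  ar i j := if j < T.ℓ i then op (moveMap (vtx T.t T.ℓ i j) (vtx T.t T.ℓ i (j + 1))
    (D.arrowMap i j)) else 0
  ev_mul_ev v w := by
    rw [← op_mul, moveMap_mul]
    split_ifs with h
    · subst h; simp
    · simp
  sum_ev := by
    rw [← Finset.op_sum, ← op_one]
    congr 1
    refine LinearMap.ext fun f => ?_
    rw [LinearMap.sum_apply]
    simp only [moveMap_apply, Module.End.one_apply]
    exact Finset.univ_sum_single f
  ev_mul_ar i j hj := by
    rw [if_pos hj, ← op_mul, moveMap_mul, if_pos rfl, mul_one]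
  ar_mul_ev i j hj := by
    rw [if_pos hj, ← op_mul, moveMap_mul, if_pos rfl, one_mul]
  ar_zero i j hj := if_neg (by omega)

/-- The map at the path from the `a`-th to the `b`-th vertex of branch `i`. -/
def pathMap (i : Fin T.t) (a b : ℕ) : Module.End k Y :=
  if a = 0 then (if b = 1 then D.F i else D.ε i • D.F i) else
    if b = a + 1 then D.arrowMap i a else if a = 1 then D.ε i • 1 else 1

lemma pr_eq (i : Fin T.t) {a b : ℕ} (hab : a < b) (hb : b ≤ T.ℓ i) :
    D.quiverRep.pr i a b =
      op (moveMap (vtx T.t T.ℓ i a) (vtx T.t T.ℓ i b) (D.pathMap i a b)) := by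
  obtain ⟨n, rfl⟩ : ∃ n, b = a + n + 1 := ⟨b - a - 1, by omega⟩
  unfold pathMap
  have har : ∀ j, j < T.ℓ i → D.quiverRep.ar i j =
    op (moveMap (vtx T.t T.ℓ i j) (vtx T.t T.ℓ i (j + 1)) (D.arrowMap i j)) :=
    fun j hj => if_pos hj
  induction n generalizing a with
  | zero =>
    rw [QuiverRep.pr_succ _ _ (by omega), QuiverRep.pr_self, mul_one, har a (by omega)]
    match a with
    | 0 => simp [arrowMap]
    | 1 => simp [arrowMap]
    | a + 2 => simp [arrowMap]
  | succ n ih =>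
    rw [QuiverRep.pr_succ _ _ (by omega), har a (by omega),
      show a + (n + 1) + 1 = (a + 1) + n + 1 by omega, ih (by omega) (by omega), ← op_mul,
      moveMap_mul, if_pos rfl]
    congr 2
    match a with
    | 0 =>
      by_cases h : 0 + 1 + n + 1 = 0 + 1 + 1
      · simp [arrowMap, h]
      · simp [arrowMap, h]
    | 1 =>
      by_cases h : n = 0
      · subst h; simp [arrowMap]
      · simp [arrowMap, h]
    | a + 2 =>
      by_cases h : n = 0
      · subst h; simp [arrowMap]
      · simp [arrowMap, h]

lemma hom_eq_zero (x : PathAlg k T.t T.ℓ) (hx : x ∈ T.I) : D.quiverRep.hom T.hℓ x = 0 := by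
  obtain ⟨c, hc⟩ := (D.one.mem_iff x).1 hx
  have i₀ : Fin T.t := ⟨0, by have := T.ht; omega⟩
  have hx' : x = c • branchSum lam := by
    apply theta_ext T.hℓ i₀
    intro i
    rw [map_smul, theta_branchSum, hc, Matrix.smul_single, smul_eq_mul]
  have hw : ∀ i, D.quiverRep.hom T.hℓ (wE i) = op (moveMap .src .snk (D.ε i • D.F i)) := by
    intro i
    have := D.one.two_le i
    rw [wE, QuiverRep.hom_subE, D.pr_eq i (by omega) le_rfl, vtx_zero, vtx_last _ (T.hℓ i), pathMap,
      if_pos rfl, if_neg (by omega)]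
  rw [hx', map_smul, branchSum_apply, map_sum]
  simp_rw [map_smul, hw]
  suffices ∑ i, lam i • op (moveMap (T := T) .src .snk (D.ε i • D.F i)) = 0 by rw [this, smul_zero]
  apply unop_injective
  refine LinearMap.ext fun f => ?_
  rw [Finset.unop_sum, LinearMap.sum_apply]
  have h2 := LinearMap.congr_fun D.rel (f .src)
  rw [LinearMap.sum_apply] at h2
  simp only [unop_smul, unop_op, LinearMap.smul_apply, moveMap_apply, ← Pi.single_smul, unop_zero,
    LinearMap.zero_apply, smul_smul] at h2 ⊢
  funext v
  rw [Finset.sum_apply]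
  by_cases hv : v = .snk
  · subst hv
    simpa using h2
  · simp [Pi.single_eq_of_ne hv]

/-- The representation of `A` on `Vtx → Y`. -/
def algRep : Alg T →ₐ[k] (Module.End k (Vtx T.t T.ℓ → Y))ᵐᵒᵖ :=
  liftAlg (D.quiverRep.hom T.hℓ) D.hom_eq_zero

/-- The `v`-component of an element. -/
def coord (f : RepMod D.algRep) (v : Vtx T.t T.ℓ) : Y := (f : Vtx T.t T.ℓ → Y) v

@[ext] lemma ext {f g : RepMod D.algRep} (h : ∀ v, D.coord f v = D.coord g v) : f = g := funext h

/-- The element with `v`-component `y` and other components zero. -/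
def elt (v : Vtx T.t T.ℓ) (y : Y) : RepMod D.algRep := (Pi.single v y : Vtx T.t T.ℓ → Y)

lemma coord_elt (v w : Vtx T.t T.ℓ) (y : Y) :
    D.coord (D.elt v y) w = if w = v then y else 0 := Pi.single_apply v y w

end StarRep

end Toupie

namespace Toupie

lemma op_smul_smul_repMod {k : Type u} [Field k] {T : ToupieAlg k} {V : Type u} [AddCommGroup V]
    [Module k V] (ρ : Alg T →ₐ[k] (Module.End k V)ᵐᵒᵖ) (c : k) (a : Alg T) (v : RepMod ρ) :
    op (c • a) • v = c • op a • v := by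
  rw [Algebra.smul_def, Algebra.commutes, op_mul, mul_smul, algebraMap_smul_repMod]

namespace StarRep

variable {k : Type u} [Field k] {T : ToupieAlg k} {lam : Fin T.t → k} {Y : Type u}
  [AddCommGroup Y] [Module k Y] (D : StarRep T lam Y)

lemma coord_add (f g : RepMod D.algRep) (v) : D.coord (f + g) v = D.coord f v + D.coord g v := rfl

lemma coord_sum {α : Type*} (s : Finset α) (f : α → RepMod D.algRep) (v) :
    D.coord (∑ x ∈ s, f x) v = ∑ x ∈ s, D.coord (f x) v := by
  induction s using Finset.induction_on with
  | empty => rfl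
  | insert a s ha ih => rw [Finset.sum_insert ha, Finset.sum_insert ha, coord_add, ih]

lemma coord_smul (c : k) (f : RepMod D.algRep) (v) : D.coord (c • f) v = c • D.coord f v := rfl

lemma coord_zero (v) : D.coord (0 : RepMod D.algRep) v = 0 := rfl

lemma elt_add (v) (y z : Y) : D.elt v (y + z) = D.elt v y + D.elt v z :=
  (LinearMap.single k (fun _ => Y) v).map_add y z

lemma elt_smul (c : k) (v) (y : Y) : D.elt v (c • y) = c • D.elt v y :=
  (LinearMap.single k (fun _ => Y) v).map_smul c y

lemma elt_zero (v) : D.elt v 0 = 0 := Pi.single_zero v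

lemma op_eV_smul (v : Vtx T.t T.ℓ) (f : RepMod D.algRep) :
    op (mkHom T (eV v)) • f = D.elt v (D.coord f v) := by
  rw [op_smul_repMod, algRep, liftAlg_mkHom, QuiverRep.hom_eV]
  rfl

lemma op_subE_smul (i : Fin T.t) {a b : ℕ} (hab : a < b) (hb : b ≤ T.ℓ i)
    (f : RepMod D.algRep) :
    op (mkHom T (subE i a b)) • f =
      D.elt (vtx T.t T.ℓ i b) (D.pathMap i a b (D.coord f (vtx T.t T.ℓ i a))) := by
  rw [op_smul_repMod, algRep, liftAlg_mkHom, QuiverRep.hom_subE, D.pr_eq i hab hb]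
  rfl

lemma pathMap_first (i : Fin T.t) : D.pathMap i 0 1 = D.F i := by simp [pathMap]

lemma pathMap_zero (i : Fin T.t) {b : ℕ} (hb : 2 ≤ b) : D.pathMap i 0 b = D.ε i • D.F i := by
  simp [pathMap, show b ≠ 1 by omega]

lemma pathMap_one (i : Fin T.t) (b : ℕ) : D.pathMap i 1 b = D.ε i • 1 := by
  simp [pathMap, arrowMap]

lemma pathMap_of_two_le (i : Fin T.t) {a : ℕ} (ha : 2 ≤ a) (b : ℕ) : D.pathMap i a b = 1 := by
  obtain ⟨a, rfl⟩ := Nat.exists_eq_add_of_le' ha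
  simp [pathMap, arrowMap]

/-- The subspace of the elements whose components in the interior of branch `i` lie in the range
of `F i`. -/
def subspace : Submodule k (RepMod D.algRep) where
  carrier := {f | ∀ i a, 0 < a → a < T.ℓ i → D.coord f (vtx T.t T.ℓ i a) ∈ LinearMap.range (D.F i)}
  add_mem' hf hg i a h0 h := add_mem (hf i a h0 h) (hg i a h0 h)
  zero_mem' _ _ _ _ := zero_mem _
  smul_mem' c _ hf i a h0 h := Submodule.smul_mem _ c (hf i a h0 h)

lemma elt_mem_subspace {v : Vtx T.t T.ℓ} {y : Y}
    (hy : ∀ i a, 0 < a → a < T.ℓ i → vtx T.t T.ℓ i a = v → y ∈ LinearMap.range (D.F i)) :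
    D.elt v y ∈ D.subspace := by
  intro i a h0 h
  rw [coord_elt]
  split_ifs with hv
  · exact hy i a h0 h hv
  · exact zero_mem _

/-- The right `A`-module of the elements whose components in the interior of branch `i` lie in the
range of `F i`. -/
def submod : Submodule (Alg T)ᵐᵒᵖ (RepMod D.algRep) where
  carrier := D.subspace
  add_mem' := D.subspace.add_mem
  zero_mem' := D.subspace.zero_mem
  smul_mem' := by
    intro r f hf
    obtain ⟨x, hx⟩ := mkHom_surjective T (unop r)
    obtain rfl : r = op (mkHom T x) := by rw [hx, op_unop]
    rw [eq_sum_coeffs T.hℓ x, map_sum, Finset.op_sum, Finset.sum_smul]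
    refine D.subspace.sum_mem fun p _ => ?_
    rw [map_smul, op_smul_smul_repMod]
    refine D.subspace.smul_mem _ ?_
    cases p with
    | vert v =>
      rw [pathE_vert, op_eV_smul]
      refine D.elt_mem_subspace fun i a h0 h hv => ?_
      rw [← hv]
      exact hf i a h0 h
    | sub i a b hab hb =>
      rw [pathE_sub, op_subE_smul _ _ hab hb]
      refine D.elt_mem_subspace fun i' a' h0 h hv => ?_
      rw [vtx_mid i' a' h0 h, eq_comm, vtx_eq_mid_iff] at hv
      obtain ⟨rfl, hv⟩ := hv
      have hb' : b = a' := by simp at hv; omega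
      subst hb'
      rcases Nat.lt_or_ge 1 a with ha | ha
      · rw [pathMap_of_two_le _ _ ha]
        exact hf i a (by omega) (by omega)
      obtain rfl | rfl : a = 0 ∨ a = 1 := by omega
      · rcases Nat.lt_or_ge 1 b with hb1 | hb1
        · rw [pathMap_zero _ _ hb1, LinearMap.smul_apply]
          exact Submodule.smul_mem _ _ ⟨_, rfl⟩
        · obtain rfl : b = 1 := by omega
          rw [pathMap_first]
          exact ⟨_, rfl⟩
      · rw [pathMap_one, LinearMap.smul_apply]
        exact Submodule.smul_mem _ _ (hf i 1 (by omega) (by omega))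

instance [Module.Finite k Y] : Module.Finite (Alg T)ᵐᵒᵖ D.submod := by
  have h1 : Module.Finite k (RepMod D.algRep) :=
    inferInstanceAs (Module.Finite k (Vtx T.t T.ℓ → Y))
  obtain ⟨s, hs⟩ := (inferInstance : Module.Finite k D.subspace)
  refine ⟨⟨s.image fun f => (⟨f.1, f.2⟩ : D.submod), ?_⟩⟩
  rw [eq_top_iff]
  rintro ⟨f, hf⟩ -
  have hmem : (⟨f, hf⟩ : D.subspace) ∈ Submodule.span k (s : Set D.subspace) := hs ▸ trivial
  have key : ∀ g ∈ Submodule.span k (s : Set D.subspace), (⟨g.1, g.2⟩ : D.submod) ∈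
      Submodule.span (Alg T)ᵐᵒᵖ
        ((s.image fun f => (⟨f.1, f.2⟩ : D.submod) : Finset D.submod) : Set D.submod) := by
    intro g hg
    induction hg using Submodule.span_induction with
    | mem g hg => exact Submodule.subset_span (Finset.mem_coe.2 (Finset.mem_image_of_mem _ hg))
    | zero => exact zero_mem _
    | add g g' _ _ ih ih' => exact add_mem ih ih'
    | smul c g _ ih =>
      have := Submodule.smul_mem _ (op (algebraMap k (Alg T) c)) ih
      convert this using 1
      apply Subtype.ext
      exact (algebraMap_smul_repMod D.algRep c g.1).symm
  exact key _ hmem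

/-- A vertex not in the interior of a branch. -/
def IsEnd (v : Vtx T.t T.ℓ) : Prop := ∀ i a, 0 < a → a < T.ℓ i → vtx T.t T.ℓ i a ≠ v

lemma isEnd_src : IsEnd (T := T) .src := fun i a h0 _ h => by
  rw [vtx_eq_src_iff] at h
  omega

lemma isEnd_snk : IsEnd (T := T) .snk := fun i a _ h h' => by
  rw [vtx_eq_snk_iff _ _ (T.hℓ i) h.le] at h'
  omega

/-- The element of the module concentrated at the source or the sink. -/
def endElt {v : Vtx T.t T.ℓ} (hv : IsEnd v) (y : Y) : D.submod :=
  ⟨D.elt v y, D.elt_mem_subspace fun i a h0 h h' => (hv i a h0 h h').elim⟩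

section Hom

variable {D} {Y' : Type u} [AddCommGroup Y'] [Module k Y'] {D' : StarRep T lam Y'}
  (φ : D.submod →ₗ[(Alg T)ᵐᵒᵖ] D'.submod)

lemma coord_map_eq (v : Vtx T.t T.ℓ) (f : D.submod) :
    D'.coord (φ f).1 v = D'.coord (φ (op (mkHom T (eV v)) • f)).1 v := by
  rw [map_smul, Submodule.coe_smul, op_eV_smul, coord_elt, if_pos rfl]

/-- The linear map at the source or the sink of a homomorphism. -/
def endMap {v : Vtx T.t T.ℓ} (hv : IsEnd v) : Y →ₗ[k] Y' where
  toFun y := D'.coord (φ (D.endElt hv y)).1 v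
  map_add' y z := by
    rw [show D.endElt hv (y + z) = D.endElt hv y + D.endElt hv z from
      Subtype.ext (D.elt_add v y z), map_add]
    rfl
  map_smul' c y := by
    rw [show D.endElt hv (c • y) = op (algebraMap k (Alg T) c) • D.endElt hv y from
      Subtype.ext ((D.elt_smul c v y).trans (algebraMap_smul_repMod _ _ _).symm), map_smul,
      Submodule.coe_smul, algebraMap_smul_repMod]
    rfl

lemma endMap_apply {v : Vtx T.t T.ℓ} (hv : IsEnd v) (y : Y) :
    endMap φ hv y = D'.coord (φ (D.endElt hv y)).1 v := rfl

lemma coord_map {v : Vtx T.t T.ℓ} (hv : IsEnd v) (f : D.submod) :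
    D'.coord (φ f).1 v = endMap φ hv (D.coord f.1 v) := by
  rw [coord_map_eq]
  congr 3
  exact Subtype.ext (D.op_eV_smul v f.1)

lemma endMap_comm (i : Fin T.t) (y : Y) : endMap φ isEnd_snk (D.ε i • D.F i y) =
    D'.ε i • D'.F i (endMap φ isEnd_src y) := by
  have h2 := D.one.two_le i
  have hD : op (mkHom T (subE i 0 (T.ℓ i))) • D.endElt isEnd_src y =
      D.endElt isEnd_snk (D.ε i • D.F i y) := by
    apply Subtype.ext
    rw [Submodule.coe_smul, op_subE_smul _ _ (by omega) le_rfl, pathMap_zero _ _ h2, vtx_zero,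
      vtx_last _ (T.hℓ i)]
    simp only [endElt, coord_elt, if_true, LinearMap.smul_apply]
  rw [endMap_apply, ← hD, map_smul, Submodule.coe_smul, op_subE_smul _ _ (by omega) le_rfl,
    pathMap_zero _ _ h2, vtx_zero, vtx_last _ (T.hℓ i), coord_elt, if_pos rfl]
  rfl

lemma F_endMap_eq_zero (i : Fin T.t) (y : Y) (hy : D.F i y = 0) :
    D'.F i (endMap φ isEnd_src y) = 0 := by
  have hD : op (mkHom T (subE i 0 1)) • D.endElt isEnd_src y = 0 := by
    apply Subtype.ext
    rw [Submodule.coe_smul, op_subE_smul _ _ (by omega) (T.hℓ i), pathMap_first, vtx_zero]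
    simp only [endElt, coord_elt, if_true, hy, elt_zero, Submodule.coe_zero]
  have h1 := congrArg (fun f => D'.coord (φ f).1 (vtx T.t T.ℓ i 1)) hD
  rwa [map_smul, map_zero, Submodule.coe_smul, op_subE_smul _ _ (by omega) (T.hℓ i),
    pathMap_first, coord_elt, if_pos rfl, vtx_zero] at h1

lemma endMap_mem_range (i : Fin T.t) (h3 : 3 ≤ T.ℓ i) (y : Y) (hy : y ∈ LinearMap.range (D.F i)) :
    endMap φ isEnd_snk y ∈ LinearMap.range (D'.F i) := by
  let f : D.submod := ⟨D.elt (vtx T.t T.ℓ i 2) y, D.elt_mem_subspace fun i' a h0 h h' => by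
    rw [vtx_mid i' a h0 h, eq_comm, vtx_eq_mid_iff] at h'
    rwa [← h'.1]⟩
  have hD : op (mkHom T (subE i 2 (T.ℓ i))) • f = D.endElt isEnd_snk y := by
    apply Subtype.ext
    rw [Submodule.coe_smul, op_subE_smul _ _ (by omega) le_rfl, pathMap_of_two_le _ _ le_rfl,
      vtx_last _ (T.hℓ i)]
    simp only [f, endElt, coord_elt, if_true, Module.End.one_apply]
  rw [endMap_apply, ← hD, map_smul, Submodule.coe_smul, op_subE_smul _ _ (by omega) le_rfl,
    pathMap_of_two_le _ _ le_rfl, vtx_last _ (T.hℓ i), coord_elt, if_pos rfl,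
    Module.End.one_apply]
  exact (φ f).2 i 2 (by omega) (by omega)

lemma eq_zero_of_endMap_eq_zero (h0 : endMap φ isEnd_src = 0) (h1 : endMap φ isEnd_snk = 0) :
    φ = 0 := by
  refine LinearMap.ext fun f => Subtype.ext (D'.ext fun v => ?_)
  rw [LinearMap.zero_apply, Submodule.coe_zero, coord_zero]
  obtain ⟨i, a, ha, rfl⟩ := exists_vtx_eq T.hℓ ⟨0, by have := T.ht; omega⟩ v
  rcases Nat.eq_zero_or_pos a with rfl | ha0
  · rw [vtx_zero, coord_map φ isEnd_src, h0, LinearMap.zero_apply]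
  rcases ha.eq_or_lt with rfl | ha
  · rw [vtx_last _ (T.hℓ i), coord_map φ isEnd_snk, h1, LinearMap.zero_apply]
  rcases Nat.lt_or_ge 1 a with ha1 | ha1
  · have h2 : op (mkHom T (subE i a (T.ℓ i))) • φ f =
        φ (op (mkHom T (subE i a (T.ℓ i))) • f) := (map_smul _ _ _).symm
    have h3 := congrArg (fun f => D'.coord f.1 .snk) h2
    rwa [coord_map φ isEnd_snk, h1, LinearMap.zero_apply, Submodule.coe_smul,
      op_subE_smul _ _ ha le_rfl, pathMap_of_two_le _ _ ha1, vtx_last _ (T.hℓ i), coord_elt,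
      if_pos rfl] at h3
  · obtain rfl : a = 1 := by omega
    obtain ⟨y, hy⟩ := f.2 i 1 ha0 ha
    have hD : op (mkHom T (eV (vtx T.t T.ℓ i 1))) • f =
        op (mkHom T (subE i 0 1)) • D.endElt isEnd_src y := by
      apply Subtype.ext
      rw [Submodule.coe_smul, op_eV_smul, Submodule.coe_smul,
        op_subE_smul _ _ (by omega) (T.hℓ i), pathMap_first, vtx_zero, ← hy]
      simp only [endElt, coord_elt, if_true]
    rw [coord_map_eq, hD, map_smul, Submodule.coe_smul, op_subE_smul _ _ (by omega) (T.hℓ i),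
      pathMap_first, vtx_zero, coord_map φ isEnd_src, h0, LinearMap.zero_apply, map_zero,
      coord_elt, if_pos rfl]

lemma endMap_injective (hφ : Function.Injective φ) : Function.Injective (endMap φ isEnd_src) := by
  rw [injective_iff_map_eq_zero]
  intro y hy
  have h1 : φ (D.endElt isEnd_src y) = 0 := by
    have h2 : op (mkHom T (eV .src)) • D.endElt isEnd_src y = D.endElt isEnd_src y := by
      apply Subtype.ext
      rw [Submodule.coe_smul, op_eV_smul]
      simp only [endElt, coord_elt, if_true]
    rw [← h2, map_smul]
    apply Subtype.ext
    rw [Submodule.coe_smul, op_eV_smul, ← endMap_apply, hy, elt_zero]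
    rfl
  have h3 := congrArg (fun f => D.coord f.1 .src) (hφ (h1.trans (map_zero φ).symm))
  simpa [endElt, coord_elt, coord_zero] using h3

end Hom

lemma endMap_comp (φ ψ : D.submod →ₗ[(Alg T)ᵐᵒᵖ] D.submod) {v : Vtx T.t T.ℓ} (hv : IsEnd v) :
    endMap (φ ∘ₗ ψ) hv = endMap φ hv ∘ₗ endMap ψ hv :=
  LinearMap.ext fun y => by
    rw [endMap_apply, LinearMap.comp_apply, coord_map φ hv, LinearMap.comp_apply]
    rfl

lemma endMap_id {v : Vtx T.t T.ℓ} (hv : IsEnd v) :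
    endMap (LinearMap.id : D.submod →ₗ[(Alg T)ᵐᵒᵖ] D.submod) hv = LinearMap.id :=
  LinearMap.ext fun y => by
    rw [endMap_apply, LinearMap.id_apply, endElt, coord_elt, if_pos rfl, LinearMap.id_apply]

lemma endMap_sub (φ ψ : D.submod →ₗ[(Alg T)ᵐᵒᵖ] D.submod) {v : Vtx T.t T.ℓ} (hv : IsEnd v) :
    endMap (φ - ψ) hv = endMap φ hv - endMap ψ hv := rfl

end StarRep

end Toupie

namespace Toupie

section Shift

variable {k : Type u} [Field k] {n : ℕ}

/-- The backward shift. -/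
def shift (k : Type u) [Field k] (n : ℕ) : Module.End k (Fin (n + 1) → k) where
  toFun x i := if h : i.1 + 1 < n + 1 then x ⟨i.1 + 1, h⟩ else 0
  map_add' x y := by funext i; simp only [Pi.add_apply]; split_ifs <;> simp
  map_smul' c x := by funext i; simp only [Pi.smul_apply]; split_ifs <;> simp

lemma shift_apply (x : Fin (n + 1) → k) (i : Fin (n + 1)) :
    shift k n x i = if h : i.1 + 1 < n + 1 then x ⟨i.1 + 1, h⟩ else 0 := rfl

lemma shift_pow_apply (m : ℕ) (x : Fin (n + 1) → k) (i : Fin (n + 1)) :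
    (shift k n ^ m) x i = if h : i.1 + m < n + 1 then x ⟨i.1 + m, h⟩ else 0 := by
  induction m generalizing i with
  | zero => simp [i.2]
  | succ m ih =>
    rw [pow_succ', Module.End.mul_apply, shift_apply]
    by_cases h : i.1 + 1 < n + 1
    · rw [dif_pos h, ih]
      simp only [show i.1 + 1 + m = i.1 + (m + 1) by omega]
    · rw [dif_neg h, dif_neg (by omega)]

lemma shift_single_zero (c : k) : shift k n (Pi.single 0 c) = 0 := by
  funext i
  rw [shift_apply]
  split_ifs with h
  · rw [Pi.single_eq_of_ne]
    · rfl
    · exact Fin.ne_of_val_ne (by simp)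
  · rfl

lemma eq_single_of_shift_eq_zero {x : Fin (n + 1) → k} (hx : shift k n x = 0) :
    x = x 0 • Pi.single 0 1 := by
  funext i
  by_cases hi : i = 0
  · subst hi; simp
  · obtain ⟨j, hj⟩ : ∃ j, i.1 = j + 1 :=
      Nat.exists_eq_succ_of_ne_zero fun h => hi (Fin.ext h)
    have h1 := congrFun hx ⟨j, by omega⟩
    rw [shift_apply, dif_pos (by simpa [← hj] using i.2)] at h1
    have h2 : i = ⟨j + 1, by omega⟩ := Fin.ext hj
    rw [Pi.smul_apply, Pi.single_eq_of_ne hi, smul_zero, h2]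
    exact h1

lemma exists_shift_pow_eq {x : Fin (n + 1) → k} (hx : x ≠ 0) :
    ∃ m, ∃ s : k, s ≠ 0 ∧ (shift k n ^ m) x = s • Pi.single 0 1 := by
  have hS : (Finset.univ.filter fun i => x i ≠ 0).Nonempty := by
    obtain ⟨i, hi⟩ := Function.ne_iff.1 hx
    exact ⟨i, by simpa using hi⟩
  obtain ⟨i, hi, hmax⟩ := Finset.exists_max_image _ (fun i : Fin (n + 1) => i.1) hS
  refine ⟨i.1, x i, (Finset.mem_filter.1 hi).2, ?_⟩
  funext j
  rw [shift_pow_apply]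
  by_cases hj : j = 0
  · subst hj
    rw [dif_pos (by rw [Fin.val_zero]; omega), Pi.smul_apply, Pi.single_eq_same, smul_eq_mul,
      mul_one]
    exact congrArg x (Fin.ext (by simp))
  · rw [Pi.smul_apply, Pi.single_eq_of_ne hj, smul_zero]
    split_ifs with h
    · by_contra h'
      have := hmax ⟨j.1 + i.1, h⟩ (by simpa using h')
      simp only at this
      exact hj (Fin.ext (by rw [Fin.val_zero]; omega))
    · rfl

lemma eq_zero_of_commute_shift (P : Module.End k (Fin (n + 1) → k)) (hP : P * P = P)
    (hc : Commute P (shift k n)) (hb : P (Pi.single 0 1) = 0) : P = 0 := by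
  refine LinearMap.ext fun x => ?_
  by_contra hx
  obtain ⟨m, s, hs, hm⟩ := exists_shift_pow_eq hx
  have h1 : P ((shift k n ^ m) (P x)) = (shift k n ^ m) (P x) := by
    have h2 := LinearMap.congr_fun (hc.pow_right m).eq (P x)
    rw [Module.End.mul_apply, Module.End.mul_apply, ← Module.End.mul_apply P P, hP] at h2
    exact h2
  rw [hm, map_smul, hb, smul_zero] at h1
  have h3 := congrFun h1 0
  simp at h3
  exact hs h3.symm

lemma eq_zero_or_one_of_commute_shift (P : Module.End k (Fin (n + 1) → k)) (hP : P * P = P)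
    (hc : Commute P (shift k n)) : P = 0 ∨ P = 1 := by
  have h1 : shift k n (P (Pi.single 0 1)) = 0 := by
    have h2 := LinearMap.congr_fun hc.eq (Pi.single 0 1)
    rw [Module.End.mul_apply, Module.End.mul_apply, shift_single_zero, map_zero] at h2
    exact h2.symm
  have h3 := eq_single_of_shift_eq_zero h1
  set c := P (Pi.single 0 1) 0 with hcdef
  have h4 : c * c = c := by
    have h5 := LinearMap.congr_fun hP (Pi.single 0 1)
    rw [Module.End.mul_apply, h3, map_smul, h3] at h5
    simpa using congrFun h5 0
  rcases (show c = 0 ∨ c = 1 by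
    rw [← sub_eq_zero (b := (1 : k)), ← mul_eq_zero]; linear_combination h4) with h0 | h0
  · left
    exact eq_zero_of_commute_shift P hP hc (by rw [h3, h0, zero_smul])
  · right
    have h6 := eq_zero_of_commute_shift (1 - P) (by
      rw [mul_sub, sub_mul, sub_mul, hP]; simp) ((Commute.one_left _).sub_left hc) (by
      rw [LinearMap.sub_apply, h3, h0, one_smul, Module.End.one_apply, sub_self])
    rw [sub_eq_zero] at h6
    exact h6.symm

/-- The automorphism `(a, b) ↦ (a + b, a + b + J b)`, with `J` the shift. -/
def jordanMap (k : Type u) [Field k] (n : ℕ) :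
    Module.End k ((Fin (n + 1) → k) × (Fin (n + 1) → k)) :=
  LinearMap.prod (LinearMap.fst k _ _ + LinearMap.snd k _ _)
    (LinearMap.fst k _ _ + LinearMap.snd k _ _ + shift k n ∘ₗ LinearMap.snd k _ _)

lemma jordanMap_apply (a b : Fin (n + 1) → k) :
    jordanMap k n (a, b) = (a + b, a + b + shift k n b) := rfl

end Shift

namespace OneRel

variable {k : Type u} [Field k] {T : ToupieAlg k} {lam : Fin T.t → k} (h : OneRel T lam)
  {i₁ i₂ p q : Fin T.t} (hpq : p ≠ q) (hp₁ : p ≠ i₁) (hp₂ : p ≠ i₂) (hq₁ : q ≠ i₁) (hq₂ : q ≠ i₂)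
  (h12 : i₁ ≠ i₂)

include hp₁ hp₂ hq₁ hq₂ in
/-- The representations witnessing that an algebra with two long branches is not laura. -/
def jordanRep (n : ℕ) : StarRep T lam ((Fin (n + 1) → k) × (Fin (n + 1) → k)) where
  one := h
  F i := if i = i₁ then LinearMap.inl k _ _ ∘ₗ LinearMap.fst k _ _ else
    if i = i₂ then LinearMap.inr k _ _ ∘ₗ LinearMap.snd k _ _ else
    if i = p then (lam p)⁻¹ • jordanMap k n else
    if i = q then -(lam q)⁻¹ • jordanMap k n else 0
  ε i := if i = p ∨ i = q then 1 else 0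
  rel := by
    rw [Finset.sum_eq_add p q hpq]
    · simp only [if_neg hp₁, if_neg hp₂, if_neg hq₁, if_neg hq₂, if_neg hpq.symm, if_true,
        true_or, or_true, mul_one, smul_smul, neg_smul,
        mul_inv_cancel₀ (h.ne_zero _), mul_neg]
      exact add_neg_cancel _
    · rintro c - ⟨hcp, hcq⟩
      rw [if_neg (by simp [hcp, hcq]), mul_zero, zero_smul]
    · simp
    · simp

variable (n : ℕ)

lemma jordanRep_F₁ : (h.jordanRep hpq hp₁ hp₂ hq₁ hq₂ n).F i₁ =
    LinearMap.inl k _ _ ∘ₗ LinearMap.fst k _ _ := if_pos rfl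

include h12 in
lemma jordanRep_F₂ : (h.jordanRep hpq hp₁ hp₂ hq₁ hq₂ n).F i₂ =
    LinearMap.inr k _ _ ∘ₗ LinearMap.snd k _ _ := by
  simp only [jordanRep, if_neg h12.symm, if_true]

lemma jordanRep_Fp : (h.jordanRep hpq hp₁ hp₂ hq₁ hq₂ n).F p = (lam p)⁻¹ • jordanMap k n := by
  simp only [jordanRep, if_neg hp₁, if_neg hp₂, if_true]

lemma jordanRep_εp : (h.jordanRep hpq hp₁ hp₂ hq₁ hq₂ n).ε p = 1 := by
  simp only [jordanRep, true_or, if_true]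

include h12 in
lemma jordanRep_endMap (φ : (h.jordanRep hpq hp₁ hp₂ hq₁ hq₂ n).submod →ₗ[(Alg T)ᵐᵒᵖ]
      (h.jordanRep hpq hp₁ hp₂ hq₁ hq₂ n).submod) (h₁ : 3 ≤ T.ℓ i₁) (h₂ : 3 ≤ T.ℓ i₂) :
    ∃ P : Module.End k (Fin (n + 1) → k), Commute P (shift k n) ∧
      StarRep.endMap φ StarRep.isEnd_src = LinearMap.prodMap P P ∧
      StarRep.endMap φ StarRep.isEnd_snk = LinearMap.prodMap P P := by
  set α := StarRep.endMap φ StarRep.isEnd_src with hα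
  set β := StarRep.endMap φ StarRep.isEnd_snk with hβ
  have hα₁ : ∀ b, (α (0, b)).1 = 0 := by
    intro b
    have h1 := StarRep.F_endMap_eq_zero φ i₁ (0, b) (by rw [jordanRep_F₁]; rfl)
    rw [jordanRep_F₁] at h1
    exact congrArg Prod.fst h1
  have hα₂ : ∀ a, (α (a, 0)).2 = 0 := by
    intro a
    have h1 := StarRep.F_endMap_eq_zero φ i₂ (a, 0) (by rw [jordanRep_F₂ _ _ _ _ _ _ h12]; rfl)
    rw [jordanRep_F₂ _ _ _ _ _ _ h12] at h1
    exact congrArg Prod.snd h1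
  have hβ₁ : ∀ a, (β (a, 0)).2 = 0 := by
    intro a
    obtain ⟨y, hy⟩ := StarRep.endMap_mem_range φ i₁ h₁ (a, 0)
      (by rw [jordanRep_F₁]; exact ⟨(a, 0), rfl⟩)
    rw [jordanRep_F₁] at hy
    exact (congrArg Prod.snd hy).symm
  have hβ₂ : ∀ b, (β (0, b)).1 = 0 := by
    intro b
    obtain ⟨y, hy⟩ := StarRep.endMap_mem_range φ i₂ h₂ (0, b)
      (by rw [jordanRep_F₂ _ _ _ _ _ _ h12]; exact ⟨(0, b), rfl⟩)
    rw [jordanRep_F₂ _ _ _ _ _ _ h12] at hy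
    exact (congrArg Prod.fst hy).symm
  have hcomm : ∀ y, β (jordanMap k n y) = jordanMap k n (α y) := by
    intro y
    have h1 := StarRep.endMap_comm φ p y
    rw [jordanRep_εp, one_smul, one_smul, jordanRep_Fp, LinearMap.smul_apply,
      LinearMap.smul_apply, map_smul] at h1
    exact smul_right_injective _ (inv_ne_zero (h.ne_zero p)) h1
  let P := LinearMap.fst k _ _ ∘ₗ α ∘ₗ LinearMap.inl k (Fin (n + 1) → k) (Fin (n + 1) → k)
  let Q := LinearMap.snd k _ _ ∘ₗ α ∘ₗ LinearMap.inr k (Fin (n + 1) → k) (Fin (n + 1) → k)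
  let R := LinearMap.fst k _ _ ∘ₗ β ∘ₗ LinearMap.inl k (Fin (n + 1) → k) (Fin (n + 1) → k)
  let S := LinearMap.snd k _ _ ∘ₗ β ∘ₗ LinearMap.inr k (Fin (n + 1) → k) (Fin (n + 1) → k)
  have hαPQ : ∀ a b, α (a, b) = (P a, Q b) := by
    intro a b
    rw [show ((a, b) : (Fin (n + 1) → k) × (Fin (n + 1) → k)) = (a, 0) + (0, b) by simp, map_add]
    exact Prod.ext (by simp [P, hα₁]) (by simp [Q, hα₂])
  have hβRS : ∀ a b, β (a, b) = (R a, S b) := by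
    intro a b
    rw [show ((a, b) : (Fin (n + 1) → k) × (Fin (n + 1) → k)) = (a, 0) + (0, b) by simp, map_add]
    exact Prod.ext (by simp [R, hβ₂]) (by simp [S, hβ₁])
  have hkey : ∀ a b, R (a + b) = P a + Q b ∧
      S (a + b + shift k n b) = P a + Q b + shift k n (Q b) := by
    intro a b
    have h1 := hcomm (a, b)
    rw [hαPQ, jordanMap_apply, jordanMap_apply, hβRS] at h1
    exact ⟨congrArg Prod.fst h1, congrArg Prod.snd h1⟩
  have hPR : R = P := LinearMap.ext fun a => by simpa using (hkey a 0).1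
  have hPS : S = P := LinearMap.ext fun a => by simpa using (hkey a 0).2
  have hPQ : P = Q := LinearMap.ext fun b => by simpa [hPR] using (hkey 0 b).1
  refine ⟨P, ?_, ?_, ?_⟩
  · refine LinearMap.ext fun b => ?_
    have h1 := (hkey 0 b).2
    rw [hPS, ← hPQ, zero_add, map_add, map_zero, zero_add] at h1
    exact add_left_cancel h1
  · refine LinearMap.ext fun y => ?_
    rw [show y = (y.1, y.2) from rfl, hαPQ, ← hPQ]
    rfl
  · refine LinearMap.ext fun y => ?_
    rw [show y = (y.1, y.2) from rfl, hβRS, hPR, hPS]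
    rfl

/-- The module of `jordanRep`. -/
def jordanMod : ModuleCat.{u} (Alg T)ᵐᵒᵖ :=
  ModuleCat.of _ (h.jordanRep hpq hp₁ hp₂ hq₁ hq₂ n).submod

include h12 in
lemma indec_jordanMod (h₁ : 3 ≤ T.ℓ i₁) (h₂ : 3 ≤ T.ℓ i₂) :
    Indec (Alg T)ᵐᵒᵖ (h.jordanMod hpq hp₁ hp₂ hq₁ hq₂ n) := by
  set D := h.jordanRep hpq hp₁ hp₂ hq₁ hq₂ n
  refine ⟨⟨⟨D.endElt StarRep.isEnd_src (1, 0), 0, fun h0 => ?_⟩⟩, fun φ hφ => ?_⟩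
  · have h1 := congrArg (fun f : D.submod => D.coord f.1 .src) h0
    change D.coord _ .src = (0 : (Fin (n + 1) → k) × (Fin (n + 1) → k)) at h1
    simp only [StarRep.endElt, StarRep.coord_elt, if_true] at h1
    exact one_ne_zero (congrArg Prod.fst h1)
  · change D.submod →ₗ[(Alg T)ᵐᵒᵖ] D.submod at φ
    obtain ⟨P, hP, hα, hβ⟩ := h.jordanRep_endMap hpq hp₁ hp₂ hq₁ hq₂ h12 n φ h₁ h₂
    have hPP : P * P = P := by
      have h1 := D.endMap_comp φ φ StarRep.isEnd_src
      have h2 : φ ∘ₗ φ = φ := hφ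
      rw [h2, hα] at h1
      refine LinearMap.ext fun x => ?_
      exact (congrArg Prod.fst (LinearMap.congr_fun h1 (x, 0))).symm
    rcases eq_zero_or_one_of_commute_shift P hPP hP with rfl | rfl
    · left
      apply StarRep.eq_zero_of_endMap_eq_zero φ
      · rw [hα]; rfl
      · rw [hβ]; rfl
    · right
      have h3 : φ - LinearMap.id = 0 := by
        apply StarRep.eq_zero_of_endMap_eq_zero
        · rw [D.endMap_sub, D.endMap_id, hα, sub_eq_zero]; rfl
        · rw [D.endMap_sub, D.endMap_id, hβ, sub_eq_zero]; rfl
      exact sub_eq_zero.1 h3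

lemma fdMod_jordanMod : FdMod (Alg T)ᵐᵒᵖ (h.jordanMod hpq hp₁ hp₂ hq₁ hq₂ n) :=
  inferInstanceAs (Module.Finite (Alg T)ᵐᵒᵖ (h.jordanRep hpq hp₁ hp₂ hq₁ hq₂ n).submod)

include h12 in
lemma not_pdLeOne_jordanMod (h₁ : 3 ≤ T.ℓ i₁) (h₂ : 3 ≤ T.ℓ i₂) :
    ¬ PdLeOne (Alg T)ᵐᵒᵖ (h.jordanMod hpq hp₁ hp₂ hq₁ hq₂ n) := by
  set D := h.jordanRep hpq hp₁ hp₂ hq₁ hq₂ n with hD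
  refine h.not_pdLeOne _ (D.endElt StarRep.isEnd_src (-Pi.single 0 1, Pi.single 0 1))
    (fun h0 => ?_) ?_ fun i => ?_
  · have h1 := congrArg (fun f : D.submod => D.coord f.1 .src) h0
    change D.coord _ .src = (0 : (Fin (n + 1) → k) × (Fin (n + 1) → k)) at h1
    simp only [StarRep.endElt, StarRep.coord_elt, if_true] at h1
    have h2 := congrFun (congrArg Prod.snd h1) 0
    simp at h2
  · apply Subtype.ext
    change op _ • D.elt .src _ = _
    rw [D.op_eV_smul, D.coord_elt, if_pos rfl]
    rfl
  · apply Subtype.ext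
    have h2 := h.two_le i
    change op _ • D.elt .src _ = 0
    rw [D.op_subE_smul _ (by omega) (by omega), vtx_zero, D.coord_elt, if_pos rfl]
    convert D.elt_zero _
    have hg : jordanMap k n (-Pi.single 0 1, Pi.single 0 1) = 0 := by
      rw [jordanMap_apply, shift_single_zero]
      simp
    unfold StarRep.pathMap
    rw [if_pos rfl]
    have hlong : 3 ≤ T.ℓ i → ¬ (T.ℓ i - 1 = 1) := by omega
    by_cases e1 : i = i₁
    · subst e1
      rw [if_neg (hlong h₁), hD]
      simp [jordanRep, hp₁.symm, hq₁.symm]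
    by_cases e2 : i = i₂
    · subst e2
      rw [if_neg (hlong h₂), hD]
      simp [jordanRep, hp₂.symm, hq₂.symm]
    have hF : D.F i (-Pi.single 0 1, Pi.single 0 1) = 0 := by
      simp only [hD, jordanRep, if_neg e1, if_neg e2]
      split_ifs
      · rw [LinearMap.smul_apply, hg, smul_zero]
      · rw [LinearMap.smul_apply, hg, smul_zero]
      · rfl
    split_ifs
    · exact hF
    · rw [LinearMap.smul_apply, hF, smul_zero]

lemma not_idLeOne_jordanMod :
    ¬ IdLeOne (Alg T)ᵐᵒᵖ (h.jordanMod hpq hp₁ hp₂ hq₁ hq₂ n) := by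
  set D := h.jordanRep hpq hp₁ hp₂ hq₁ hq₂ n with hD
  refine h.not_idLeOne _ (D.endElt StarRep.isEnd_snk (0, Pi.single (Fin.last n) 1)) ?_
    fun m hm => ?_
  · apply Subtype.ext
    change op _ • D.elt .snk _ = _
    rw [D.op_eV_smul, D.coord_elt, if_pos rfl]
    rfl
  · change Fin T.t → D.submod at m
    have h1 := congrArg (fun f : D.submod => D.coord f.1 .snk) hm
    simp only [StarRep.endElt, StarRep.coord_elt, if_true] at h1
    have h2 : D.coord (∑ i, op (mkHom T (lam i • subE i 1 (T.ℓ i))) • m i : D.submod).1 .snk ∈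
        LinearMap.range (jordanMap k n) := by
      rw [AddSubmonoidClass.coe_finsetSum, D.coord_sum]
      refine Submodule.sum_mem _ fun i _ => ?_
      have hi := h.two_le i
      rw [Submodule.coe_smul, map_smul, op_smul_smul_repMod, D.coord_smul,
        D.op_subE_smul _ (by omega) le_rfl, vtx_last _ (T.hℓ i), D.coord_elt, if_pos rfl,
        D.pathMap_one, LinearMap.smul_apply, Module.End.one_apply]
      refine Submodule.smul_mem _ _ ?_
      obtain ⟨y, hy⟩ := (m i).2 i 1 (by omega) (by omega)
      rw [← hy]
      by_cases hi' : i = p ∨ i = q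
      · refine Submodule.smul_mem _ _ ?_
        rcases hi' with rfl | rfl
        · rw [hD, jordanRep_Fp]
          exact Submodule.smul_mem _ _ ⟨_, rfl⟩
        · simp only [hD, jordanRep, if_neg hq₁, if_neg hq₂, if_neg hpq.symm, if_true]
          exact Submodule.smul_mem _ _ ⟨_, rfl⟩
      · rw [show D.ε i = 0 from if_neg hi', zero_smul]
        exact zero_mem _
    obtain ⟨⟨a, b⟩, hab⟩ := h2
    rw [show D.coord (∑ i, op (mkHom T (lam i • subE i 1 (T.ℓ i))) • m i : D.submod).1 .snk = _
      from h1, jordanMap_apply] at hab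
    have h3 := congrFun (congrArg Prod.fst hab) (Fin.last n)
    have h4 := congrFun (congrArg Prod.snd hab) (Fin.last n)
    simp only [Pi.add_apply, Pi.zero_apply, Pi.single_eq_same] at h3 h4
    rw [h3, shift_apply, dif_neg (by simp)] at h4
    simp at h4

lemma le_of_jordanMod_equiv {n n' : ℕ} (e : h.jordanMod hpq hp₁ hp₂ hq₁ hq₂ n ≃ₗ[(Alg T)ᵐᵒᵖ]
    h.jordanMod hpq hp₁ hp₂ hq₁ hq₂ n') : n ≤ n' := by
  let φ : (h.jordanRep hpq hp₁ hp₂ hq₁ hq₂ n).submod →ₗ[(Alg T)ᵐᵒᵖ]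
    (h.jordanRep hpq hp₁ hp₂ hq₁ hq₂ n').submod := e.toLinearMap
  have h1 := LinearMap.finrank_le_finrank_of_injective
    (StarRep.endMap_injective φ e.injective)
  simp only [Module.finrank_prod, Module.finrank_fin_fun] at h1
  omega

include h hpq hp₁ hp₂ hq₁ hq₂ h12 in
lemma not_laura (h₁ : 3 ≤ T.ℓ i₁) (h₂ : 3 ≤ T.ℓ i₂) : ¬ Laura (Alg T)ᵐᵒᵖ := by
  rintro ⟨S, hS, hall⟩
  have hex : ∀ n, ∃ N : S, Nonempty (h.jordanMod hpq hp₁ hp₂ hq₁ hq₂ n ≃ₗ[(Alg T)ᵐᵒᵖ] N.1) := by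
    intro n
    have hI := h.indec_jordanMod hpq hp₁ hp₂ hq₁ hq₂ h12 n h₁ h₂
    have hF := h.fdMod_jordanMod hpq hp₁ hp₂ hq₁ hq₂ n
    obtain ⟨N, hN, e⟩ := hall _ hI hF
      (fun hL => h.not_pdLeOne_jordanMod hpq hp₁ hp₂ hq₁ hq₂ h12 n h₁ h₂
        (hL.2.2 _ hI hF Relation.ReflTransGen.refl))
      (fun hR => h.not_idLeOne_jordanMod hpq hp₁ hp₂ hq₁ hq₂ n
        (hR.2.2 _ hI hF Relation.ReflTransGen.refl))
    exact ⟨⟨N, hN⟩, e⟩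
  choose N e using hex
  have : Finite S := hS
  obtain ⟨n, n', hne, hN⟩ := Finite.exists_ne_map_eq_of_infinite N
  obtain ⟨e₁⟩ := e n
  obtain ⟨e₂⟩ := e n'
  rw [← hN] at e₂
  exact hne (le_antisymm (h.le_of_jordanMod_equiv hpq hp₁ hp₂ hq₁ hq₂ (e₁.trans e₂.symm))
    (h.le_of_jordanMod_equiv hpq hp₁ hp₂ hq₁ hq₂ (e₂.trans e₁.symm)))

end OneRel

end Toupie

namespace Toupie

/-! ### Incidence algebras of rooted forests -/

section Incidence

variable (k : Type u) [Field k] (S : Type) [Fintype S] [PartialOrder S]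

/-- The incidence algebra of a finite poset. -/
def IncAlg : Subalgebra k (Matrix S S k) where
  carrier := {h | ∀ u v, ¬ u ≤ v → h u v = 0}
  mul_mem' {a b} ha hb u v huv := by
    rw [Matrix.mul_apply]
    refine Finset.sum_eq_zero fun w _ => ?_
    by_cases huw : u ≤ w
    · rw [hb w v fun hwv => huv (huw.trans hwv), mul_zero]
    · rw [ha u w huw, zero_mul]
  add_mem' {a b} ha hb u v huv := by
    rw [Matrix.add_apply, ha u v huv, hb u v huv, add_zero]
  algebraMap_mem' c u v huv := by
    rw [Matrix.algebraMap_matrix_apply, if_neg fun h => huv h.le]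

variable {S}

/-- The matrix unit at `(u, v)` if `u ≤ v`, and zero otherwise. -/
def incUnit (u v : S) : IncAlg k S :=
  ⟨if u ≤ v then Matrix.single u v 1 else 0, fun x y hxy => by
    split_ifs with h
    · rw [Matrix.single_apply_of_ne]
      rintro ⟨rfl, rfl⟩
      exact hxy h
    · rfl⟩

variable {k}

lemma incUnit_of_le {u v : S} (h : u ≤ v) :
    (incUnit k u v : Matrix S S k) = Matrix.single u v 1 := if_pos h

lemma incUnit_of_not_le {u v : S} (h : ¬ u ≤ v) : incUnit k u v = 0 := Subtype.ext (if_neg h)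

lemma incUnit_apply {u v : S} (h : u ≤ v) (x y : S) :
    (incUnit k u v : Matrix S S k) x y = if u = x ∧ v = y then 1 else 0 := by
  rw [incUnit_of_le h, Matrix.single_apply]

lemma incUnit_mul {u v : S} (huv : u ≤ v) (h : IncAlg k S) :
    incUnit k u v * h = ∑ w, h.1 v w • incUnit k u w := by
  apply Subtype.ext
  ext x y
  rw [Subalgebra.coe_mul, incUnit_of_le huv, AddSubmonoidClass.coe_finsetSum, Matrix.sum_apply]
  simp only [Subalgebra.coe_smul, Matrix.smul_apply, smul_eq_mul]
  by_cases hx : x = u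
  · subst hx
    rw [Matrix.single_mul_apply_same, one_mul, Finset.sum_eq_single y]
    · by_cases hvy : v ≤ y
      · rw [incUnit_apply (huv.trans hvy), if_pos ⟨rfl, rfl⟩, mul_one]
      · rw [h.2 v y hvy, zero_mul]
    · intro w _ hw
      by_cases hxw : x ≤ w
      · rw [incUnit_apply hxw, if_neg fun h => hw h.2, mul_zero]
      · rw [incUnit_of_not_le hxw]; exact mul_zero _
    · simp
  · rw [Matrix.single_mul_apply_of_ne _ _ _ _ _ hx, Finset.sum_eq_zero]
    intro w _
    by_cases hxw : u ≤ w
    · rw [incUnit_apply hxw, if_neg fun h => hx h.1.symm, mul_zero]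
    · rw [incUnit_of_not_le hxw]; exact mul_zero _

lemma mul_incUnit {u v : S} (huv : u ≤ v) (h : IncAlg k S) :
    h * incUnit k u v = ∑ w, h.1 w u • incUnit k w v := by
  apply Subtype.ext
  ext x y
  rw [Subalgebra.coe_mul, incUnit_of_le huv, AddSubmonoidClass.coe_finsetSum, Matrix.sum_apply]
  simp only [Subalgebra.coe_smul, Matrix.smul_apply, smul_eq_mul]
  by_cases hy : y = v
  · subst hy
    rw [Matrix.mul_single_apply_same, mul_one, Finset.sum_eq_single x]
    · by_cases hxu : x ≤ u
      · rw [incUnit_apply (hxu.trans huv), if_pos ⟨rfl, rfl⟩, mul_one]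
      · rw [h.2 x u hxu, zero_mul]
    · intro w _ hw
      by_cases hxw : w ≤ y
      · rw [incUnit_apply hxw, if_neg fun h => hw h.1, mul_zero]
      · rw [incUnit_of_not_le hxw]; exact mul_zero _
    · simp
  · rw [Matrix.mul_single_apply_of_ne _ _ _ _ _ hy, Finset.sum_eq_zero]
    intro w _
    by_cases hxw : w ≤ v
    · rw [incUnit_apply hxw, if_neg fun h => hy h.2.symm, mul_zero]
    · rw [incUnit_of_not_le hxw]; exact mul_zero _

lemma incUnit_mul_incUnit {u v w : S} (huv : u ≤ v) (hvw : v ≤ w) :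
    incUnit k u v * incUnit k v w = incUnit k u w := by
  apply Subtype.ext
  rw [Subalgebra.coe_mul, incUnit_of_le huv, incUnit_of_le hvw, incUnit_of_le (huv.trans hvw),
    Matrix.single_mul_single_same, one_mul]

lemma incUnit_mul_incUnit_of_ne {u v v' w : S} (h : v ≠ v') :
    incUnit k u v * incUnit k v' w = 0 := by
  by_cases huv : u ≤ v
  · by_cases hvw : v' ≤ w
    · apply Subtype.ext
      rw [Subalgebra.coe_mul, incUnit_of_le huv, incUnit_of_le hvw]
      exact Matrix.single_mul_single_of_ne _ _ _ _ h _
    · rw [incUnit_of_not_le hvw, mul_zero]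
  · rw [incUnit_of_not_le huv, zero_mul]

lemma sum_incUnit : ∑ v, incUnit k v v = (1 : IncAlg k S) := by
  apply Subtype.ext
  ext x y
  rw [AddSubmonoidClass.coe_finsetSum, Matrix.sum_apply]
  simp only [incUnit_apply le_rfl]
  by_cases hxy : x = y
  · subst hxy
    rw [Finset.sum_eq_single x] <;> simp +contextual
  · rw [OneMemClass.coe_one, Matrix.one_apply_ne hxy, Finset.sum_eq_zero]
    intro v _
    rw [if_neg]
    rintro ⟨rfl, rfl⟩
    exact hxy rfl

instance : FiniteDimensional k (IncAlg k S) :=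
  inferInstanceAs (FiniteDimensional k (Subalgebra.toSubmodule (IncAlg k S)))

/-- Functions on a poset with values in a vector space, as a right module over the incidence
algebra. -/
@[nolint unusedArguments]
def Row (k : Type u) [Field k] (S : Type) [Fintype S] [PartialOrder S] (W : Type u)
    [AddCommGroup W] [Module k W] : Type u := S → W

section Row

variable {W : Type u} [AddCommGroup W] [Module k W]

instance : AddCommGroup (Row k S W) := inferInstanceAs (AddCommGroup (S → W))

instance : Module k (Row k S W) := inferInstanceAs (Module k (S → W))

instance : SMul (IncAlg k S)ᵐᵒᵖ (Row k S W) where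
  smul r F := fun v => ∑ u, (unop r).1 u v • F u

lemma op_smul_row (h : IncAlg k S) (F : Row k S W) (v : S) :
    (op h • F : Row k S W) v = ∑ u, h.1 u v • F u := rfl

lemma row_add_apply (F G : Row k S W) (v : S) : (F + G) v = F v + G v := rfl

instance : Module (IncAlg k S)ᵐᵒᵖ (Row k S W) where
  one_smul F := by
    funext v
    change ∑ u, (1 : Matrix S S k) u v • F u = F v
    rw [Finset.sum_eq_single v]
    · rw [Matrix.one_apply_eq, one_smul]
    · intro u _ hu
      rw [Matrix.one_apply_ne hu, zero_smul]
    · simp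
  mul_smul r s F := by
    funext v
    change ∑ u, ((unop s).1 * (unop r).1) u v • F u =
      ∑ w, (unop r).1 w v • ∑ u, (unop s).1 u w • F u
    simp only [Matrix.mul_apply, Finset.sum_smul, Finset.smul_sum, smul_smul]
    rw [Finset.sum_comm]
    exact Finset.sum_congr rfl fun w _ => Finset.sum_congr rfl fun u _ => by rw [mul_comm]
  smul_zero r := by
    funext v
    exact Finset.sum_eq_zero fun u _ => smul_zero _
  smul_add r F G := by
    funext v
    change ∑ u, (unop r).1 u v • (F u + G u) =
      ∑ u, (unop r).1 u v • F u + ∑ u, (unop r).1 u v • G u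
    simp only [smul_add, Finset.sum_add_distrib]
  add_smul r s F := by
    funext v
    change ∑ u, ((unop r).1 u v + (unop s).1 u v) • F u =
      ∑ u, (unop r).1 u v • F u + ∑ u, (unop s).1 u v • F u
    simp only [add_smul, Finset.sum_add_distrib]
  zero_smul F := by
    funext v
    exact Finset.sum_eq_zero fun u _ => zero_smul _ _

lemma op_incUnit_smul_row {x y : S} (hxy : x ≤ y) (F : Row k S W) (v : S) :
    (op (incUnit k x y) • F : Row k S W) v = if v = y then F x else 0 := by
  rw [op_smul_row, Finset.sum_eq_single x]
  · rw [incUnit_apply hxy]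
    by_cases hv : v = y
    · rw [if_pos ⟨rfl, hv.symm⟩, if_pos hv, one_smul]
    · rw [if_neg fun h => hv h.2.symm, if_neg hv, zero_smul]
  · intro u _ hu
    rw [incUnit_apply hxy, if_neg fun h => hu h.1.symm, zero_smul]
  · simp

instance : IsScalarTower k (IncAlg k S)ᵐᵒᵖ (Row k S W) where
  smul_assoc c r F := by
    funext v
    change ∑ u, (c * (unop r).1 u v) • F u = c • ∑ u, (unop r).1 u v • F u
    simp only [Finset.smul_sum, smul_smul]

end Row

end Incidence

end Toupie

namespace Toupie

section Hereditary

variable {k : Type u} [Field k] {S : Type} [Fintype S] [PartialOrder S]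

lemma op_smul_op_incUnit_smul {N : Type*} [AddCommGroup N] [Module (IncAlg k S)ᵐᵒᵖ N] [Module k N]
    [IsScalarTower k (IncAlg k S)ᵐᵒᵖ N] (h : IncAlg k S) (p u : S) (x : N)
    (hx : ¬ p ≤ u → x = 0) :
    op h • op (incUnit k p u) • x = ∑ w, h.1 u w • op (incUnit k p w) • x := by
  by_cases hpu : p ≤ u
  · rw [smul_smul, ← op_mul, incUnit_mul hpu, Finset.op_sum, Finset.sum_smul]
    exact Finset.sum_congr rfl fun w _ => by rw [op_smul, smul_assoc]
  · simp [hx hpu]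

variable {M N : Type u} [AddCommGroup M] [Module (IncAlg k S)ᵐᵒᵖ M] [Module k M]
  [IsScalarTower k (IncAlg k S)ᵐᵒᵖ M] [AddCommGroup N] [Module (IncAlg k S)ᵐᵒᵖ N] [Module k N]
  [IsScalarTower k (IncAlg k S)ᵐᵒᵖ N]

lemma op_smul_row_apply {M : Type u} [AddCommGroup M] [Module k M]
    (h : IncAlg k S) (G : Row k S (S → M)) (w v : S) :
    (op h • G : Row k S (S → M)) w v = ∑ u, h.1 u w • G u v := by
  rw [op_smul_row, Finset.sum_apply]
  rfl

variable (k M) in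
/-- The direct sum over `v` of copies of the right modules supported on the upper sets `U v`,
with multiplicity space `M e_v`. -/
def famMod (U : S → Set S) (hU : ∀ v, IsUpperSet (U v)) :
    Submodule (IncAlg k S)ᵐᵒᵖ (Row k S (S → M)) where
  carrier := {G | ∀ w v, op (incUnit k v v) • G w v = G w v ∧ (w ∉ U v → G w v = 0)}
  add_mem' {F G} hF hG w v := by
    rw [row_add_apply, Pi.add_apply]
    exact ⟨by rw [smul_add, (hF w v).1, (hG w v).1], fun h => by
      rw [(hF w v).2 h, (hG w v).2 h, add_zero]⟩
  zero_mem' w v := ⟨smul_zero _, fun _ => rfl⟩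
  smul_mem' r G hG w v := by
    rw [← op_unop r, op_smul_row_apply]
    refine ⟨?_, fun hw => Finset.sum_eq_zero fun u _ => ?_⟩
    · rw [Finset.smul_sum]
      refine Finset.sum_congr rfl fun u _ => ?_
      rw [← algebraMap_smul (IncAlg k S)ᵐᵒᵖ, smul_smul, ← Algebra.commutes, ← smul_smul,
        (hG u v).1]
    · by_cases huw : u ≤ w
      · rw [(hG u v).2 fun hu => hw (hU v huw hu), smul_zero]
      · rw [r.unop.2 u w huw, zero_smul]

variable {U : S → Set S} {hU : ∀ v, IsUpperSet (U v)}

/-- The linear map out of `famMod` determined by linear maps on the generating spaces. -/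
def famLift (p : S → S) (hp : ∀ v, ∀ w ∈ U v, p v ≤ w) (c : S → M →ₗ[k] N) :
    famMod k M U hU →ₗ[(IncAlg k S)ᵐᵒᵖ] N where
  toFun G := ∑ v, ∑ w, op (incUnit k (p v) w) • c v (G.1 w v)
  map_add' F G := by
    simp only [Submodule.coe_add, row_add_apply, Pi.add_apply, map_add, smul_add,
      Finset.sum_add_distrib]
  map_smul' r G := by
    rw [← op_unop r, RingHom.id_apply, Finset.smul_sum]
    refine Finset.sum_congr rfl fun v _ => ?_
    rw [Finset.smul_sum]
    have h1 : ∀ u, op r.unop • op (incUnit k (p v) u) • c v (G.1 u v) =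
        ∑ w, r.unop.1 u w • op (incUnit k (p v) w) • c v (G.1 u v) := fun u =>
      op_smul_op_incUnit_smul _ _ _ _ fun hpu => by
        rw [(G.2 u v).2 fun hu => hpu (hp v u hu), map_zero]
    simp only [h1]
    rw [Finset.sum_comm]
    refine Finset.sum_congr rfl fun w _ => ?_
    rw [Submodule.coe_smul, op_smul_row_apply, map_sum, Finset.smul_sum]
    refine Finset.sum_congr rfl fun u _ => ?_
    rw [map_smul, ← algebraMap_smul (IncAlg k S)ᵐᵒᵖ, smul_smul, ← Algebra.commutes, ← smul_smul,
      algebraMap_smul]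

lemma famLift_apply (p : S → S) (hp : ∀ v, ∀ w ∈ U v, p v ≤ w) (c : S → M →ₗ[k] N)
    (G : famMod k M U hU) :
    famLift p hp c G = ∑ v, ∑ w, op (incUnit k (p v) w) • c v (G.1 w v) := rfl

variable (k U) in
/-- The element of `famMod` concentrated at one generating space. -/
def famSingle (p : S → S) (v : S) (x : M) : Row k S (S → M) :=
  fun w' v' => if v' = v ∧ w' = p v ∧ w' ∈ U v then op (incUnit k v v) • x else 0

omit [IsScalarTower k (IncAlg k S)ᵐᵒᵖ M] in
lemma famSingle_apply (p : S → S) (v : S) (x : M) (w' v' : S) : famSingle k U p v x w' v' =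
    if v' = v ∧ w' = p v ∧ w' ∈ U v then op (incUnit k v v) • x else 0 := rfl

lemma famSingle_mem (p : S → S) (v : S) (x : M) : famSingle k U p v x ∈ famMod k M U hU := by
  intro w' v'
  rw [famSingle_apply]
  constructor
  · split_ifs with h
    · rw [h.1, smul_smul, ← op_mul, incUnit_mul_incUnit le_rfl le_rfl]
    · exact smul_zero _
  · intro h
    rw [if_neg]
    rintro ⟨rfl, -, h'⟩
    exact h h'

variable (hU) in
/-- The inclusion of a generating space. -/
def famIncl (p : S → S) (v : S) : M →ₗ[k] famMod k M U hU where
  toFun x := ⟨famSingle k U p v x, famSingle_mem p v x⟩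
  map_add' x y := Subtype.ext (funext fun w' => funext fun v' => by
    change famSingle k U p v (x + y) w' v' =
      famSingle k U p v x w' v' + famSingle k U p v y w' v'
    simp only [famSingle_apply]
    split_ifs <;> simp)
  map_smul' c x := Subtype.ext (funext fun w' => funext fun v' => by
    change famSingle k U p v (c • x) w' v' = c • famSingle k U p v x w' v'
    simp only [famSingle_apply]
    split_ifs
    · rw [← algebraMap_smul (IncAlg k S)ᵐᵒᵖ, smul_smul, ← Algebra.commutes, ← smul_smul,
        algebraMap_smul]
    · rw [smul_zero])

lemma famLift_famIncl (p : S → S) (hp : ∀ v, ∀ w ∈ U v, p v ≤ w)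
    (hp' : ∀ v, (U v).Nonempty → p v ∈ U v) (G : famMod k M U hU) :
    famLift p hp (N := famMod k M U hU) (famIncl hU p) G = G := by
  apply Subtype.ext
  funext w' v'
  rw [famLift_apply, AddSubmonoidClass.coe_finsetSum]
  have h1 : ∀ v w, ((op (incUnit k (p v) w) • famIncl hU p v (G.1 w v) : famMod k M U hU).1 :
      Row k S (S → M)) w' v' = if v' = v ∧ w' = w then G.1 w v else 0 := by
    intro v w
    rw [Submodule.coe_smul]
    by_cases hw : w ∈ U v
    · rw [op_incUnit_smul_row (hp v w hw)]
      by_cases hw' : w' = w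
      · rw [if_pos hw']
        by_cases hv' : v' = v
        · rw [if_pos ⟨hv', hw'⟩]
          change famSingle k U p v (G.1 w v) (p v) v' = _
          rw [famSingle_apply, if_pos ⟨hv', rfl, hp' v ⟨w, hw⟩⟩, (G.2 w v).1]
        · rw [if_neg fun h => hv' h.1]
          change famSingle k U p v (G.1 w v) (p v) v' = _
          rw [famSingle_apply, if_neg fun h => hv' h.1]
      · rw [if_neg hw', if_neg fun h => hw' h.2]
        rfl
    · rw [(G.2 w v).2 hw, map_zero, ite_self, Submodule.coe_zero,
        smul_zero (A := Row k S (S → M))]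
      rfl
  have h2 : ∀ (s : Finset S) (f : S → Row k S (S → M)), (∑ v ∈ s, f v) w' v' = ∑ v ∈ s, f v w' v' :=
    fun s f => by
      rw [show (∑ v ∈ s, f v) w' = ∑ v ∈ s, f v w' from Finset.sum_apply (M := fun _ => S → M) _ _ _,
        Finset.sum_apply]
  rw [h2, Finset.sum_eq_single v']
  · rw [AddSubmonoidClass.coe_finsetSum, h2, Finset.sum_eq_single w', h1, if_pos ⟨rfl, rfl⟩]
    · intro w _ hw
      rw [h1, if_neg fun h => hw h.2.symm]
    · simp
  · intro v _ hv
    rw [AddSubmonoidClass.coe_finsetSum, h2]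
    exact Finset.sum_eq_zero fun w _ => by rw [h1, if_neg fun h => hv h.1.symm]
  · simp

lemma projective_famMod (p : S → S) (hp : ∀ v, ∀ w ∈ U v, p v ≤ w)
    (hp' : ∀ v, (U v).Nonempty → p v ∈ U v) :
    Module.Projective (IncAlg k S)ᵐᵒᵖ (famMod k M U hU) := by
  refine Module.Projective.of_lifting_property'' fun f hf => ?_
  have : Module.Free k (famMod k M U hU) := 
    @Module.Free.of_divisionRing k (famMod k M U hU) _ _ _
  obtain ⟨σ, hσ⟩ := (f.restrictScalars k).exists_rightInverse_of_surjective
    (LinearMap.range_eq_top.2 hf)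
  refine ⟨famLift (N := famMod k M U hU →₀ (IncAlg k S)ᵐᵒᵖ) p hp fun v => σ ∘ₗ famIncl hU p v,
    LinearMap.ext fun G => ?_⟩
  rw [LinearMap.comp_apply, famLift_apply]
  conv_rhs => rw [LinearMap.id_apply, ← famLift_famIncl p hp hp' G, famLift_apply]
  simp only [map_sum, map_smul]
  refine Finset.sum_congr rfl fun v _ => Finset.sum_congr rfl fun w _ => ?_
  congr 1
  exact LinearMap.congr_fun hσ _

end Hereditary

end Toupie

namespace Toupie

section Hereditary

variable {k : Type u} [Field k] {S : Type} [Fintype S] [PartialOrder S]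

section Resolution

variable {M : Type u} [AddCommGroup M] [Module (IncAlg k S)ᵐᵒᵖ M] [Module k M]
  [IsScalarTower k (IncAlg k S)ᵐᵒᵖ M]

omit [Module k M] [IsScalarTower k (IncAlg k S)ᵐᵒᵖ M] in
lemma op_incUnit_smul_smul {u v w : S} (huv : u ≤ v) (hvw : v ≤ w) (x : M) :
    op (incUnit k v w) • op (incUnit k u v) • x = op (incUnit k u w) • x := by
  rw [smul_smul, ← op_mul, incUnit_mul_incUnit huv hvw]

omit [Module k M] [IsScalarTower k (IncAlg k S)ᵐᵒᵖ M] in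
lemma op_incUnit_smul_smul_of_ne {u v v' w : S} (h : v ≠ v') (x : M) :
    op (incUnit k v' w) • op (incUnit k u v) • x = 0 := by
  rw [smul_smul, ← op_mul, incUnit_mul_incUnit_of_ne h, op_zero, zero_smul]

omit [Module k M] [IsScalarTower k (IncAlg k S)ᵐᵒᵖ M] in
lemma op_incUnit_self_smul_smul (u v : S) (x : M) :
    op (incUnit k v v) • op (incUnit k u v) • x = op (incUnit k u v) • x := by
  by_cases h : u ≤ v
  · exact op_incUnit_smul_smul h le_rfl x
  · rw [incUnit_of_not_le h, op_zero, zero_smul, smul_zero]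

omit [Module k M] [IsScalarTower k (IncAlg k S)ᵐᵒᵖ M] in
lemma sum_op_incUnit_smul (x : M) : ∑ v : S, op (incUnit k v v) • x = x := by
  rw [← Finset.sum_smul, ← Finset.op_sum, sum_incUnit, op_one, one_smul]

variable (k S M) in
/-- The projective cover part of the standard resolution. -/
abbrev famCov : Submodule (IncAlg k S)ᵐᵒᵖ (Row k S (S → M)) :=
  famMod k M (Set.Ici : S → Set S) fun v => isUpperSet_Ici v

variable (k S M) in
/-- The syzygy part of the standard resolution. -/
abbrev famSyz : Submodule (IncAlg k S)ᵐᵒᵖ (Row k S (S → M)) :=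
  famMod k M (Set.Ioi : S → Set S) fun v => isUpperSet_Ioi v

variable (k S M) in
/-- The augmentation of the standard resolution. -/
def augmentation : famCov k S M →ₗ[(IncAlg k S)ᵐᵒᵖ] M :=
  famLift id (fun _ _ h => h) fun _ => LinearMap.id

lemma augmentation_apply (G : famCov k S M) :
    augmentation k S M G = ∑ v, ∑ w, op (incUnit k v w) • G.1 w v := rfl

lemma op_smul_augmentation (x : S) (G : famCov k S M) :
    op (incUnit k x x) • augmentation k S M G = ∑ v, op (incUnit k v x) • G.1 x v := by
  rw [augmentation_apply, Finset.smul_sum]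
  refine Finset.sum_congr rfl fun v _ => ?_
  rw [Finset.smul_sum, Finset.sum_eq_single x, op_incUnit_self_smul_smul]
  · intro w _ hw
    exact op_incUnit_smul_smul_of_ne hw _
  · simp

lemma augmentation_surjective : Function.Surjective (augmentation k S M) := by
  intro m
  refine ⟨∑ v, famIncl (fun v => isUpperSet_Ici v) id v m, ?_⟩
  rw [map_sum]
  conv_rhs => rw [← sum_op_incUnit_smul (k := k) (S := S) m]
  refine Finset.sum_congr rfl fun v _ => ?_
  rw [augmentation_apply, Finset.sum_eq_single v, Finset.sum_eq_single v]
  · change _ • famSingle k Set.Ici id v m v v = _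
    rw [famSingle_apply, if_pos ⟨rfl, rfl, le_rfl⟩, op_incUnit_self_smul_smul]
  · intro w _ hw
    change _ • famSingle k Set.Ici id v m w v = _
    rw [famSingle_apply, if_neg fun h => hw h.2.1, smul_zero]
  · simp
  · intro v' _ hv'
    refine Finset.sum_eq_zero fun w _ => ?_
    change _ • famSingle k Set.Ici id v m w v' = _
    rw [famSingle_apply, if_neg fun h => hv' h.1, smul_zero]
  · simp

variable (hS : ∀ v a b : S, v ≤ a → v ≤ b → a ≤ b ∨ b ≤ a)

include hS in
lemma sum_op_smul_eq_zero {G : famCov k S M} (hG : augmentation k S M G = 0) {x v : S}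
    (hvx : ¬ v < x) : ∑ u, op (incUnit k u v) • G.1 x u = 0 := by
  by_cases hxv : x ≤ v
  · have h1 : ∀ u, op (incUnit k u v) • G.1 x u =
        op (incUnit k x v) • op (incUnit k u x) • G.1 x u := by
      intro u
      by_cases hux : u ≤ x
      · rw [op_incUnit_smul_smul hux hxv]
      · rw [(G.2 x u).2 hux, smul_zero, smul_zero, smul_zero]
    simp only [h1]
    rw [← Finset.smul_sum, ← op_smul_augmentation, hG, smul_zero, smul_zero]
  · refine Finset.sum_eq_zero fun u _ => ?_
    by_cases hux : u ≤ x
    · by_cases huv : u ≤ v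
      · rcases hS u x v hux huv with h | h
        · exact absurd h hxv
        · exact absurd (lt_of_le_of_ne h fun h' => hxv h'.symm.le) hvx
      · rw [incUnit_of_not_le huv, op_zero, zero_smul]
    · rw [(G.2 x u).2 hux, smul_zero]

/-- The isomorphism from the kernel of the augmentation to the syzygy, as a function. -/
def syzFun (G : Row k S (S → M)) : Row k S (S → M) :=
  fun w v => if v < w then ∑ u, op (incUnit k u v) • G w u else 0

omit [IsScalarTower k (IncAlg k S)ᵐᵒᵖ M] in
lemma syzFun_apply (G : Row k S (S → M)) (w v : S) :
    syzFun G w v = if v < w then ∑ u, op (incUnit k u v) • G w u else 0 := rfl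

include hS in
lemma syzFun_smul {G : famCov k S M} (hG : augmentation k S M G = 0) (h : IncAlg k S) (w v : S) :
    syzFun (op h • G.1) w v = (op h • syzFun G.1 : Row k S (S → M)) w v := by
  rw [op_smul_row_apply, syzFun_apply]
  have h1 : ∑ u, op (incUnit k u v) • (op h • G.1 : Row k S (S → M)) w u =
      ∑ x, h.1 x w • ∑ u, op (incUnit k u v) • G.1 x u := by
    simp only [op_smul_row_apply, Finset.smul_sum]
    rw [Finset.sum_comm]
    refine Finset.sum_congr rfl fun x _ => Finset.sum_congr rfl fun u _ => ?_
    rw [← algebraMap_smul (IncAlg k S)ᵐᵒᵖ, smul_smul, ← Algebra.commutes, ← smul_smul,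
      algebraMap_smul]
  rw [h1]
  split_ifs with hvw
  · refine Finset.sum_congr rfl fun x _ => ?_
    rw [syzFun_apply]
    split_ifs with hvx
    · rfl
    · rw [sum_op_smul_eq_zero hS hG hvx]
  · refine (Finset.sum_eq_zero fun x _ => ?_).symm
    rw [syzFun_apply]
    split_ifs with hvx
    · rw [h.2 x w fun hxw => hvw (hvx.trans_le hxw), zero_smul]
    · rw [smul_zero]

omit [Module k M] [IsScalarTower k (IncAlg k S)ᵐᵒᵖ M] in
lemma sum_incUnit_smul_eq (G : S → M) (v : S) (hv : op (incUnit k v v) • G v = G v) :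
    ∑ u, op (incUnit k u v) • G u =
      G v + ∑ u ∈ Finset.univ.filter (· < v), op (incUnit k u v) • G u := by
  rw [← Finset.add_sum_erase _ _ (Finset.mem_univ v), hv]
  congr 1
  refine (Finset.sum_subset (fun u hu => ?_) fun u hu hu' => ?_).symm
  · exact Finset.mem_erase.2 ⟨(Finset.mem_filter.1 hu).2.ne, Finset.mem_univ _⟩
  · rw [incUnit_of_not_le, op_zero, zero_smul]
    intro h
    exact hu' (Finset.mem_filter.2 ⟨Finset.mem_univ _,
      lt_of_le_of_ne h (Finset.ne_of_mem_erase hu)⟩)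

variable (k) in
omit [Module k M] [IsScalarTower k (IncAlg k S)ᵐᵒᵖ M] in
lemma exists_recursive (w : S) (R : S → M) : ∃ G : S → M, ∀ v, G v = if v ≤ w then
    R v - ∑ u ∈ Finset.univ.filter (· < v), op (incUnit k u v) • G u else 0 := by
  let F : ∀ v : S, (∀ u, u < v → M) → M := fun v g => if v ≤ w then
    R v - ∑ u ∈ (Finset.univ.filter (· < v)).attach,
      op (incUnit k u.1 v) • g u.1 (Finset.mem_filter.1 u.2).2 else 0
  refine ⟨(wellFounded_lt (α := S)).fix F, fun v => ?_⟩
  rw [WellFounded.fix_eq]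
  simp only [F]
  congr 2
  exact Finset.sum_attach _ fun u => op (incUnit k u v) • (wellFounded_lt (α := S)).fix F u

include hS in
lemma eq_zero_of_syzFun_eq_zero {G : famCov k S M} (hG : augmentation k S M G = 0)
    (hG' : syzFun G.1 = 0) : G = 0 := by
  apply Subtype.ext
  funext w v
  change G.1 w v = 0
  induction v using (wellFounded_lt (α := S)).induction with
  | _ v ih =>
    by_cases hvw : v ≤ w
    · have h1 : ∑ u, op (incUnit k u v) • G.1 w u = 0 := by
        rcases hvw.lt_or_eq with h | h
        · have h2 : syzFun G.1 w v = 0 := congrFun (congrFun hG' w) v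
          rwa [syzFun_apply, if_pos h] at h2
        · exact sum_op_smul_eq_zero hS hG (by rw [h]; exact lt_irrefl w)
      rw [sum_incUnit_smul_eq _ _ (G.2 w v).1, Finset.sum_eq_zero, add_zero] at h1
      · exact h1
      · intro u hu
        rw [ih u (Finset.mem_filter.1 hu).2, smul_zero]
    · exact (G.2 w v).2 hvw

include hS in
lemma exists_linearEquiv_famSyz :
    Nonempty (LinearMap.ker (augmentation k S M) ≃ₗ[(IncAlg k S)ᵐᵒᵖ] famSyz k S M) := by
  let δ : LinearMap.ker (augmentation k S M) →ₗ[(IncAlg k S)ᵐᵒᵖ] famSyz k S M :=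
    { toFun := fun G => ⟨syzFun G.1.1, fun w v => by
        rw [syzFun_apply]
        constructor
        · split_ifs
          · rw [Finset.smul_sum]
            exact Finset.sum_congr rfl fun u _ => op_incUnit_self_smul_smul _ _ _
          · exact smul_zero _
        · intro h
          exact if_neg h⟩
      map_add' := fun F G => Subtype.ext (funext fun w => funext fun v => by
        change syzFun (F.1.1 + G.1.1) w v = syzFun F.1.1 w v + syzFun G.1.1 w v
        simp only [syzFun_apply, row_add_apply, Pi.add_apply, smul_add, Finset.sum_add_distrib]
        split_ifs <;> simp)
      map_smul' := fun r G => Subtype.ext (funext fun w => funext fun v =>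
        syzFun_smul hS G.2 r.unop w v) }
  refine ⟨LinearEquiv.ofBijective δ ⟨?_, ?_⟩⟩
  · intro G₁ G₂ h12
    have hG : syzFun (G₁.1 - G₂.1 : famCov k S M).1 = 0 := by
      have h2 : syzFun G₁.1.1 = syzFun G₂.1.1 := congrArg Subtype.val h12
      funext w v
      have h3 : syzFun G₁.1.1 w v - syzFun G₂.1.1 w v = 0 := by rw [h2, sub_self]
      refine Eq.trans ?_ h3
      change (if v < w then ∑ u, op (incUnit k u v) • (G₁.1.1 w u - G₂.1.1 w u) else 0) = _
      simp only [syzFun_apply, smul_sub, Finset.sum_sub_distrib]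
      split_ifs <;> simp
    refine Subtype.ext (sub_eq_zero.1 (eq_zero_of_syzFun_eq_zero hS ?_ hG))
    have h1 := (augmentation k S M).map_add (G₁.1 - G₂.1 : famCov k S M) G₂.1
    have h2 : (G₁.1 - G₂.1 : famCov k S M) + G₂.1 = G₁.1 :=
      Subtype.ext (sub_add_cancel G₁.1.1 G₂.1.1)
    rw [h2, LinearMap.mem_ker.1 G₁.2, LinearMap.mem_ker.1 G₂.2, add_zero] at h1
    exact h1.symm
  · intro H
    choose G hG using fun w => exists_recursive k w (H.1 w)
    have hfix : ∀ w v, op (incUnit k v v) • G w v = G w v := by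
      intro w v
      rw [hG]
      split_ifs
      · rw [smul_sub, (H.2 w v).1, Finset.smul_sum]
        congr 1
        exact Finset.sum_congr rfl fun u _ => op_incUnit_self_smul_smul _ _ _
      · exact smul_zero _
    have hsum : ∀ w v, v ≤ w → ∑ u, op (incUnit k u v) • G w u = H.1 w v := by
      intro w v hvw
      rw [sum_incUnit_smul_eq _ _ (hfix w v), hG w v, if_pos hvw, sub_add_cancel]
    let G' : famCov k S M := ⟨G, fun w v => ⟨hfix w v, fun h => by
      rw [hG]
      exact if_neg h⟩⟩
    have hG' : augmentation k S M G' = 0 := by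
      rw [← sum_op_incUnit_smul (k := k) (S := S) (augmentation k S M G')]
      refine Finset.sum_eq_zero fun x _ => ?_
      rw [op_smul_augmentation]
      exact (hsum x x le_rfl).trans ((H.2 x x).2 (lt_irrefl x))
    refine ⟨⟨G', hG'⟩, ?_⟩
    apply Subtype.ext
    funext w v
    change (if v < w then ∑ u, op (incUnit k u v) • G w u else 0) = H.1 w v
    split_ifs with h
    · exact hsum w v h.le
    · exact ((H.2 w v).2 h).symm

end Resolution

/-- The incidence algebra of a finite rooted forest is hereditary. -/
theorem hereditary_incAlg (hS : ∀ v a b : S, v ≤ a → v ≤ b → a ≤ b ∨ b ≤ a) :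
    Hereditary (IncAlg k S)ᵐᵒᵖ := by
  intro M
  let _ : Module k M := Module.compHom M (algebraMap k (IncAlg k S)ᵐᵒᵖ)
  have : IsScalarTower k (IncAlg k S)ᵐᵒᵖ M := .of_algebraMap_smul fun _ _ => rfl
  obtain ⟨e⟩ := exists_linearEquiv_famSyz (k := k) (S := S) (M := M) hS
  have hp : ∀ v : S, ∃ p, (∀ w ∈ Set.Ioi v, p ≤ w) ∧ ((Set.Ioi v).Nonempty → p ∈ Set.Ioi v) := by
    intro v
    by_cases h : (Set.Ioi v).Nonempty
    · obtain ⟨p, hp⟩ := (Set.toFinite (Set.Ioi v)).exists_minimal h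
      refine ⟨p, fun w hw => ?_, fun _ => hp.1⟩
      rcases hS v p w (le_of_lt hp.1) (le_of_lt hw) with h' | h'
      · exact h'
      · exact hp.2 hw h'
    · exact ⟨v, fun w hw => absurd ⟨w, hw⟩ h, fun h' => absurd h' h⟩
  choose p hp hp' using hp
  have h1 : Module.Projective (IncAlg k S)ᵐᵒᵖ (famSyz k S M) := projective_famMod p hp hp'
  exact ⟨ModuleCat.of _ (famCov k S M), augmentation k S M, augmentation_surjective,
    projective_famMod id (fun _ _ h => h) fun v _ => le_refl v, Module.Projective.of_equiv e.symm⟩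

end Hereditary

end Toupie

namespace Toupie

section Simples

variable {k : Type u} [Field k] {S : Type} [Fintype S] [PartialOrder S]

lemma incAlg_mul_apply_self (a b : IncAlg k S) (v : S) :
    (a * b).1 v v = a.1 v v * b.1 v v := by
  rw [Subalgebra.coe_mul, Matrix.mul_apply, Finset.sum_eq_single v]
  · intro w _ hw
    by_cases hvw : v ≤ w
    · rw [b.2 w v fun h => hw (le_antisymm h hvw), mul_zero]
    · rw [a.2 v w hvw, zero_mul]
  · simp

variable (k) in
/-- The diagonal coefficient at `v`, as a character of the incidence algebra. -/
def diagHom (v : S) : (IncAlg k S)ᵐᵒᵖ →+* k where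
  toFun r := r.unop.1 v v
  map_one' := Matrix.one_apply_eq v
  map_mul' r s := by
    rw [unop_mul, incAlg_mul_apply_self, mul_comm]
  map_zero' := rfl
  map_add' _ _ := rfl

lemma diagHom_op_incUnit (v w : S) : diagHom k v (op (incUnit k w w)) = if w = v then 1 else 0 := by
  change (incUnit k w w).1 v v = _
  simp only [incUnit_apply le_rfl, and_self]

/-- The simple module at `v`. -/
@[nolint unusedArguments]
def SimpleAt (k : Type u) {S : Type} [Fintype S] [PartialOrder S] (_ : S) : Type u := k

instance (v : S) : AddCommGroup (SimpleAt k v) := inferInstanceAs (AddCommGroup k)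

instance (v : S) : Module (IncAlg k S)ᵐᵒᵖ (SimpleAt k v) := Module.compHom k (diagHom k v)

lemma smul_simpleAt (v : S) (r : (IncAlg k S)ᵐᵒᵖ) (c : k) :
    (r • (show SimpleAt k v from c) : SimpleAt k v) = diagHom k v r * c := rfl

lemma isSimpleModule_simpleAt (v : S) : IsSimpleModule (IncAlg k S)ᵐᵒᵖ (SimpleAt k v) := by
  refine isSimpleModule_iff_toSpanSingleton_surjective.2
    ⟨inferInstanceAs (Nontrivial k), fun x hx y => ?_⟩
  let x' : k := x
  let y' : k := y
  have hx' : x' ≠ 0 := hx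
  refine ⟨algebraMap k (IncAlg k S)ᵐᵒᵖ (y' / x'), ?_⟩
  change (algebraMap k (Matrix S S k) (y' / x')) v v * x' = y'
  rw [Matrix.algebraMap_matrix_apply, if_pos rfl]
  exact div_mul_cancel₀ y' hx'

lemma eq_of_linearEquiv_simpleAt {v w : S}
    (e : SimpleAt k v ≃ₗ[(IncAlg k S)ᵐᵒᵖ] SimpleAt k w) : v = w := by
  by_contra hvw
  let x : SimpleAt k v := (1 : k)
  have h1 : op (incUnit k v v) • x = x := by
    refine (smul_simpleAt v _ _).trans ?_
    rw [diagHom_op_incUnit, if_pos rfl, one_mul]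
  have h2 : e x = 0 := by
    rw [← h1, e.map_smul]
    refine (smul_simpleAt w _ _).trans ?_
    rw [diagHom_op_incUnit, if_neg hvw]
    exact zero_mul (show k from e x)
  exact one_ne_zero (α := k) (e.map_eq_zero_iff.1 h2)

lemma exists_linearEquiv_simpleAt (M : Type u) [AddCommGroup M] [Module (IncAlg k S)ᵐᵒᵖ M]
    [IsSimpleModule (IncAlg k S)ᵐᵒᵖ M] :
    ∃ v : S, Nonempty (M ≃ₗ[(IncAlg k S)ᵐᵒᵖ] SimpleAt k v) := by
  let _ : Module k M := Module.compHom M (algebraMap k (IncAlg k S)ᵐᵒᵖ)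
  have : IsScalarTower k (IncAlg k S)ᵐᵒᵖ M := .of_algebraMap_smul fun _ _ => rfl
  have hcomm : ∀ (r : (IncAlg k S)ᵐᵒᵖ) (c : k) (y : M), r • c • y = c • r • y := fun r c y => by
    rw [← algebraMap_smul (IncAlg k S)ᵐᵒᵖ c y, smul_smul, ← Algebra.commutes, ← smul_smul,
      algebraMap_smul]
  have hne : {v : S | ∃ m : M, op (incUnit k v v) • m ≠ 0}.Nonempty := by
    have : Nontrivial M := IsSimpleModule.nontrivial (IncAlg k S)ᵐᵒᵖ M
    obtain ⟨m, hm⟩ := exists_ne (0 : M)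
    by_contra h
    refine hm ?_
    rw [← sum_op_incUnit_smul (k := k) (S := S) m]
    refine Finset.sum_eq_zero fun v _ => ?_
    by_contra hv
    exact h ⟨v, m, hv⟩
  obtain ⟨v, ⟨m, hm⟩, hmax⟩ := (Set.toFinite _).exists_maximal hne
  have hact : ∀ r : (IncAlg k S)ᵐᵒᵖ, r • op (incUnit k v v) • m =
      diagHom k v r • op (incUnit k v v) • m := by
    intro r
    rw [← op_unop r, op_smul_op_incUnit_smul _ _ _ _ fun h => absurd le_rfl h,
      Finset.sum_eq_single v]
    · rfl
    · intro w _ hw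
      by_cases hvw : v ≤ w
      · have h1 : op (incUnit k v w) • m = 0 := by
          by_contra h2
          refine hw (le_antisymm (hmax ⟨op (incUnit k v w) • m, ?_⟩ hvw) hvw)
          rwa [op_incUnit_self_smul_smul]
        rw [h1, smul_zero]
      · rw [incUnit_of_not_le hvw, op_zero, zero_smul, smul_zero]
    · simp
  let g : SimpleAt k v →ₗ[(IncAlg k S)ᵐᵒᵖ] M :=
    { toFun := fun c => (show k from c) • op (incUnit k v v) • m
      map_add' := fun a b => add_smul (show k from a) (show k from b) _
      map_smul' := fun r c => by
        let c' : k := c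
        change (diagHom k v r * c') • op (incUnit k v v) • m = r • c' • op (incUnit k v v) • m
        rw [hcomm, hact, smul_smul, mul_comm] }
  refine ⟨v, ⟨(LinearEquiv.ofBijective g ⟨?_, fun y => ?_⟩).symm⟩⟩
  · intro a b hab
    exact smul_left_injective k hm hab
  · obtain ⟨r, hr⟩ := (isSimpleModule_iff_toSpanSingleton_surjective (R := (IncAlg k S)ᵐᵒᵖ) (M := M).1
      inferInstance).2 _ hm y
    exact ⟨diagHom k v r, (hact r).symm.trans hr⟩

variable (k S) in
/-- The simple modules over an incidence algebra correspond to the elements of the poset. -/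
theorem numClasses_isSimpleModule : NumClasses (IncAlg k S)ᵐᵒᵖ
    (fun M => IsSimpleModule (IncAlg k S)ᵐᵒᵖ M) (Fintype.card S) := by
  refine ⟨fun i => ModuleCat.of _ (SimpleAt k ((Fintype.equivFin S).symm i)),
    fun i => isSimpleModule_simpleAt _, fun i j ⟨e⟩ => ?_, fun M hM => ?_⟩
  · exact (Fintype.equivFin S).symm.injective (eq_of_linearEquiv_simpleAt e)
  · have : IsSimpleModule (IncAlg k S)ᵐᵒᵖ M := hM
    obtain ⟨v, ⟨e⟩⟩ := exists_linearEquiv_simpleAt (k := k) (S := S) M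
    obtain ⟨i, rfl⟩ := (Fintype.equivFin S).symm.surjective v
    exact ⟨i, ⟨e⟩⟩

end Simples

end Toupie

namespace Toupie

section FamilyModule

variable {k : Type u} [Field k] {S : Type} [Fintype S] [PartialOrder S]
  {W : Type u} [AddCommGroup W] [Module k W]

/-- The right module over the incidence algebra given by a monotone family of subspaces. -/
def subMod (Y : S → Submodule k W) (hY : Monotone Y) :
    Submodule (IncAlg k S)ᵐᵒᵖ (Row k S W) where
  carrier := {F | ∀ u, F u ∈ Y u}
  add_mem' hF hG u := (Y u).add_mem (hF u) (hG u)
  zero_mem' u := (Y u).zero_mem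
  smul_mem' r F hF v := by
    refine (Y v).sum_mem fun u _ => ?_
    by_cases huv : u ≤ v
    · exact (Y v).smul_mem _ (hY huv (hF u))
    · rw [r.unop.2 u v huv, zero_smul]
      exact (Y v).zero_mem

variable {Y : S → Submodule k W} {hY : Monotone Y}

/-- The element of `subMod` concentrated at `u`. -/
def subSingle (hY : Monotone Y) (u : S) : Y u →ₗ[k] subMod Y hY where
  toFun y := ⟨fun v => if v = u then y.1 else 0, fun v => by
    change (if v = u then y.1 else 0) ∈ Y v
    split_ifs with h
    · exact h ▸ y.2
    · exact (Y v).zero_mem⟩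
  map_add' y z := Subtype.ext (funext fun v => by
    change (if v = u then y.1 + z.1 else 0) = (if v = u then y.1 else 0) + if v = u then z.1 else 0
    split_ifs <;> simp)
  map_smul' c y := Subtype.ext (funext fun v => by
    change (if v = u then c • y.1 else 0) = c • (if v = u then y.1 else 0)
    split_ifs <;> simp)

lemma subSingle_apply (u : S) (y : Y u) (v : S) :
    (subSingle hY u y).1 v = if v = u then y.1 else 0 := rfl

lemma subSingle_apply_self (u : S) (y : Y u) : (subSingle hY u y).1 u = y.1 := if_pos rfl

lemma op_incUnit_smul_subMod {u v : S} (huv : u ≤ v) (F : subMod Y hY) :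
    op (incUnit k u v) • F = subSingle hY v ⟨F.1 u, hY huv (F.2 u)⟩ :=
  Subtype.ext (funext fun w => op_incUnit_smul_row huv F.1 w)

lemma op_incUnit_smul_subMod_apply {u v : S} (huv : u ≤ v) (F : subMod Y hY) :
    (op (incUnit k u v) • F).1 v = F.1 u := by
  rw [op_incUnit_smul_subMod huv, subSingle_apply_self]

/-- The homomorphism between modules given by monotone families of subspaces that is induced by
a linear map. -/
def subMap {W' : Type u} [AddCommGroup W'] [Module k W'] {Y' : S → Submodule k W'}
    (hY : Monotone Y) (hY' : Monotone Y') (g : W →ₗ[k] W') (hg : ∀ u, ∀ y ∈ Y u, g y ∈ Y' u) :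
    subMod Y hY →ₗ[(IncAlg k S)ᵐᵒᵖ] subMod Y' hY' where
  toFun F := ⟨fun u => g (F.1 u), fun u => hg u _ (F.2 u)⟩
  map_add' F G := Subtype.ext (funext fun u => g.map_add (F.1 u) (G.1 u))
  map_smul' r F := Subtype.ext (funext fun v => by
    change g (∑ u, r.unop.1 u v • F.1 u) = ∑ u, r.unop.1 u v • g (F.1 u)
    rw [map_sum]
    exact Finset.sum_congr rfl fun u _ => g.map_smul _ _)

lemma exists_linearMap_of_end {x : S} (hx : ∀ u, u ≤ x)
    (g : Module.End (IncAlg k S)ᵐᵒᵖ (subMod Y hY)) :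
    ∃ g' : W →ₗ[k] W, ∀ F u, (g F).1 u = g' (F.1 u) := by
  let g₀ : Y x →ₗ[k] W :=
    { toFun := fun y => (g (subSingle hY x y)).1 x
      map_add' := fun y z => by rw [map_add, map_add]; rfl
      map_smul' := fun c y => by
        rw [map_smul, LinearMap.map_smul_of_tower]; rfl }
  obtain ⟨g', hg'⟩ := g₀.exists_extend
  refine ⟨g', fun F u => ?_⟩
  rw [← op_incUnit_smul_subMod_apply (hx u), ← map_smul, op_incUnit_smul_subMod (hx u)]
  exact (LinearMap.congr_fun hg' ⟨F.1 u, hY (hx u) (F.2 u)⟩).symm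

lemma finite_subMod [FiniteDimensional k W] : Module.Finite (IncAlg k S)ᵐᵒᵖ (subMod Y hY) := by
  have h1 : Module.Finite k (Row k S W) := inferInstanceAs (Module.Finite k (S → W))
  have h2 : Module.Finite k (subMod Y hY) :=
    inferInstanceAs (Module.Finite k ((subMod Y hY).restrictScalars k))
  exact Module.Finite.of_restrictScalars_finite k _ _

section Extension

variable {E : Type u} [AddCommGroup E] [Module (IncAlg k S)ᵐᵒᵖ E] [Module k E]
  [IsScalarTower k (IncAlg k S)ᵐᵒᵖ E]

/-- The action of an element of the incidence algebra as a linear map. -/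
def actLin (E : Type u) [AddCommGroup E] [Module (IncAlg k S)ᵐᵒᵖ E] [Module k E]
    [IsScalarTower k (IncAlg k S)ᵐᵒᵖ E] (h : IncAlg k S) : E →ₗ[k] E where
  toFun d := op h • d
  map_add' := smul_add _
  map_smul' c d := by
    rw [RingHom.id_apply, ← algebraMap_smul (IncAlg k S)ᵐᵒᵖ c d, smul_smul, ← Algebra.commutes,
      ← smul_smul, algebraMap_smul]

variable (k E) in
/-- The subspaces `E e_{ux}` of `E`. -/
def actRange (x u : S) : Submodule k E := LinearMap.range (actLin E (incUnit k u x))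

lemma monotone_actRange {x : S} (hx : ∀ u, u ≤ x) : Monotone (actRange k E x) := by
  rintro u v huv _ ⟨d, rfl⟩
  exact ⟨op (incUnit k u v) • d, op_incUnit_smul_smul huv (hx v) d⟩

/-- The comparison map from a module to the module of a monotone family of subspaces. -/
def toSubMod {x : S} (hx : ∀ u, u ≤ x) :
    E →ₗ[(IncAlg k S)ᵐᵒᵖ] subMod (actRange k E x) (monotone_actRange hx) where
  toFun d := ⟨fun u => op (incUnit k u x) • d, fun u => ⟨d, rfl⟩⟩
  map_add' d d' := Subtype.ext (funext fun u => smul_add _ _ _)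
  map_smul' r d := Subtype.ext (funext fun v => by
    change op (incUnit k v x) • r • d = ∑ u, r.unop.1 u v • op (incUnit k u x) • d
    rw [← op_unop r, smul_smul, ← op_mul, mul_incUnit (hx v), Finset.op_sum, Finset.sum_smul]
    exact Finset.sum_congr rfl fun w _ => by rw [op_smul, smul_assoc]; rfl)

lemma toSubMod_bijective {x : S} (hx : ∀ u, u ≤ x)
    (hE : ∀ (u : S) (d : E), op (incUnit k u x) • d = 0 → op (incUnit k u u) • d = 0) :
    Function.Bijective (toSubMod (k := k) (E := E) hx) := by
  constructor
  · intro d d' h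
    have h1 : ∀ u, op (incUnit k u x) • d = op (incUnit k u x) • d' := fun u =>
      congrFun (congrArg Subtype.val h) u
    rw [← sub_eq_zero, ← sum_op_incUnit_smul (k := k) (S := S) (d - d')]
    exact Finset.sum_eq_zero fun u _ => hE u _ (by rw [smul_sub, h1, sub_self])
  · intro G
    choose d hd using G.2
    refine ⟨∑ u, op (incUnit k u u) • d u, Subtype.ext (funext fun v => ?_)⟩
    change op (incUnit k v x) • ∑ u, op (incUnit k u u) • d u = G.1 v
    rw [Finset.smul_sum, Finset.sum_eq_single v, op_incUnit_smul_smul le_rfl (hx v)]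
    · exact hd v
    · intro u _ hu
      exact op_incUnit_smul_smul_of_ne hu _
    · simp

end Extension

variable (Y) in
/-- The linear-algebra form of the vanishing of self-extensions of `subMod`. -/
def LiftsTo (x : S) : Prop :=
  ∀ (D : Type u) [AddCommGroup D] [Module k D] (Z : S → Submodule k D) (p : D →ₗ[k] W)
    (j : Y x →ₗ[k] D), Monotone Z → (∀ u, ∀ y ∈ Y u, ∃ d ∈ Z u, p d = y) →
    (∀ u, ∀ d ∈ Z u, p d = 0 → ∃ y : Y x, y.1 ∈ Y u ∧ j y = d) →
    (∀ u (y : Y x), y.1 ∈ Y u → j y ∈ Z u) → (∀ y, p (j y) = 0) →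
    ∃ s : W →ₗ[k] D, (∀ u, ∀ y ∈ Y u, s y ∈ Z u) ∧ ∀ y ∈ Y x, p (s y) = y

theorem selfExtVanish_subMod {x : S} (hx : ∀ u, u ≤ x) (h : LiftsTo Y x) :
    SelfExtVanish (IncAlg k S)ᵐᵒᵖ (subMod Y hY) := by
  intro E _ _ ι π hι hπ hιπ
  let _ : Module k E := Module.compHom E (algebraMap k (IncAlg k S)ᵐᵒᵖ)
  have : IsScalarTower k (IncAlg k S)ᵐᵒᵖ E := .of_algebraMap_smul fun _ _ => rfl
  have hπι : ∀ F, π (ι F) = 0 := fun F =>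
    LinearMap.mem_ker.1 (hιπ ▸ LinearMap.mem_range_self ι F)
  let p : E →ₗ[k] W :=
    { toFun := fun d => (π d).1 x
      map_add' := fun d d' => by rw [map_add]; rfl
      map_smul' := fun c d => by rw [LinearMap.map_smul_of_tower]; rfl }
  have hp : ∀ u (d : E), p (op (incUnit k u x) • d) = (π d).1 u := fun u d => by
    change (π (op (incUnit k u x) • d)).1 x = _
    rw [map_smul, op_incUnit_smul_subMod_apply (hx u)]
  have hker : ∀ u (d : E), (π d).1 u = 0 → ∃ F, ι F = op (incUnit k u u) • d := by
    intro u d hd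
    have h1 : op (incUnit k u u) • d ∈ LinearMap.ker π := by
      rw [LinearMap.mem_ker, map_smul, op_incUnit_smul_subMod le_rfl]
      exact Subtype.ext (funext fun v => by
        rw [subSingle_apply]
        simp only [hd, ite_self]
        rfl)
    rw [← hιπ] at h1
    exact h1
  let j : Y x →ₗ[k] E := (ι.restrictScalars k).comp (subSingle hY x)
  have hj : ∀ u (F : subMod Y hY),
      op (incUnit k u x) • ι F = j ⟨F.1 u, hY (hx u) (F.2 u)⟩ := fun u F => by
    rw [← map_smul, op_incUnit_smul_subMod (hx u)]
    rfl
  obtain ⟨s, hs, hs'⟩ := h E (actRange k E x) p j (monotone_actRange hx) (fun u y hy => by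
      obtain ⟨d, hd⟩ := hπ (subSingle hY u ⟨y, hy⟩)
      exact ⟨op (incUnit k u x) • d, ⟨d, rfl⟩, by rw [hp, hd, subSingle_apply_self]⟩)
    (by
      rintro u _ ⟨d, rfl⟩ hd
      obtain ⟨F, hF⟩ := hker u d ((hp u d).symm.trans hd)
      refine ⟨⟨F.1 u, hY (hx u) (F.2 u)⟩, F.2 u, ?_⟩
      rw [← hj, hF, op_incUnit_smul_smul le_rfl (hx u)]
      rfl)
    (fun u y hy => ⟨ι (subSingle hY u ⟨y.1, hy⟩), by
      refine (hj _ _).trans (congrArg j ?_)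
      exact Subtype.ext (subSingle_apply_self (hY := hY) u ⟨y.1, hy⟩)⟩)
    (fun y => by
      change (π (ι _)).1 x = 0
      rw [hπι]
      rfl)
  have hbij := toSubMod_bijective (k := k) (E := E) hx fun u d hd => by
    obtain ⟨F, hF⟩ := hker u d (by rw [← hp, hd, map_zero])
    have h1 : op (incUnit k u x) • ι F = 0 := by
      rw [hF, op_incUnit_smul_smul le_rfl (hx u), hd]
    rw [← map_smul] at h1
    have h2 : F.1 u = 0 := by
      rw [← op_incUnit_smul_subMod_apply (hx u), hι (h1.trans (map_zero ι).symm)]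
      rfl
    have h3 : op (incUnit k u u) • ι F = ι F := by
      rw [hF, op_incUnit_smul_smul le_rfl le_rfl]
    rw [← hF, ← h3, ← map_smul, op_incUnit_smul_subMod le_rfl]
    have h4 : subSingle hY u ⟨F.1 u, hY le_rfl (F.2 u)⟩ = 0 := by
      rw [show (⟨F.1 u, hY le_rfl (F.2 u)⟩ : Y u) = 0 from Subtype.ext h2, map_zero]
    rw [h4, map_zero]
  let e := LinearEquiv.ofBijective _ hbij
  refine ⟨e.symm.toLinearMap.comp (subMap hY (monotone_actRange hx) s hs), ?_⟩
  refine LinearMap.ext fun F => Subtype.ext (funext fun u => ?_)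
  change (π (e.symm (subMap hY (monotone_actRange hx) s hs F))).1 u = F.1 u
  rw [← hp]
  have h1 : op (incUnit k u x) • e.symm (subMap hY (monotone_actRange hx) s hs F) =
      s (F.1 u) := by
    change (e (e.symm (subMap hY (monotone_actRange hx) s hs F))).1 u = _
    rw [LinearEquiv.apply_symm_apply]
    rfl
  rw [h1]
  exact hs' _ (hY (hx u) (F.2 u))

end FamilyModule

end Toupie

namespace Toupie

section Summands

variable {R : Type u} [Ring R] {N : Type u} [AddCommGroup N] [Module R N]

lemma nonempty_linearEquiv_of_indec {M L : Type u} [AddCommGroup M] [Module R M] [AddCommGroup L]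
    [Module R L] (hM : Indec R (ModuleCat.of R M)) [Nontrivial L] (α : M →ₗ[R] L) (β : L →ₗ[R] M)
    (h : α.comp β = LinearMap.id) : Nonempty (M ≃ₗ[R] L) := by
  have hα : ∀ y, α (β y) = y := fun y => LinearMap.congr_fun h y
  have hidem : (β.comp α).comp (β.comp α) = β.comp α :=
    LinearMap.ext fun x => congrArg β (hα (α x))
  rcases hM.2 (β.comp α) hidem with h0 | h1
  · obtain ⟨y, hy⟩ := exists_ne (0 : L)
    refine absurd ?_ hy
    calc y = α (β (α (β y))) := by rw [hα, hα]
      _ = 0 := (congrArg α (LinearMap.congr_fun h0 (β y))).trans (map_zero α)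
  · exact ⟨LinearEquiv.ofLinearMap α β h h1⟩

variable {k : Type u} [Field k] {A : Type u} [Ring A] [Algebra k A]

/-- The indecomposable summands of a module whose endomorphism algebra is basic with respect to
a given complete family of orthogonal idempotents. -/
theorem numClasses_summands {V : Type} [Fintype V] (φ : A ≃+* Module.End R N) (e : V → A)
    (he : ∀ v, e v * e v = e v) (hne : ∀ v, e v ≠ 0)
    (hloc : ∀ v a, ∃ c : k, e v * a * e v = c • e v)
    (hacyc : ∀ v w a b, v ≠ w → e v * a * e w * b * e v = 0)
    (hidem : ∀ p : A, p * p = p → (∀ v, e v * p * e v = 0) → p = 0) :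
    NumClasses R (fun M => Indec R M ∧ IsSummandOf R N M) (Fintype.card V) := by
  have hmul : ∀ a b y, φ (a * b) y = φ a (φ b y) := fun a b y => by rw [map_mul]; rfl
  have hfix : ∀ v, ∀ y ∈ LinearMap.range (φ (e v)), φ (e v) y = y := by
    rintro v _ ⟨z, rfl⟩
    rw [← hmul, he]
  let Q : V → Submodule R N := fun v => LinearMap.range (φ (e v))
  let pr : ∀ v, N →ₗ[R] Q v := fun v => (φ (e v)).rangeRestrict
  have hpr : ∀ v (y : Q v), pr v y.1 = y := fun v y => Subtype.ext (hfix v y.1 y.2)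
  have hnt : ∀ v, Nontrivial (Q v) := by
    intro v
    rw [Submodule.nontrivial_iff_ne_bot]
    intro h
    exact hne v (φ.map_eq_zero_iff.1 (LinearMap.range_eq_bot.1 h))
  have hend : ∀ v w (f : Q v →ₗ[R] Q w), ∃ a, ∀ y : Q v, (f y).1 = φ (e w * a * e v) y.1 := by
    intro v w f
    refine ⟨φ.symm ((Q w).subtype.comp (f.comp (pr v))), fun y => ?_⟩
    rw [hmul, hmul, hfix v y.1 y.2, RingEquiv.apply_symm_apply]
    change (f y).1 = φ (e w) (f (pr v y.1)).1
    rw [hpr, hfix w _ (f y).2]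
  have hindec : ∀ v, Indec R (ModuleCat.of R (Q v)) := by
    refine fun v => ⟨hnt v, fun f hf => ?_⟩
    obtain ⟨a, ha⟩ := hend v v f
    obtain ⟨c, hc⟩ := hloc v a
    rw [hc] at ha
    have h1 : c * c = c := by
      refine smul_left_injective k (hne v) (φ.injective (LinearMap.ext fun z => ?_))
      have h2 : ∀ y : Q v, φ (c • e v) (φ (c • e v) y.1) = φ (c • e v) y.1 := fun y => by
        rw [← ha, ← ha]
        exact congrArg Subtype.val (LinearMap.congr_fun hf y)
      have h3 := h2 ⟨φ (e v) z, z, rfl⟩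
      simp only [← hmul, smul_mul_assoc, mul_smul_comm, he, smul_smul] at h3
      exact h3
    rcases IsIdempotentElem.iff_eq_zero_or_one.1 h1 with rfl | rfl
    · left
      refine LinearMap.ext fun y => Subtype.ext ?_
      rw [ha, zero_smul, map_zero]
      rfl
    · right
      refine LinearMap.ext fun y => Subtype.ext ?_
      rw [ha, one_smul, hfix v y.1 y.2]
      rfl
  refine ⟨fun i => ModuleCat.of R (Q ((Fintype.equivFin V).symm i)), fun i => ⟨hindec _, ?_⟩,
    fun i j ⟨f⟩ => ?_, fun M hM => ?_⟩
  · refine ⟨Q ((Fintype.equivFin V).symm i), LinearMap.ker (pr ((Fintype.equivFin V).symm i)),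
      ?_, ⟨LinearEquiv.refl R _⟩⟩
    exact LinearMap.isCompl_of_proj (hpr _)
  · refine (Fintype.equivFin V).symm.injective ?_
    by_contra hvw
    obtain ⟨a, ha⟩ := hend _ _ f.toLinearMap
    obtain ⟨b, hb⟩ := hend _ _ f.symm.toLinearMap
    have := hnt ((Fintype.equivFin V).symm i)
    obtain ⟨y, hy⟩ := exists_ne (0 : Q ((Fintype.equivFin V).symm i))
    refine hy (Subtype.ext ?_)
    have h1 := hb (f y)
    have h2 : f.symm.toLinearMap (f y) = y := f.symm_apply_apply y
    have h3 : (f y).1 = φ _ y.1 := ha y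
    rw [h2, h3, ← hmul] at h1
    rw [h1, mul_assoc, ← mul_assoc (e _) (_ * a), ← mul_assoc (e _), he, ← mul_assoc,
      ← mul_assoc, hacyc _ _ _ _ hvw, map_zero]
    rfl
  · obtain ⟨hM, N₁, N₂, hc, ⟨f⟩⟩ := hM
    have := hM.1
    obtain ⟨p, hp⟩ := φ.surjective (N₁.subtype.comp (N₁.projectionOnto N₂ hc))
    have hpa : ∀ y : N₁, φ p y.1 = y.1 := fun y => by
      rw [hp]
      exact congrArg Subtype.val (Submodule.projectionOnto_apply_left hc y)
    have hpm : ∀ z, φ p z = (N₁.projectionOnto N₂ hc z).1 := fun z => by rw [hp]; rfl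
    have hpp : p * p = p := φ.injective (LinearMap.ext fun z => by
      rw [hmul, hpm z, hpa])
    obtain ⟨v, hv⟩ : ∃ v, e v * p * e v ≠ 0 := by
      by_contra! h
      obtain ⟨m, hm⟩ := exists_ne (0 : M)
      refine hm (f.map_eq_zero_iff.1 (Subtype.ext ?_))
      rw [← hpa, hidem p hpp h, map_zero]
      rfl
    obtain ⟨c, hc'⟩ := hloc v p
    have hc0 : c ≠ 0 := by
      rintro rfl
      exact hv (by rw [hc', zero_smul])
    obtain ⟨i, rfl⟩ := (Fintype.equivFin V).symm.surjective v
    refine ⟨i, nonempty_linearEquiv_of_indec hM ((pr _).comp (N₁.subtype.comp f.toLinearMap))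
      (f.symm.toLinearMap.comp ((N₁.projectionOnto N₂ hc).comp
        ((φ (c⁻¹ • e ((Fintype.equivFin V).symm i))).comp (Q _).subtype)))
      (LinearMap.ext fun y => Subtype.ext ?_)⟩
    change φ (e _) (f (f.symm (N₁.projectionOnto N₂ hc (φ (c⁻¹ • e _) y.1)))).1 = y.1
    rw [LinearEquiv.apply_symm_apply, ← hpm, ← hmul, ← hmul, mul_smul_comm,
      hc', smul_smul, inv_mul_cancel₀ hc0, one_smul, hfix _ y.1 y.2]

end Summands

end Toupie

namespace Toupie

section Columns

variable {k : Type u} [Field k] {T : ToupieAlg k} {lam : Fin T.t → k}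

variable (T) in
/-- The class in `A` of the path from the `a`-th vertex of branch `i` to the sink. -/
def toSink (i : Fin T.t) (a : ℕ) : Alg T := mkHom T (subE i a (T.ℓ i))

variable (T) in
/-- The span of the classes of the paths along branch `i` to the sink that start at one of the
first `a + 1` vertices. -/
def colSpan (i : Fin T.t) (a : ℕ) : Submodule k (Alg T) :=
  Submodule.span k (toSink T i '' Set.Iic a)

lemma toSink_mem_colSpan (i : Fin T.t) {a b : ℕ} (h : a ≤ b) : toSink T i a ∈ colSpan T i b :=
  Submodule.subset_span ⟨a, h, rfl⟩

lemma mkHom_eV_snk : mkHom T (eV .snk) = einf T := rfl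

lemma mkHom_eq_sum (x : PathAlg k T.t T.ℓ) :
    mkHom T x = ∑ p, coeffs x p • mkHom T (pathE k p) := by
  conv_lhs => rw [eq_sum_coeffs T.hℓ x]
  rw [map_sum]
  exact Finset.sum_congr rfl fun p _ => map_smul _ _ _

lemma mul_toSink_mem (x : Alg T) (i : Fin T.t) {a : ℕ} (ha : a < T.ℓ i) :
    x * toSink T i a ∈ colSpan T i a := by
  obtain ⟨x, rfl⟩ := mkHom_surjective T x
  rw [mkHom_eq_sum, Finset.sum_mul]
  refine Submodule.sum_mem _ fun p _ => ?_
  rw [smul_mul_assoc]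
  refine Submodule.smul_mem _ _ ?_
  rw [toSink, ← map_mul, ← eV_mul_subE T.hℓ i ha le_rfl, ← mul_assoc]
  cases p with
  | vert v =>
    rw [pathE_vert, eV_mul_eV]
    split_ifs with h
    · rw [h, eV_mul_subE T.hℓ i ha le_rfl]
      exact toSink_mem_colSpan i le_rfl
    · rw [zero_mul, map_zero]
      exact Submodule.zero_mem _
  | sub j b c hbc hc =>
    rw [pathE_sub, ← subE_mul_eV T.hℓ j hbc hc, mul_assoc (subE j b c), eV_mul_eV]
    split_ifs with h
    · have ha0 : 0 < a := by
        rw [Nat.pos_iff_ne_zero]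
        rintro rfl
        rw [vtx_zero, vtx_eq_src_iff] at h
        omega
      rw [vtx_mid i a ha0 ha, vtx_eq_mid_iff] at h
      obtain ⟨rfl, h⟩ := h
      simp only at h
      obtain rfl : c = a := by omega
      rw [subE_mul_eV T.hℓ j hbc hc, subE_mul_subE T.hℓ j hbc ha le_rfl]
      exact toSink_mem_colSpan j hbc.le
    · rw [mul_zero, zero_mul, map_zero]
      exact Submodule.zero_mem _

lemma mul_einf_mem (x : Alg T) : x * einf T ∈
    Submodule.span k {y | y = einf T ∨ ∃ i, ∃ a < T.ℓ i, y = toSink T i a} := by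
  obtain ⟨x, rfl⟩ := mkHom_surjective T x
  rw [mkHom_eq_sum, Finset.sum_mul]
  refine Submodule.sum_mem _ fun p _ => ?_
  rw [smul_mul_assoc]
  refine Submodule.smul_mem _ _ ?_
  rw [← mkHom_eV_snk, ← map_mul]
  cases p with
  | vert v =>
    rw [pathE_vert, eV_mul_eV]
    split_ifs with h
    · rw [h]
      exact Submodule.subset_span (Or.inl rfl)
    · rw [map_zero]
      exact Submodule.zero_mem _
  | sub j b c hbc hc =>
    rw [pathE_sub, ← subE_mul_eV T.hℓ j hbc hc, mul_assoc (subE j b c), eV_mul_eV]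
    split_ifs with h
    · rw [vtx_eq_snk_iff _ _ (T.hℓ j) hc] at h
      subst h
      rw [subE_mul_eV T.hℓ j hbc le_rfl]
      exact Submodule.subset_span (Or.inr ⟨j, b, hbc, rfl⟩)
    · rw [mul_zero, map_zero]
      exact Submodule.zero_mem _

lemma toSink_mul_einf (i : Fin T.t) {a : ℕ} (ha : a < T.ℓ i) :
    toSink T i a * einf T = toSink T i a := by
  rw [← mkHom_eV_snk, toSink, ← map_mul]
  conv_lhs => rw [← vtx_last (ℓ := T.ℓ) i (T.hℓ i), subE_mul_eV T.hℓ i ha le_rfl]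

lemma einf_mul_einf : einf T * einf T = einf T := by
  rw [← mkHom_eV_snk, ← map_mul, eV_mul_self]

lemma vtx_ne_snk (i : Fin T.t) {a : ℕ} (ha : a < T.ℓ i) : vtx T.t T.ℓ i a ≠ .snk := by
  rw [Ne, vtx_eq_snk_iff i a (T.hℓ i) ha.le]
  exact ha.ne

/-- The linear map on the path algebra with prescribed values at the paths to the sink. -/
def pathLin {E : Type*} [AddCommGroup E] [Module k E] (i₀ : Fin T.t) (z : E)
    (f : Fin T.t → ℕ → E) : PathAlg k T.t T.ℓ →ₗ[k] E where
  toFun x := theta T.hℓ i₀ x .snk .snk • z + ∑ i, ∑ a ∈ Finset.range (T.ℓ i),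
    theta T.hℓ i x (vtx T.t T.ℓ i a) .snk • f i a
  map_add' x y := by
    simp only [map_add, Matrix.add_apply, add_smul, Finset.sum_add_distrib]
    abel
  map_smul' c x := by
    simp only [map_smul, Matrix.smul_apply, smul_assoc, smul_add, Finset.smul_sum, RingHom.id_apply]

namespace OneRel

variable (h : OneRel T lam)
include h

/-- A linear map out of `A e_∞` is determined by arbitrary values at the trivial path and at the
nontrivial paths to the sink, subject to the defining relation. -/
lemma exists_linearMap {E : Type*} [AddCommGroup E] [Module k E] (i₀ : Fin T.t) (z : E)
    (f : Fin T.t → ℕ → E) (hf : ∑ i, lam i • f i 0 = 0) :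
    ∃ g : Alg T →ₗ[k] E, g (einf T) = z ∧ ∀ i, ∀ a < T.ℓ i, g (toSink T i a) = f i a := by
  have hI : ∀ x ∈ T.I, pathLin i₀ z f x = 0 := by
    intro x hx
    obtain ⟨c, hc⟩ := (h.mem_iff x).1 hx
    change _ • z + ∑ i, ∑ a ∈ Finset.range (T.ℓ i), _ = 0
    have h1 : ∀ i, ∑ a ∈ Finset.range (T.ℓ i), theta T.hℓ i x (vtx T.t T.ℓ i a) .snk • f i a =
        c • lam i • f i 0 := by
      intro i
      rw [Finset.sum_eq_single 0]
      · rw [hc, vtx_zero, Matrix.single_apply_same, smul_smul]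
      · intro a _ ha
        rw [hc, Matrix.single_apply_of_ne, zero_smul]
        exact fun h' => ha ((vtx_eq_src_iff i a).1 h'.1.symm)
      · intro h0
        rw [Finset.mem_range] at h0
        exact absurd (T.hℓ i) (by omega)
    rw [Finset.sum_congr rfl fun i _ => h1 i, ← Finset.smul_sum, hf, smul_zero, add_zero, hc,
      Matrix.single_apply_of_ne _ _ _ _ _ (by simp), zero_smul]
  obtain ⟨s, hs⟩ := (mkHom T).toLinearMap.exists_rightInverse_of_surjective
    (LinearMap.range_eq_top.2 (mkHom_surjective T))
  have hg : ∀ x, pathLin i₀ z f (s (mkHom T x)) = pathLin i₀ z f x := by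
    intro x
    rw [← sub_eq_zero, ← map_sub]
    apply hI
    rw [← mkHom_eq_zero_iff, map_sub, sub_eq_zero]
    exact LinearMap.congr_fun hs (mkHom T x)
  refine ⟨(pathLin i₀ z f).comp s, ?_, fun i a ha => ?_⟩
  · refine (hg (eV .snk)).trans ?_
    change _ • z + ∑ i, ∑ a ∈ Finset.range (T.ℓ i), _ = z
    rw [theta_eV, Matrix.single_apply_same, one_smul, add_eq_left]
    refine Finset.sum_eq_zero fun i _ => Finset.sum_eq_zero fun a ha => ?_
    rw [theta_eV, Matrix.single_apply_of_ne, zero_smul]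
    exact fun h' => vtx_ne_snk i (Finset.mem_range.1 ha) h'.1.symm
  · refine (hg (subE i a (T.ℓ i))).trans ?_
    change _ • z + ∑ j, ∑ b ∈ Finset.range (T.ℓ j), _ = f i a
    have h1 : ∀ j, theta T.hℓ j (subE i a (T.ℓ i)) =
        if i = j then Matrix.single (vtx T.t T.ℓ i a) .snk (1 : k) else 0 := by
      intro j
      rw [theta_subE T.hℓ j i ha le_rfl]
      split_ifs with hij
      · rw [← hij, vtx_last i (T.hℓ i)]
      · rfl
    have h2 : theta (k := k) T.hℓ i₀ (subE i a (T.ℓ i)) .snk .snk = 0 := by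
      rw [h1]
      split_ifs
      · rw [Matrix.single_apply_of_ne]
        exact fun h' => vtx_ne_snk i ha h'.1
      · rfl
    rw [h2, zero_smul, zero_add]
    simp only [h1]
    rw [Finset.sum_eq_single i, Finset.sum_eq_single a]
    · rw [if_pos rfl, Matrix.single_apply_same, one_smul]
    · intro b hb hba
      rw [if_pos rfl, Matrix.single_apply_of_ne, zero_smul]
      exact fun h' => hba (vtx_inj_left i ha.le (Finset.mem_range.1 hb).le h'.1).symm
    · intro h'
      exact absurd (Finset.mem_range.2 ha) h'
    · intro j _ hj
      refine Finset.sum_eq_zero fun b _ => ?_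
      rw [if_neg hj.symm]
      exact zero_smul _ _
    · simp

lemma sum_smul_toSink : ∑ i, lam i • toSink T i 0 = 0 := by
  rw [← h.mkHom_branchSum, branchSum_apply, map_sum]
  exact Finset.sum_congr rfl fun i _ => (map_smul (mkHom T) _ _).symm

end OneRel

end Columns

end Toupie

namespace Toupie

section DoubleCentralizer

variable {k : Type u} [Field k] {T : ToupieAlg k} {lam : Fin T.t → k}

lemma mkHom_eV_mul_toSink (i : Fin T.t) {a : ℕ} (ha : a < T.ℓ i) :
    mkHom T (eV (vtx T.t T.ℓ i a)) * toSink T i a = toSink T i a := by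
  rw [toSink, ← map_mul, eV_mul_subE T.hℓ i ha le_rfl]

lemma sum_mkHom_eV : ∑ v, mkHom T (eV v) = 1 := by rw [← map_sum, sum_eV, map_one]

lemma mkHom_eV_mul (v w : Vtx T.t T.ℓ) :
    mkHom T (eV v) * mkHom T (eV w) = if v = w then mkHom T (eV v) else 0 := by
  rw [← map_mul, eV_mul_eV]
  split_ifs
  · rfl
  · exact map_zero _

lemma exists_mul_toSink_eq (i : Fin T.t) {a : ℕ} (ha : a < T.ℓ i) (y : Alg T)
    (hy : y ∈ colSpan T i a) :
    ∃ z, z * mkHom T (eV (vtx T.t T.ℓ i a)) = z ∧ z * toSink T i a = y := by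
  induction hy using Submodule.span_induction with
  | mem y hy =>
    obtain ⟨b, hb, rfl⟩ := hy
    rcases (show b ≤ a from hb).eq_or_lt with rfl | hb
    · exact ⟨mkHom T (eV _), by rw [mkHom_eV_mul, if_pos rfl], mkHom_eV_mul_toSink i ha⟩
    · refine ⟨mkHom T (subE i b a), ?_, ?_⟩
      · rw [← map_mul, subE_mul_eV T.hℓ i hb ha.le]
      · rw [toSink, ← map_mul, subE_mul_subE T.hℓ i hb ha le_rfl]
        rfl
  | zero => exact ⟨0, zero_mul _, zero_mul _⟩
  | add x y _ _ hx hy =>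
    obtain ⟨z, hz, rfl⟩ := hx
    obtain ⟨w, hw, rfl⟩ := hy
    exact ⟨z + w, by rw [add_mul, hz, hw], add_mul _ _ _⟩
  | smul c x _ hx =>
    obtain ⟨z, hz, rfl⟩ := hx
    exact ⟨c • z, by rw [smul_mul_assoc, hz], smul_mul_assoc _ _ _⟩

lemma exists_of_mem_colSpan_one (i : Fin T.t) (y : Alg T) (hy : y ∈ colSpan T i 1) :
    ∃ c d : k, y = c • toSink T i 0 + d • toSink T i 1 := by
  have h : (Set.Iic 1 : Set ℕ) = {0, 1} := by
    ext n
    simp only [Set.mem_Iic, Set.mem_insert_iff, Set.mem_singleton_iff]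
    omega
  rw [colSpan, h, Set.image_pair, Submodule.mem_span_pair] at hy
  obtain ⟨c, d, h⟩ := hy
  exact ⟨c, d, h.symm⟩

namespace OneRel

variable (h : OneRel T lam)
include h

lemma theta_eq_zero_of_mul_subE (x : PathAlg k T.t T.ℓ) (i : Fin T.t) {b : ℕ} (hb : b < T.ℓ i)
    (hx : mkHom T x * toSink T i b = 0) (u : Vtx T.t T.ℓ) :
    theta T.hℓ i x u (vtx T.t T.ℓ i b) = 0 := by
  rw [toSink, ← map_mul, mkHom_eq_zero_iff, h.mem_iff] at hx
  obtain ⟨c, hc⟩ := hx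
  have : Nontrivial (Fin T.t) := Fin.nontrivial_iff_two_le.2 T.ht
  obtain ⟨j, hj⟩ := exists_ne i
  have h1 := hc j
  rw [map_mul, theta_subE_of_ne T.hℓ hj.symm hb le_rfl, mul_zero] at h1
  have h2 : c * lam j = 0 := by
    have h3 := congrFun (congrFun h1 .src) .snk
    rw [Matrix.single_apply_same] at h3
    exact h3.symm
  have h4 := hc i
  rw [(mul_eq_zero.1 h2).resolve_right (h.ne_zero j), zero_mul, map_mul,
    theta_subE_self T.hℓ i hb le_rfl, Matrix.single_zero] at h4
  have h5 := congrFun (congrFun h4 u) (vtx T.t T.ℓ i (T.ℓ i))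
  rw [Matrix.mul_single_apply_same, mul_one] at h5
  exact h5

/-- `A` acts faithfully on `A e_∞`. -/
lemma eq_zero_of_mul_einf (a : Alg T) (ha : ∀ i, ∀ b < T.ℓ i, a * toSink T i b = 0)
    (ha' : a * einf T = 0) : a = 0 := by
  obtain ⟨x, rfl⟩ := mkHom_surjective T a
  have hz : ∀ i, ∀ b < T.ℓ i, ∀ u, theta T.hℓ i x u (vtx T.t T.ℓ i b) = 0 := fun i b hb =>
    h.theta_eq_zero_of_mul_subE x i hb (ha i b hb)
  rw [← mul_one (mkHom T x), ← sum_mkHom_eV, Finset.mul_sum]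
  refine Finset.sum_eq_zero fun v _ => ?_
  cases v with
  | src =>
    rw [← map_mul]
    have h1 : x * eV .src = 0 := by
      have := T.ht
      refine theta_ext T.hℓ ⟨0, by omega⟩ fun j => ?_
      rw [map_mul, theta_eV, map_zero]
      ext u v
      by_cases hv : v = .src
      · subst hv
        rw [Matrix.mul_single_apply_same, mul_one, ← vtx_zero (ℓ := T.ℓ) j]
        exact hz j 0 (T.hℓ j) u
      · rw [Matrix.mul_single_apply_of_ne _ _ _ _ _ hv]
        rfl
    rw [h1, map_zero]
  | snk => exact ha'
  | mid i b =>
    have hb := b.2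
    have h1 := mul_eV_mid T.hℓ x i (Nat.succ_pos b.1) (by omega) 0 fun u => by
      rw [hz i (b.1 + 1) (by omega), ite_self]
    rw [vtx_mid i (b.1 + 1) (Nat.succ_pos _) (by omega), zero_smul] at h1
    rw [← map_mul]
    exact (congrArg (mkHom T) h1).trans (map_zero _)

/-- A linear endomorphism preserving the relevant subspaces acts on the initial paths by a
scalar. -/
lemma exists_scalar (g : Alg T →ₗ[k] Alg T) (hg : ∀ i, g (toSink T i 0) ∈ colSpan T i 1) :
    ∃ c : k, ∀ i, g (toSink T i 0) = c • toSink T i 0 := by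
  choose c d hcd using fun i => exists_of_mem_colSpan_one i _ (hg i)
  have hsum : ∑ i, lam i • (c i • toSink T i 0 + d i • toSink T i 1) = 0 := by
    rw [← map_zero g, ← h.sum_smul_toSink, map_sum]
    exact Finset.sum_congr rfl fun i _ => by rw [map_smul, hcd]
  have hd : ∀ i, d i = 0 := by
    intro i
    obtain ⟨φ, -, hφ⟩ := h.exists_linearMap (E := k) i 0
      (fun j a => if j = i ∧ a = 1 then 1 else 0) (by simp)
    have h1 := congrArg φ hsum
    rw [map_sum, map_zero, Finset.sum_eq_single i] at h1
    · rw [map_smul, map_add, map_smul, map_smul, hφ i 0 (T.hℓ i), hφ i 1 (h.two_le i)] at h1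
      simpa [h.ne_zero i] using h1
    · intro j _ hj
      rw [map_smul, map_add, map_smul, map_smul, hφ j 0 (T.hℓ j), hφ j 1 (h.two_le j)]
      simp [hj]
    · simp
  have h1 : mkHom T (branchSum fun i => lam i * c i) = 0 := by
    rw [branchSum_apply, map_sum, ← hsum]
    refine Finset.sum_congr rfl fun i _ => ?_
    rw [hd, zero_smul, add_zero, smul_smul]
    exact map_smul (mkHom T) _ _
  rw [mkHom_eq_zero_iff, h.mem_iff] at h1
  obtain ⟨e, he⟩ := h1
  refine ⟨e, fun i => ?_⟩
  have h2 := congrFun (congrFun (he i) .src) .snk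
  rw [theta_branchSum, Matrix.single_apply_same, Matrix.single_apply_same, mul_comm e] at h2
  rw [hcd, hd, zero_smul, add_zero, mul_left_cancel₀ (h.ne_zero i) h2]

/-- A linear endomorphism of `A e_∞` preserving the relevant subspaces is a left
multiplication. -/
lemma exists_mul_eq (g : Alg T →ₗ[k] Alg T) (hg0 : ∀ i, g (toSink T i 0) ∈ colSpan T i 1)
    (hg : ∀ i a, 0 < a → a < T.ℓ i → g (toSink T i a) ∈ colSpan T i a)
    (hg' : g (einf T) * einf T = g (einf T)) :
    ∃ a, a * einf T = g (einf T) ∧ ∀ i, ∀ b < T.ℓ i, a * toSink T i b = g (toSink T i b) := by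
  obtain ⟨c, hc⟩ := h.exists_scalar g hg0
  have hz : ∀ v, ∃ z, z * mkHom T (eV v) = z ∧ (v = .snk → z * einf T = g (einf T)) ∧
      ∀ i, ∀ b < T.ℓ i, v = vtx T.t T.ℓ i b → z * toSink T i b = g (toSink T i b) := by
    intro v
    cases v with
    | src =>
      refine ⟨c • mkHom T (eV .src), ?_, by simp, fun i b hb hv => ?_⟩
      · rw [smul_mul_assoc, mkHom_eV_mul, if_pos rfl]
      · obtain rfl := (vtx_eq_src_iff i b).1 hv.symm
        rw [hc, smul_mul_assoc, hv, mkHom_eV_mul_toSink i hb]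
    | snk =>
      exact ⟨g (einf T), hg', fun _ => hg', fun i b hb hv => absurd hv.symm (vtx_ne_snk i hb)⟩
    | mid i b =>
      have hb := b.2
      obtain ⟨z, hz, hz'⟩ := exists_mul_toSink_eq i (a := b.1 + 1) (by omega) _
        (hg i (b.1 + 1) (Nat.succ_pos _) (by omega))
      rw [vtx_mid i (b.1 + 1) (Nat.succ_pos _) (by omega)] at hz
      refine ⟨z, hz, by simp, fun j a ha hv => ?_⟩
      obtain ⟨rfl, rfl⟩ := (vtx_eq_mid_iff j i a b).1 hv.symm
      exact hz'
  choose z hz hz1 hz2 using hz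
  have hmul : ∀ w y, mkHom T (eV w) * y = y → (∑ v, z v) * y = z w * y := by
    intro w y hy
    rw [← hy, ← mul_assoc, ← mul_assoc, Finset.sum_mul, Finset.sum_eq_single w]
    · intro v _ hv
      rw [← hz v, mul_assoc, mkHom_eV_mul, if_neg hv, mul_zero]
    · simp
  refine ⟨∑ v, z v, ?_, fun i b hb => ?_⟩
  · rw [hmul .snk _ einf_mul_einf, hz1 _ rfl]
  · rw [hmul _ _ (mkHom_eV_mul_toSink i hb), hz2 _ i b hb rfl]

end OneRel

end DoubleCentralizer

end Toupie

namespace Toupie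

/-- The poset whose incidence algebra is the hereditary algebra of the tilting module: a chain
of length `l`, with one further minimal element for each branch. -/
inductive Node {t : ℕ} (i₀ : Fin t) (l : ℕ) : Type
  | leaf (i : Fin t) : Node i₀ l
  | chain (j : Fin l) : Node i₀ l

namespace Node

variable {t : ℕ} {i₀ : Fin t} {l : ℕ}

/-- The nodes as a disjoint union. -/
def equivSum (i₀ : Fin t) (l : ℕ) : Node i₀ l ≃ Fin t ⊕ Fin l where
  toFun
    | leaf i => .inl i
    | chain j => .inr j
  invFun := Sum.elim leaf chain
  left_inv u := by cases u <;> rfl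
  right_inv u := by cases u <;> rfl

instance : Fintype (Node i₀ l) := Fintype.ofEquiv _ (equivSum i₀ l).symm

lemma card : Fintype.card (Node i₀ l) = t + l := by
  rw [Fintype.card_congr (equivSum i₀ l), Fintype.card_sum, Fintype.card_fin, Fintype.card_fin]

/-- The order relation: the leaf `i₀` lies below the last two elements of the chain, every other
leaf lies below the whole chain. -/
def Le : Node i₀ l → Node i₀ l → Prop
  | leaf i, leaf i' => i = i'
  | leaf i, chain j => i = i₀ → l ≤ j + 2
  | chain _, leaf _ => False
  | chain j, chain j' => j ≤ j'

instance : PartialOrder (Node i₀ l) where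
  le := Le
  le_refl u := by cases u <;> simp [Le]
  le_trans u v w huv hvw := by
    cases u <;> cases v <;> cases w <;> simp only [Le] at * <;> grind
  le_antisymm u v huv hvu := by
    cases u <;> cases v <;> simp only [Le] at * <;> grind

lemma leaf_le_leaf {i i' : Fin t} : (leaf i : Node i₀ l) ≤ leaf i' ↔ i = i' := Iff.rfl

lemma leaf_le_chain {i : Fin t} {j : Fin l} :
    (leaf i : Node i₀ l) ≤ chain j ↔ (i = i₀ → l ≤ j + 2) := Iff.rfl

lemma not_chain_le_leaf {i : Fin t} {j : Fin l} : ¬ (chain j : Node i₀ l) ≤ leaf i := id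

lemma chain_le_chain {j j' : Fin l} : (chain j : Node i₀ l) ≤ chain j' ↔ j ≤ j' := Iff.rfl

lemma le_total_of_le {v a b : Node i₀ l} (ha : v ≤ a) (hb : v ≤ b) : a ≤ b ∨ b ≤ a := by
  cases a <;> cases b <;> cases v <;>
    simp only [leaf_le_leaf, leaf_le_chain, not_chain_le_leaf, chain_le_chain] at * <;> grind

lemma le_chain_last {j : Fin l} (hj : j.1 + 1 = l) (u : Node i₀ l) : u ≤ chain j := by
  cases u <;> simp only [leaf_le_chain, chain_le_chain, Fin.le_def] <;> omega

end Node

end Toupie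

namespace Toupie

variable {k : Type u} [Field k] (T : ToupieAlg k) (i₀ : Fin T.t)

/-- The paths to the sink that generate the component of the tilting module at a node. -/
def nodeGen : Node i₀ (T.ℓ i₀) → Set (Alg T)
  | .leaf i => {y | ∃ a < T.ℓ i, y = toSink T i a}
  | .chain j => {y | (∃ i, ∃ a < T.ℓ i, (i = i₀ → a ≤ j.1 + 1) ∧ y = toSink T i a) ∨
      (j.1 + 1 = T.ℓ i₀ ∧ y = einf T)}

/-- The component of the tilting module at a node. -/
def nodeSpan (u : Node i₀ (T.ℓ i₀)) : Submodule k (Alg T) := Submodule.span k (nodeGen T i₀ u)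

variable {T i₀}

lemma monotone_nodeSpan : Monotone (nodeSpan T i₀) := by
  intro u v huv
  refine Submodule.span_mono fun y hy => ?_
  cases u with
  | leaf i =>
    obtain ⟨a, ha, rfl⟩ := hy
    cases v with
    | leaf i' => exact (Node.leaf_le_leaf.1 huv) ▸ ⟨a, ha, rfl⟩
    | chain j =>
      refine Or.inl ⟨i, a, ha, fun hi => ?_, rfl⟩
      have := Node.leaf_le_chain.1 huv hi
      subst hi
      omega
  | chain j =>
    cases v with
    | leaf i' => exact (Node.not_chain_le_leaf huv).elim
    | chain j' =>
      have hjj : j.1 ≤ j'.1 := Node.chain_le_chain.1 huv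
      rcases hy with ⟨i, a, ha, hi, rfl⟩ | ⟨hj, rfl⟩
      · exact Or.inl ⟨i, a, ha, fun h => (hi h).trans (by omega), rfl⟩
      · exact Or.inr ⟨by have := j'.2; omega, rfl⟩

lemma toSink_mem_leaf {i : Fin T.t} {a : ℕ} (ha : a < T.ℓ i) :
    toSink T i a ∈ nodeSpan T i₀ (.leaf i) :=
  Submodule.subset_span ⟨a, ha, rfl⟩

lemma toSink_mem_chain {i : Fin T.t} {a : ℕ} (ha : a < T.ℓ i) {j : Fin (T.ℓ i₀)}
    (hi : i = i₀ → a ≤ j.1 + 1) : toSink T i a ∈ nodeSpan T i₀ (.chain j) :=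
  Submodule.subset_span (Or.inl ⟨i, a, ha, hi, rfl⟩)

lemma mul_mem_nodeSpan (x : Alg T) {u : Node i₀ (T.ℓ i₀)} {y : Alg T} (hy : y ∈ nodeSpan T i₀ u) :
    x * y ∈ nodeSpan T i₀ u := by
  suffices h : nodeSpan T i₀ u ≤ (nodeSpan T i₀ u).comap (LinearMap.mulLeft k x) from h hy
  refine Submodule.span_le.2 fun y hy => ?_
  change x * y ∈ nodeSpan T i₀ u
  cases u with
  | leaf i =>
    obtain ⟨a, ha, rfl⟩ := hy
    refine Submodule.span_le.2 ?_ (mul_toSink_mem x i ha)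
    rintro _ ⟨b, hb, rfl⟩
    exact toSink_mem_leaf (lt_of_le_of_lt hb ha)
  | chain j =>
    rcases hy with ⟨i, a, ha, hi, rfl⟩ | ⟨hj, rfl⟩
    · refine Submodule.span_le.2 ?_ (mul_toSink_mem x i ha)
      rintro _ ⟨b, hb, rfl⟩
      exact toSink_mem_chain (lt_of_le_of_lt hb ha) fun h => le_trans hb (hi h)
    · refine Submodule.span_le.2 ?_ (mul_einf_mem x)
      rintro _ (rfl | ⟨i, a, ha, rfl⟩)
      · exact Submodule.subset_span (Or.inr ⟨hj, rfl⟩)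
      · refine toSink_mem_chain ha fun h => ?_
        subst h
        omega

lemma mul_einf_of_mem_nodeSpan {u : Node i₀ (T.ℓ i₀)} {y : Alg T} (hy : y ∈ nodeSpan T i₀ u) :
    y * einf T = y := by
  suffices h : nodeSpan T i₀ u ≤
      LinearMap.eqLocus (LinearMap.mulRight k (einf T)) LinearMap.id from h hy
  refine Submodule.span_le.2 fun y hy => ?_
  change y * einf T = y
  cases u with
  | leaf i =>
    obtain ⟨a, ha, rfl⟩ := hy
    exact toSink_mul_einf i ha
  | chain j =>
    rcases hy with ⟨i, a, ha, -, rfl⟩ | ⟨-, rfl⟩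
    · exact toSink_mul_einf i ha
    · exact einf_mul_einf

/-- The elements of `nodeSpan` at the leaf `i` decompose along `colSpan`. -/
lemma nodeSpan_leaf_le_colSpan {i : Fin T.t} {a : ℕ} (ha : T.ℓ i ≤ a + 1) :
    nodeSpan T i₀ (.leaf i) ≤ colSpan T i a := by
  refine Submodule.span_le.2 ?_
  rintro _ ⟨b, hb, rfl⟩
  exact toSink_mem_colSpan i (by omega)

variable (T i₀) in
/-- The tilting module. -/
abbrev nodeMod : Submodule (IncAlg k (Node i₀ (T.ℓ i₀)))ᵐᵒᵖ (Row k (Node i₀ (T.ℓ i₀)) (Alg T)) :=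
  subMod (nodeSpan T i₀) monotone_nodeSpan

variable (T i₀) in
/-- The action of the algebra on the tilting module by left multiplication. -/
def nodeRep : Alg T →+* Module.End (IncAlg k (Node i₀ (T.ℓ i₀)))ᵐᵒᵖ (nodeMod T i₀) where
  toFun x := subMap monotone_nodeSpan monotone_nodeSpan (LinearMap.mulLeft k x)
    fun _ _ hy => mul_mem_nodeSpan x hy
  map_one' := LinearMap.ext fun F => Subtype.ext (funext fun u => one_mul (F.1 u))
  map_mul' x y := LinearMap.ext fun F => Subtype.ext (funext fun u => mul_assoc x y (F.1 u))
  map_zero' := LinearMap.ext fun F => Subtype.ext (funext fun u => zero_mul (F.1 u))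
  map_add' x y := LinearMap.ext fun F => Subtype.ext (funext fun u => add_mul x y (F.1 u))

lemma nodeRep_apply (x : Alg T) (F : nodeMod T i₀) (u : Node i₀ (T.ℓ i₀)) :
    (nodeRep T i₀ x F).1 u = x * F.1 u := rfl

end Toupie

namespace Toupie

variable {k : Type u} [Field k] {T : ToupieAlg k} {lam : Fin T.t → k} {i₀ : Fin T.t}

/-- The component at an interior element of the chain is spanned by its intersections with the
components at the leaves. -/
lemma exists_sum_of_mem_chain {c : Fin (T.ℓ i₀)} (hc : c.1 + 1 < T.ℓ i₀) {y : Alg T}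
    (hy : y ∈ nodeSpan T i₀ (.chain c)) :
    ∃ m : Fin T.t → Alg T, (∀ i, m i ∈ nodeSpan T i₀ (.leaf i) ⊓ nodeSpan T i₀ (.chain c)) ∧
      ∑ i, m i = y := by
  have h : nodeSpan T i₀ (.chain c) ≤ ⨆ i, nodeSpan T i₀ (.leaf i) ⊓ nodeSpan T i₀ (.chain c) := by
    refine Submodule.span_le.2 ?_
    rintro _ (⟨i, a, ha, hi, rfl⟩ | ⟨hd', rfl⟩)
    · exact Submodule.mem_iSup_of_mem i ⟨toSink_mem_leaf ha, toSink_mem_chain ha hi⟩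
    · omega
  obtain ⟨f, hf, hfy⟩ := (Submodule.mem_iSup_iff_exists_finsupp _ _).1 (h hy)
  exact ⟨f, hf, by rw [← hfy, Finsupp.sum_fintype _ _ fun _ => rfl]⟩

section Lift

variable {x : Node i₀ (T.ℓ i₀)} {D : Type u} [AddCommGroup D] [Module k D]
  {Z : Node i₀ (T.ℓ i₀) → Submodule k D} {p : D →ₗ[k] Alg T} {j : nodeSpan T i₀ x →ₗ[k] D}

lemma exists_lift_inf (h2 : 2 ≤ T.ℓ i₀) (hZ : Monotone Z)
    (hsurj : ∀ u, ∀ y ∈ nodeSpan T i₀ u, ∃ d ∈ Z u, p d = y)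
    (hker : ∀ u, ∀ d ∈ Z u, p d = 0 → ∃ y : nodeSpan T i₀ x, y.1 ∈ nodeSpan T i₀ u ∧ j y = d)
    (hj : ∀ u (y : nodeSpan T i₀ x), y.1 ∈ nodeSpan T i₀ u → j y ∈ Z u)
    (hpj : ∀ y, p (j y) = 0) (hx : ∀ u, u ≤ x) {i : Fin T.t} {c : Fin (T.ℓ i₀)}
    (hc : c.1 + 1 < T.ℓ i₀) {y : Alg T} (hy : y ∈ nodeSpan T i₀ (.leaf i))
    (hyc : y ∈ nodeSpan T i₀ (.chain c)) : ∃ d ∈ Z (.leaf i) ⊓ Z (.chain c), p d = y := by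
  obtain ⟨d, hd, rfl⟩ := hsurj _ _ hy
  by_cases hi : i = i₀
  · subst hi
    obtain ⟨d', hd', hdd⟩ := hsurj _ _ hyc
    have hc' : Node.chain c ≤ (Node.chain ⟨T.ℓ i - 2, by omega⟩ : Node i (T.ℓ i)) :=
      Node.chain_le_chain.2 (Fin.le_def.2 (by simp only; omega))
    have hl' : Node.leaf i ≤ (Node.chain ⟨T.ℓ i - 2, by omega⟩ : Node i (T.ℓ i)) :=
      Node.leaf_le_chain.2 fun _ => by simp only; omega
    obtain ⟨m, hm, hjm⟩ := hker (.chain ⟨T.ℓ i - 2, by omega⟩) (d - d')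
      (Submodule.sub_mem _ (hZ hl' hd) (hZ hc' hd')) (by rw [map_sub, hdd, sub_self])
    have hsup : m.1 ∈ nodeSpan T i (.leaf i) ⊔ nodeSpan T i (.chain c) := by
      refine Submodule.span_le.2 ?_ hm
      rintro _ (⟨i', a, ha, -, rfl⟩ | ⟨hd', rfl⟩)
      · by_cases h : i' = i
        · subst h
          exact Submodule.mem_sup_left (toSink_mem_leaf ha)
        · exact Submodule.mem_sup_right (toSink_mem_chain ha fun h' => (h h').elim)
      · simp only at hd'
        omega
    obtain ⟨m₁, hm₁, m₂, hm₂, hmm⟩ := Submodule.mem_sup.1 hsup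
    have hj₁ := hj _ ⟨m₁, monotone_nodeSpan (hx _) hm₁⟩ hm₁
    have hj₂ := hj _ ⟨m₂, monotone_nodeSpan (hx _) hm₂⟩ hm₂
    refine ⟨d - j ⟨m₁, monotone_nodeSpan (hx _) hm₁⟩, ⟨Submodule.sub_mem _ hd hj₁, ?_⟩, ?_⟩
    · have : d - j ⟨m₁, monotone_nodeSpan (hx _) hm₁⟩ =
          d' + j ⟨m₂, monotone_nodeSpan (hx _) hm₂⟩ := by
        have h1 : m = ⟨m₁, monotone_nodeSpan (hx _) hm₁⟩ + ⟨m₂, monotone_nodeSpan (hx _) hm₂⟩ :=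
          Subtype.ext hmm.symm
        rw [h1, map_add] at hjm
        rw [sub_eq_iff_eq_add, add_assoc, add_comm (j _) (j _), hjm, add_sub_cancel]
      rw [this]
      exact Submodule.add_mem _ hd' hj₂
    · rw [map_sub, hpj, sub_zero]
  · exact ⟨d, ⟨hd, hZ (Node.leaf_le_chain.2 fun h => (hi h).elim) hd⟩, rfl⟩

end Lift

namespace OneRel

/-- The module `nodeMod` has no self-extensions. -/
lemma liftsTo_nodeSpan (h : OneRel T lam) (h2 : ∀ i, i ≠ i₀ → T.ℓ i = 2) {c : Fin (T.ℓ i₀)}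
    (hc : c.1 + 1 = T.ℓ i₀) : LiftsTo (nodeSpan T i₀) (.chain c) := by
  intro D _ _ Z p j hZ hsurj hker hj hpj
  have hx := Node.le_chain_last (i₀ := i₀) hc
  have hl : 2 ≤ T.ℓ i₀ := h.two_le i₀
  have hlift := fun {i c y} => exists_lift_inf (i := i) (c := c) (y := y) hl hZ hsurj hker hj hpj hx
  have hbase : ∃ f : Fin T.t → D, (∀ i, f i ∈ Z (.leaf i) ⊓ Z (.chain ⟨0, by omega⟩)) ∧
      (∀ i, p (f i) = toSink T i 0) ∧ ∑ i, lam i • f i = 0 := by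
    have h1 : ∀ i, ∃ d ∈ Z (.leaf i) ⊓ Z (.chain ⟨0, by omega⟩), p d = toSink T i 0 := fun i =>
      hlift (by simp only; omega) (toSink_mem_leaf (T.hℓ i))
        (toSink_mem_chain (T.hℓ i) fun _ => Nat.zero_le _)
    choose d hd hpd using h1
    obtain ⟨m, hm, hjm⟩ := hker (.chain ⟨0, by omega⟩) (∑ i, lam i • d i)
      (Submodule.sum_mem _ fun i _ => Submodule.smul_mem _ _ (hd i).2) (by
        simp only [map_sum, map_smul, hpd, h.sum_smul_toSink])
    obtain ⟨m', hm', hmm⟩ := exists_sum_of_mem_chain (c := ⟨0, by omega⟩) (by simp only; omega) hm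
    have hm'' : ∀ i, m' i ∈ nodeSpan T i₀ (.chain c) := fun i => monotone_nodeSpan (hx _) (hm' i).1
    have hm0 : m = ∑ i, ⟨m' i, hm'' i⟩ := Subtype.ext (by
      rw [← hmm, AddSubmonoidClass.coe_finsetSum])
    refine ⟨fun i => d i - (lam i)⁻¹ • j ⟨m' i, hm'' i⟩, fun i => ?_, fun i => ?_, ?_⟩
    · exact Submodule.sub_mem _ (hd i) (Submodule.smul_mem _ _ ⟨hj _ _ (hm' i).1, hj _ _ (hm' i).2⟩)
    · rw [map_sub, map_smul, hpj, smul_zero, sub_zero, hpd]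
    · simp only [smul_sub, Finset.sum_sub_distrib, smul_inv_smul₀ (h.ne_zero _)]
      rw [← hjm, hm0, map_sum, sub_self]
  obtain ⟨f₀, hf₀, hpf₀, hsum⟩ := hbase
  have hpos : ∀ i b, ∃ d, 0 < b → b < T.ℓ i → p d = toSink T i b ∧ d ∈ Z (.leaf i) ∧
      ∀ c' : Fin (T.ℓ i₀), i = i₀ → b ≤ c'.1 + 1 → d ∈ Z (.chain c') := by
    intro i b
    by_cases hb : 0 < b ∧ b < T.ℓ i
    · have hbl : b - 1 + 1 < T.ℓ i₀ := by
        by_cases hi : i = i₀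
        · subst hi
          omega
        · have := h2 i hi
          omega
      obtain ⟨d, hd, hpd⟩ := hlift (c := ⟨b - 1, by omega⟩) hbl (toSink_mem_leaf hb.2)
        (toSink_mem_chain hb.2 fun _ => by simp only; omega)
      refine ⟨d, fun _ _ => ⟨hpd, hd.1, fun c' _ hbc => hZ (Node.chain_le_chain.2 ?_) hd.2⟩⟩
      rw [Fin.le_def]
      simp only
      omega
    · exact ⟨0, fun h1 h2 => (hb ⟨h1, h2⟩).elim⟩
  choose f hf using hpos
  obtain ⟨z, hz, hpz⟩ := hsurj (.chain c) (einf T) (Submodule.subset_span (Or.inr ⟨hc, rfl⟩))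
  obtain ⟨s, hsz, hs⟩ := h.exists_linearMap i₀ z (fun i b => if b = 0 then f₀ i else f i b) (by
    simpa using hsum)
  have hps : ∀ i, ∀ b < T.ℓ i, p (s (toSink T i b)) = toSink T i b := by
    intro i b hb
    rw [hs i b hb]
    split_ifs with h0
    · rw [hpf₀, h0]
    · exact (hf i b (Nat.pos_of_ne_zero h0) hb).1
  have hleaf : ∀ i, ∀ b < T.ℓ i, s (toSink T i b) ∈ Z (.leaf i) := by
    intro i b hb
    rw [hs i b hb]
    split_ifs with h0
    · exact (hf₀ i).1
    · exact (hf i b (Nat.pos_of_ne_zero h0) hb).2.1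
  refine ⟨s, fun u => ?_, ?_⟩
  · suffices hle : nodeSpan T i₀ u ≤ (Z u).comap s from fun y hy => hle hy
    refine Submodule.span_le.2 fun y hy => ?_
    change s y ∈ Z u
    cases u with
    | leaf i =>
      obtain ⟨a, ha, rfl⟩ := hy
      exact hleaf i a ha
    | chain c' =>
      rcases hy with ⟨i, a, ha, hi, rfl⟩ | ⟨hc', rfl⟩
      · by_cases hi₀ : i = i₀
        · rw [hs i a ha]
          split_ifs with h0
          · exact hZ (Node.chain_le_chain.2 (Fin.le_def.2 (Nat.zero_le _))) (hf₀ i).2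
          · exact (hf i a (Nat.pos_of_ne_zero h0) ha).2.2 c' hi₀ (hi hi₀)
        · exact hZ (Node.leaf_le_chain.2 fun h => (hi₀ h).elim) (hleaf i a ha)
      · obtain rfl : c' = c := Fin.ext (by omega)
        rwa [hsz]
  · suffices hle : nodeSpan T i₀ (.chain c) ≤ LinearMap.eqLocus (p.comp s) LinearMap.id from
      fun y hy => hle hy
    refine Submodule.span_le.2 ?_
    rintro _ (⟨i, a, ha, -, rfl⟩ | ⟨-, rfl⟩)
    · exact hps i a ha
    · change p (s (einf T)) = einf T
      rw [hsz, hpz]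

end OneRel

end Toupie

namespace Toupie

variable {k : Type u} [Field k] {T : ToupieAlg k} {lam : Fin T.t → k} {i₀ : Fin T.t}

namespace OneRel

lemma mem_colSpan_of_mem_inf (h : OneRel T lam) {a : ℕ} {c : Fin (T.ℓ i₀)} (hca : c.1 + 1 = a)
    {y : Alg T} (hy : y ∈ nodeSpan T i₀ (.leaf i₀)) (hyc : y ∈ nodeSpan T i₀ (.chain c)) :
    y ∈ colSpan T i₀ a := by
  obtain ⟨g, hg, hgs⟩ := h.exists_linearMap i₀ (0 : Alg T)
    (fun i b => if i = i₀ ∧ a < b then toSink T i b else 0) (by simp)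
  have h1 : nodeSpan T i₀ (.chain c) ≤ LinearMap.ker g := by
    refine Submodule.span_le.2 ?_
    rintro _ (⟨i, b, hb, hi, rfl⟩ | ⟨-, rfl⟩)
    · refine LinearMap.mem_ker.2 ?_
      rw [hgs i b hb, if_neg]
      rintro ⟨rfl, hab⟩
      have := hi rfl
      omega
    · exact hg
  have h2 : nodeSpan T i₀ (.leaf i₀) ≤ (colSpan T i₀ a).comap (LinearMap.id - g) := by
    refine Submodule.span_le.2 ?_
    rintro _ ⟨b, hb, rfl⟩
    change toSink T i₀ b - g (toSink T i₀ b) ∈ colSpan T i₀ a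
    rw [hgs i₀ b hb]
    split_ifs with hab
    · rw [sub_self]
      exact Submodule.zero_mem _
    · rw [sub_zero]
      exact toSink_mem_colSpan i₀ (not_lt.1 fun h' => hab ⟨rfl, h'⟩)
  have h3 : y - g y ∈ colSpan T i₀ a := h2 hy
  rwa [LinearMap.mem_ker.1 (h1 hyc), sub_zero] at h3

lemma nodeRep_injective (h : OneRel T lam) : Function.Injective (nodeRep T i₀) := by
  refine (injective_iff_map_eq_zero _).2 fun x hx => ?_
  have h1 : ∀ u, ∀ y ∈ nodeSpan T i₀ u, x * y = 0 := by
    intro u y hy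
    have h2 := nodeRep_apply x (subSingle monotone_nodeSpan u ⟨y, hy⟩) u
    rw [hx, subSingle_apply_self] at h2
    exact h2.symm
  have hl := h.two_le i₀
  refine h.eq_zero_of_mul_einf x (fun i b hb => h1 (.leaf i) _ (toSink_mem_leaf hb))
    (h1 (.chain ⟨T.ℓ i₀ - 1, by omega⟩) _ (Submodule.subset_span (Or.inr ⟨?_, rfl⟩)))
  simp only
  omega

lemma nodeRep_surjective (h : OneRel T lam) (h2 : ∀ i, i ≠ i₀ → T.ℓ i = 2) :
    Function.Surjective (nodeRep T i₀) := by
  intro g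
  have hl := h.two_le i₀
  obtain ⟨c, hc⟩ : ∃ c : Fin (T.ℓ i₀), c.1 + 1 = T.ℓ i₀ :=
    ⟨⟨T.ℓ i₀ - 1, by omega⟩, by simp only; omega⟩
  have hx := Node.le_chain_last (i₀ := i₀) hc
  obtain ⟨g', hg'⟩ := exists_linearMap_of_end hx g
  have hmem : ∀ u, ∀ y ∈ nodeSpan T i₀ u, g' y ∈ nodeSpan T i₀ u := by
    intro u y hy
    have h1 := hg' (subSingle monotone_nodeSpan u ⟨y, hy⟩) u
    rw [subSingle_apply_self] at h1
    rw [← h1]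
    exact (g _).2 u
  have hinf : einf T ∈ nodeSpan T i₀ (.chain c) := Submodule.subset_span (Or.inr ⟨hc, rfl⟩)
  have hcol : ∀ i a, a < T.ℓ i → g' (toSink T i a) ∈ colSpan T i (max a 1) := by
    intro i a ha
    by_cases hi : i = i₀
    · subst hi
      refine h.mem_colSpan_of_mem_inf (c := ⟨max a 1 - 1, by omega⟩) (by simp only; omega)
        (hmem _ _ (toSink_mem_leaf ha)) (hmem _ _ (toSink_mem_chain ha fun _ => ?_))
      simp only
      omega
    · exact nodeSpan_leaf_le_colSpan (by have := h2 i hi; omega) (hmem _ _ (toSink_mem_leaf ha))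
  obtain ⟨x, hxe, hxs⟩ := h.exists_mul_eq g'
    (fun i => by simpa using hcol i 0 (T.hℓ i))
    (fun i a h0 ha => by simpa [max_eq_left (Nat.one_le_iff_ne_zero.2 h0.ne')] using hcol i a ha)
    (mul_einf_of_mem_nodeSpan (hmem _ _ hinf))
  have hxg : nodeSpan T i₀ (.chain c) ≤ LinearMap.eqLocus (LinearMap.mulLeft k x) g' := by
    refine Submodule.span_le.2 ?_
    rintro _ (⟨i, a, ha, -, rfl⟩ | ⟨-, rfl⟩)
    · exact hxs i a ha
    · exact hxe
  refine ⟨x, LinearMap.ext fun F => Subtype.ext (funext fun u => ?_)⟩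
  rw [nodeRep_apply, hg']
  exact hxg (monotone_nodeSpan (hx u) (F.2 u))

end OneRel

end Toupie

namespace Toupie

section Acyclic

variable {k : Type u} [Field k] {t : ℕ} {ℓ : Fin t → ℕ}

/-- A height function on the vertices that increases along the arrows. -/
def Vtx.height : Vtx t ℓ → ℕ
  | .src => 0
  | .mid _ a => a.1 + 1
  | .snk => ∑ j, ℓ j

lemma Vtx.height_vtx (i : Fin t) {a : ℕ} (ha : a < ℓ i) : (vtx t ℓ i a).height = a := by
  rcases Nat.eq_zero_or_pos a with rfl | h0
  · rw [vtx_zero]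
    rfl
  · rw [vtx_mid i a h0 (by omega)]
    change a - 1 + 1 = a
    omega

lemma Vtx.height_le (v : Vtx t ℓ) : v.height ≤ ∑ j, ℓ j := by
  cases v with
  | src => exact Nat.zero_le _
  | snk => exact le_rfl
  | mid i a =>
    have h1 := Finset.single_le_sum (f := ℓ) (fun _ _ => Nat.zero_le _) (Finset.mem_univ i)
    have h2 := a.2
    change a.1 + 1 ≤ _
    omega

lemma Vtx.height_vtx_lt (i : Fin t) {a b : ℕ} (hab : a < b) (hb : b ≤ ℓ i) :
    (vtx t ℓ i a).height < (vtx t ℓ i b).height := by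
  rw [height_vtx i (hab.trans_le hb)]
  rcases hb.eq_or_lt with rfl | hb
  · rw [vtx_last i (by omega)]
    exact hab.trans_le
      (Finset.single_le_sum (f := ℓ) (fun _ _ => Nat.zero_le _) (Finset.mem_univ i))
  · rwa [height_vtx i hb]

lemma height_lt_of_theta_ne_zero (hℓ : ∀ i, 1 ≤ ℓ i) (i : Fin t) (x : PathAlg k t ℓ)
    {u v : Vtx t ℓ} (h : theta hℓ i x u v ≠ 0) (huv : u ≠ v) : u.height < v.height := by
  obtain ⟨a, b, hab, hb, rfl, rfl⟩ := exists_of_theta_ne_zero hℓ i x h huv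
  exact Vtx.height_vtx_lt i hab hb

lemma height_add_le_of_pow_ne_zero (hℓ : ∀ i, 1 ≤ ℓ i) (i : Fin t) (x : PathAlg k t ℓ)
    (hx : ∀ v, theta hℓ i x v v = 0) (n : ℕ) {u v : Vtx t ℓ} (h : (theta hℓ i x ^ n) u v ≠ 0) :
    u.height + n ≤ v.height := by
  induction n generalizing u v with
  | zero =>
    rw [pow_zero, Matrix.one_apply] at h
    rw [add_zero, (ite_ne_right_iff.1 h).1]
  | succ n ih =>
    rw [pow_succ, Matrix.mul_apply] at h
    obtain ⟨w, -, hw⟩ := Finset.exists_ne_zero_of_sum_ne_zero h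
    have h1 := ih (left_ne_zero_of_mul hw)
    have h2 := height_lt_of_theta_ne_zero hℓ i x (right_ne_zero_of_mul hw) fun hwv =>
      right_ne_zero_of_mul hw (hwv ▸ hx w)
    omega

lemma pow_eq_zero_of_theta_diag (hℓ : ∀ i, 1 ≤ ℓ i) (i₀ : Fin t) (x : PathAlg k t ℓ)
    (hx : ∀ v, theta hℓ i₀ x v v = 0) : x ^ (∑ j, ℓ j + 1) = 0 := by
  refine theta_ext hℓ i₀ fun i => ?_
  rw [map_pow, map_zero]
  ext u v
  by_contra h
  have h1 := height_add_le_of_pow_ne_zero hℓ i x (fun v => by rw [theta_diag_eq hℓ i i₀, hx]) _ h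
  have h2 := v.height_le
  omega

lemma exists_eV_mul_mul_eV (hℓ : ∀ i, 1 ≤ ℓ i) (i₀ : Fin t) (x : PathAlg k t ℓ) (v : Vtx t ℓ) :
    eV v * x * eV v = theta hℓ i₀ x v v • (eV v : PathAlg k t ℓ) := by
  refine theta_ext hℓ i₀ fun i => ?_
  rw [theta_sandwich, map_smul, theta_eV, Matrix.smul_single, theta_diag_eq hℓ i i₀, smul_eq_mul,
    mul_one]

lemma eV_mul_mul_eV_mul_mul_eV (hℓ : ∀ i, 1 ≤ ℓ i) (i₀ : Fin t) (x y : PathAlg k t ℓ)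
    {v w : Vtx t ℓ} (hvw : v ≠ w) : eV v * x * eV w * y * eV v = 0 := by
  refine theta_ext hℓ i₀ fun i => ?_
  have h1 : (eV v * x * eV w * y * eV v : PathAlg k t ℓ) =
      (eV v * x * eV w) * (eV w * y * eV v) := by
    simp only [mul_assoc]
    rw [← mul_assoc (eV w) (eV w), eV_mul_self]
  rw [h1, map_mul, theta_sandwich, theta_sandwich, Matrix.single_mul_single_same, map_zero]
  by_cases h : theta hℓ i x v w = 0
  · rw [h, zero_mul, Matrix.single_zero]
  by_cases h' : theta hℓ i y w v = 0
  · rw [h', mul_zero, Matrix.single_zero]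
  · exact (lt_asymm (height_lt_of_theta_ne_zero hℓ i x h hvw)
      (height_lt_of_theta_ne_zero hℓ i y h' hvw.symm)).elim

end Acyclic

section Count

variable {t : ℕ} {ℓ : Fin t → ℕ}

/-- The vertices as the two extremal ones together with the interior ones. -/
def Vtx.equivOption : Vtx t ℓ ≃ Option (Option (Σ i, Fin (ℓ i - 1))) where
  toFun
    | .src => none
    | .snk => some none
    | .mid i a => some (some ⟨i, a⟩)
  invFun
    | none => .src
    | some none => .snk
    | some (some x) => .mid x.1 x.2
  left_inv v := by cases v <;> rfl
  right_inv x := by rcases x with _ | _ | x <;> rfl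

lemma Vtx.card_eq (i₀ : Fin t) (h1 : 1 ≤ ℓ i₀) (h2 : ∀ i, i ≠ i₀ → ℓ i = 2) :
    Fintype.card (Vtx t ℓ) = t + ℓ i₀ := by
  rw [Fintype.card_congr Vtx.equivOption, Fintype.card_option, Fintype.card_option,
    Fintype.card_sigma]
  simp only [Fintype.card_fin]
  rw [← Finset.add_sum_erase _ _ (Finset.mem_univ i₀), Finset.sum_congr rfl (g := fun _ => 1)
    fun i hi => by rw [h2 i (Finset.ne_of_mem_erase hi)], Finset.sum_const,
    Finset.card_erase_of_mem (Finset.mem_univ _), Finset.card_univ, Fintype.card_fin, smul_eq_mul]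
  have := i₀.2
  omega

end Count

variable {k : Type u} [Field k] {T : ToupieAlg k}

instance : FiniteDimensional k (Alg T) := by
  have : FiniteDimensional k (PathAlg k T.t T.ℓ) :=
    inferInstanceAs (FiniteDimensional k (Subalgebra.toSubmodule (PathAlg k T.t T.ℓ)))
  exact Module.Finite.of_surjective (mkHom T).toLinearMap (mkHom_surjective T)

lemma mkHom_eV_ne_zero (v : Vtx T.t T.ℓ) : mkHom T (eV v) ≠ 0 := by
  intro hv
  have h1 := (theta_of_mem_I T ((mkHom_eq_zero_iff T _).1 hv) ⟨0, by have := T.ht; omega⟩).1 v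
  rw [theta_eV, Matrix.single_apply_same] at h1
  exact one_ne_zero h1

lemma eq_zero_of_idempotent (i₀ : Fin T.t) {p : Alg T} (hp : p * p = p)
    (hv : ∀ v, mkHom T (eV v) * p * mkHom T (eV v) = 0) : p = 0 := by
  obtain ⟨x, rfl⟩ := mkHom_surjective T p
  have h1 : ∀ v, theta T.hℓ i₀ x v v = 0 := by
    intro v
    have h2 := hv v
    rw [← map_mul, ← map_mul, mkHom_eq_zero_iff] at h2
    simpa [theta_sandwich] using (theta_of_mem_I T h2 i₀).1 v
  have h3 := congrArg (mkHom T) (pow_eq_zero_of_theta_diag T.hℓ i₀ x h1)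
  rwa [map_pow, IsIdempotentElem.pow_succ_eq _ hp, map_zero] at h3

end Toupie

namespace Toupie

variable {k : Type u} [Field k] {T : ToupieAlg k} {lam : Fin T.t → k} {i₀ : Fin T.t}

namespace OneRel

variable (h : OneRel T lam)
include h

lemma isTiltingMod_nodeMod (h2 : ∀ i, i ≠ i₀ → T.ℓ i = 2) :
    IsTiltingMod (IncAlg k (Node i₀ (T.ℓ i₀)))ᵐᵒᵖ (nodeMod T i₀) := by
  have hl := h.two_le i₀
  obtain ⟨c, hc⟩ : ∃ c : Fin (T.ℓ i₀), c.1 + 1 = T.ℓ i₀ :=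
    ⟨⟨T.ℓ i₀ - 1, by omega⟩, by simp only; omega⟩
  refine ⟨finite_subMod, selfExtVanish_subMod (Node.le_chain_last hc) (h.liftsTo_nodeSpan h2 hc),
    Fintype.card (Node i₀ (T.ℓ i₀)), ?_, numClasses_isSimpleModule k _⟩
  rw [Node.card, ← Vtx.card_eq i₀ (T.hℓ i₀) h2]
  refine numClasses_summands (k := k) (RingEquiv.ofBijective (nodeRep T i₀)
    ⟨h.nodeRep_injective, h.nodeRep_surjective h2⟩) (fun v => mkHom T (eV v)) (fun v => ?_)
    mkHom_eV_ne_zero (fun v a => ?_) (fun v w a b hvw => ?_)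
    (fun p hp hv => eq_zero_of_idempotent i₀ hp hv)
  · rw [mkHom_eV_mul, if_pos rfl]
  · obtain ⟨x, rfl⟩ := mkHom_surjective T a
    refine ⟨theta T.hℓ i₀ x v v, ?_⟩
    rw [← map_mul, ← map_mul, exists_eV_mul_mul_eV T.hℓ i₀, map_smul]
  · obtain ⟨x, rfl⟩ := mkHom_surjective T a
    obtain ⟨y, rfl⟩ := mkHom_surjective T b
    simp only [← map_mul]
    rw [eV_mul_mul_eV_mul_mul_eV T.hℓ i₀ x y hvw, map_zero]

/-- If at most one branch is long, the algebra is tilted. -/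
lemma isTilted (h2 : ∀ i, i ≠ i₀ → T.ℓ i = 2) : IsTilted k (Alg T) := by
  refine ⟨IncAlg k (Node i₀ (T.ℓ i₀)), inferInstance, inferInstance, inferInstance,
    hereditary_incAlg fun _ _ _ => Node.le_total_of_le, nodeMod T i₀, inferInstance,
    inferInstance, h.isTiltingMod_nodeMod h2, inferInstance, inferInstance, inferInstance,
    RingEquiv.ofBijective (nodeRep T i₀) ⟨h.nodeRep_injective, h.nodeRep_surjective h2⟩,
    fun c x => LinearMap.ext fun F => Subtype.ext (funext fun u => smul_mul_assoc c x (F.1 u))⟩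

end OneRel

lemma exists_ne_ne {n : ℕ} (hn : 4 ≤ n) (i j : Fin n) :
    ∃ p q : Fin n, p ≠ q ∧ p ≠ i ∧ p ≠ j ∧ q ≠ i ∧ q ≠ j := by
  have h : 1 < (Finset.univ \ {i, j} : Finset (Fin n)).card := by
    have h1 := Finset.le_card_sdiff ({i, j} : Finset (Fin n)) Finset.univ
    have h2 := Finset.card_le_two (a := i) (b := j)
    rw [Finset.card_univ, Fintype.card_fin] at h1
    omega
  obtain ⟨p, hp, q, hq, hpq⟩ := Finset.one_lt_card.1 h
  simp only [Finset.mem_sdiff, Finset.mem_univ, true_and, Finset.mem_insert,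
    Finset.mem_singleton, not_or] at hp hq
  exact ⟨p, q, hpq, hp.1, hp.2, hq.1, hq.2⟩

end Toupie

namespace Toupie

/-- Let `A = kQ/I` be a simply connected toupie algebra with
`m = dim_k e₀ A e∞ ≥ 3` and `t = m + 1` branches.  If at least two branches have length
at least three then `A` is not a laura algebra, and if at most one branch has length at
least three then `A` is tilted. -/
theorem t_eq_m_add_one_dichotomy {k : Type u} [Field k] (T : ToupieAlg k)
    (hsc : SimplyConnected T) (hm : 3 ≤ mDim T) (ht : T.t = mDim T + 1) :
    ((∃ i j : Fin T.t, i ≠ j ∧ 3 ≤ T.ℓ i ∧ 3 ≤ T.ℓ j) → ¬ Laura (Alg T)ᵐᵒᵖ) ∧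
      (AtMostOneLongBranch T → IsTilted k (Alg T)) := by
  obtain ⟨lam, h⟩ := exists_oneRel T hsc ht
  refine ⟨fun ⟨i, j, hij, hi, hj⟩ => ?_, fun hA => ?_⟩
  · obtain ⟨p, q, hpq, hpi, hpj, hqi, hqj⟩ := exists_ne_ne (by omega) i j
    exact h.not_laura hpq hpi hpj hqi hqj hij hi hj
  · obtain ⟨i₀, h₀⟩ : ∃ i₀ : Fin T.t, ∀ i, i ≠ i₀ → T.ℓ i < 3 := by
      by_cases hl : ∃ i, 3 ≤ T.ℓ i
      · obtain ⟨i₀, hi₀⟩ := hl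
        exact ⟨i₀, fun i hi => not_le.1 fun h3 => hi (hA i i₀ h3 hi₀)⟩
      · push Not at hl
        exact ⟨⟨0, by omega⟩, fun i _ => hl i⟩
    exact h.isTilted (i₀ := i₀) fun i hi => le_antisymm (Nat.le_of_lt_succ (h₀ i hi)) (h.two_le i)

end Toupie
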